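/- arXiv:1508.06035 — 3 statements merged into one kernel-verified Lean document; each statement's English description precedes it below -/
import Mathlib

section
/- Let S be a compact, orientable, two-dimensional embedded C^∞ submanifold of ℝ³ without boundary with smooth unit normal field n. There exist constants c > 0 and h₀ > 0, depending only on S and γ₀, such that for every admissible quasi-uniform triangulation T_h with h ≤ h₀: (i) every point x ∈ S_h satisfies dist(x, S) ≤ c h²; and (ii) for every triangle τ ∈ T_h there is a choice of unit normal ν_τ of the plane of τ such that ‖ν_τ − n(a(x))‖ ≤ c h for every x ∈ τ. -/
open MeasureTheory Metric
open scoped RealInnerProductSpace ENNReal NNReal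

noncomputable section

/-- Ambient Euclidean space `ℝ³`. -/
abbrev E3 : Type := EuclideanSpace ℝ (Fin 3)

/-- The tangential gradient of `w : E3 → ℝ` along the set `A` at `x`, with values projected
onto the subspace `P`: the orthogonal projection onto `P` of the Riesz representative of the
derivative of `w` within `A` at `x`. -/
def tGrad (A : Set E3) (P : Submodule ℝ E3) (w : E3 → ℝ) (x : E3) : E3 :=
  (Submodule.orthogonalProjectionOnto P ((InnerProductSpace.toDual ℝ E3).symm (fderivWithin ℝ w A x)) : E3)

/-- A compact, orientable, two-dimensional embedded `C^∞` submanifold of `ℝ³` without boundary,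
described by a global smooth unit normal field `n` and local smooth regular defining functions. -/
structure SmoothSurface where
  S : Set E3
  n : E3 → E3
  compact : IsCompact S
  nonempty : S.Nonempty
  localLevel : ∀ x ∈ S, ∃ U : Set E3, ∃ F : E3 → ℝ, IsOpen U ∧ x ∈ U ∧
    ContDiff ℝ (⊤ : ℕ∞) F ∧ S ∩ U = {y ∈ U | F y = 0} ∧
    (∀ y ∈ U, gradient F y ≠ 0) ∧
    (∀ y, y ∈ S ∩ U → ∃ t : ℝ, gradient F y = t • n y)
  n_unit : ∀ x ∈ S, ‖n x‖ = 1
  n_smooth : ∃ U : Set E3, IsOpen U ∧ S ⊆ U ∧ ContDiffOn ℝ (⊤ : ℕ∞) n U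

namespace SmoothSurface

variable (Srf : SmoothSurface)

/-- The tangent plane of `S` at `x`, as the orthogonal complement of the normal. -/
def tangent (x : E3) : Submodule ℝ E3 := (ℝ ∙ Srf.n x)ᗮ

/-- The tangential gradient `∇_S w` on the surface. -/
def grad (w : E3 → ℝ) (x : E3) : E3 := tGrad Srf.S (Srf.tangent x) w x

/-- The bilinear form `a(v,w) = ∫_S (⟨∇_S v, ∇_S w⟩ + v w)` (w.r.t. 2-dimensional
Hausdorff measure on `S`). -/
def aForm (v w : E3 → ℝ) : ℝ :=
  ∫ x in Srf.S, (⟪Srf.grad v x, Srf.grad w x⟫ + v x * w x) ∂μH[2]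

end SmoothSurface

/-- The (closed, flat) triangle with vertices `t.1, t.2.1, t.2.2`. -/
def triOf (t : E3 × E3 × E3) : Set E3 := convexHull ℝ {t.1, t.2.1, t.2.2}

/-- The vertex set of a triangle. -/
def vertsOf (t : E3 × E3 × E3) : Set E3 := {t.1, t.2.1, t.2.2}

/-- The plane spanned by a triangle. -/
def planeOf (t : E3 × E3 × E3) : Set E3 := (affineSpan ℝ (vertsOf t) : Set E3)

/-- The direction (2-dimensional linear subspace) of the plane of a triangle. -/
def dirOf (t : E3 × E3 × E3) : Submodule ℝ E3 := (affineSpan ℝ (vertsOf t)).direction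

/-- The triangle-wise tangential gradient `∇_{S_h} w` on the triangle `t`. -/
def gradTri (t : E3 × E3 × E3) (w : E3 → ℝ) (x : E3) : E3 := tGrad (triOf t) (dirOf t) w x

/-- An admissible quasi-uniform triangulation `T_h` of the surface `Srf` with mesh parameter `h`
and quasi-uniformity constant `γ₀`, together with the nearest-point projection `a` defined on
a tubular neighbourhood `N` of the surface. -/
structure Triangulation (Srf : SmoothSurface) (γ₀ h : ℝ) where
  T : Finset (E3 × E3 × E3)
  a : E3 → E3
  N : Set E3
  T_nonempty : T.Nonempty
  indep : ∀ t ∈ T, AffineIndependent ℝ ![t.1, t.2.1, t.2.2]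
  verts_on : ∀ t ∈ T, vertsOf t ⊆ Srf.S
  meet : ∀ t ∈ T, ∀ t' ∈ T, t ≠ t' →
    triOf t ∩ triOf t' = ∅ ∨
    (∃ v, v ∈ vertsOf t ∩ vertsOf t' ∧ triOf t ∩ triOf t' = {v}) ∨
    (∃ v w, v ≠ w ∧ v ∈ vertsOf t ∩ vertsOf t' ∧ w ∈ vertsOf t ∩ vertsOf t' ∧
      triOf t ∩ triOf t' = segment ℝ v w)
  diam_le : ∀ t ∈ T, Metric.diam (triOf t) ≤ h
  disk : ∀ t ∈ T, ∃ y ∈ triOf t, closedBall y (γ₀ * h) ∩ planeOf t ⊆ triOf t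
  N_open : IsOpen N
  S_sub : Srf.S ⊆ N
  Sh_sub : (⋃ t ∈ T, triOf t) ⊆ N
  a_smooth : ContDiffOn ℝ (⊤ : ℕ∞) a N
  a_mem : ∀ x ∈ N, a x ∈ Srf.S
  a_nearest : ∀ x ∈ N, ∀ y ∈ Srf.S, dist x (a x) ≤ dist x y
  a_unique : ∀ x ∈ N, ∀ y ∈ Srf.S, dist x y = dist x (a x) → y = a x
  a_bij : Set.BijOn a (⋃ t ∈ T, triOf t) Srf.S

namespace Triangulation

variable {Srf : SmoothSurface} {γ₀ h : ℝ} (Tr : Triangulation Srf γ₀ h)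

/-- The polyhedral surface `S_h`, the union of the triangles. -/
def Sh : Set E3 := ⋃ t ∈ Tr.T, triOf t

/-- Membership in the finite element space `V_h` of continuous, piecewise affine functions
on `S_h` (as functions `E3 → ℝ`; only the values on `S_h` are relevant). -/
def IsVh (v : E3 → ℝ) : Prop :=
  ContinuousOn v Tr.Sh ∧
  ∀ t ∈ Tr.T, ∃ (L : E3 →ₗ[ℝ] ℝ) (c : ℝ), ∀ x ∈ triOf t, v x = L x + c


/-- The discrete bilinear form
`a_h(v,w) = ∫_{S_h} (⟨∇_{S_h} v, ∇_{S_h} w⟩ + v w)`, computed triangle by triangle. -/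
def ahForm (v w : E3 → ℝ) : ℝ :=
  ∑ t ∈ Tr.T, ∫ x in triOf t,
    (⟪gradTri t v x, gradTri t w x⟫ + v x * w x) ∂μH[2]

/-- The lift of a function on `S_h` to a function on `S` via the inverse of `a|_{S_h}`. -/
def liftS (w : E3 → ℝ) : E3 → ℝ := fun y => w (Function.invFunOn Tr.a Tr.Sh y)

/-- The lift of `f : S → ℝ` to `S_h` is `f ∘ a`. -/
def liftSh (f : E3 → ℝ) : E3 → ℝ := fun x => f (Tr.a x)

end Triangulation

/-- `f` is smooth in a neighbourhood of the set `A`. -/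
def SmoothNear (f : E3 → ℝ) (A : Set E3) : Prop :=
  ∃ V : Set E3, IsOpen V ∧ A ⊆ V ∧ ContDiffOn ℝ (⊤ : ℕ∞) f V

/-- `u` is the (weak, hence smooth) solution of `-Δ_S u + u = f` on the surface `Srf`. -/
def IsSolution (Srf : SmoothSurface) (f u : E3 → ℝ) : Prop :=
  SmoothNear u Srf.S ∧
  ∀ φ : E3 → ℝ, ContDiff ℝ (⊤ : ℕ∞) φ → Srf.aForm u φ = ∫ x in Srf.S, f x * φ x ∂μH[2]

/-- `uh` is the discrete Galerkin solution in `V_h` with data the lift `f ∘ a` of `f`. -/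
def Triangulation.IsDiscreteSolution {Srf : SmoothSurface} {γ₀ h : ℝ}
    (Tr : Triangulation Srf γ₀ h) (f uh : E3 → ℝ) : Prop :=
  Tr.IsVh uh ∧
  ∀ φh : E3 → ℝ, Tr.IsVh φh →
    Tr.ahForm uh φh = ∫ x in Tr.Sh, f (Tr.a x) * φh x ∂μH[2]

/-- Orthogonal projection onto the affine tangent plane of `S` at `z₀`. -/
def SmoothSurface.P0 (Srf : SmoothSurface) (z₀ : E3) (x : E3) : E3 :=
  z₀ + (Submodule.orthogonalProjectionOnto (Srf.tangent z₀) (x - z₀) : E3)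

/-- `r(x) = ‖P₀(x) − z₀‖`, the distance of the tangential projection of `x` to `z₀`. -/
def SmoothSurface.rfn (Srf : SmoothSurface) (z₀ : E3) (x : E3) : ℝ :=
  ‖Srf.P0 z₀ x - z₀‖

/-- The affine tangent plane `z₀ + T_{z₀}S`. -/
def SmoothSurface.tplane (Srf : SmoothSurface) (z₀ : E3) : Set E3 :=
  {x : E3 | x - z₀ ∈ Srf.tangent z₀}

/-- The disk `D = B₁₀₀(z₀)` in the affine tangent plane at `z₀`. -/
def SmoothSurface.disk100 (Srf : SmoothSurface) (z₀ : E3) : Set E3 :=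
  Srf.tplane z₀ ∩ closedBall z₀ 100

/-- `r₁ > 0` is a graph radius for `S`: uniformly in `z₀ ∈ S`, the piece `B_{2r₁}(z₀) ∩ S`
is a graph over the tangent plane at `z₀`, in particular `P₀` is injective on it. -/
def SmoothSurface.IsGraphRadius (Srf : SmoothSurface) (r₁ : ℝ) : Prop :=
  0 < r₁ ∧ r₁ ≤ 1 ∧ ∀ z₀ ∈ Srf.S, Set.InjOn (Srf.P0 z₀) (Srf.S ∩ closedBall z₀ (2 * r₁))

/-- `ζ` is an admissible smooth cutoff at `z₀`: supported in the ball of radius `3r₁/2`,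
equal to `1` on the ball of radius `r₁`, with `C²`-bounds at most `Cζ` (uniform in `z₀`). -/
def IsCutoff (z₀ : E3) (r₁ Cζ : ℝ) (ζ : E3 → ℝ) : Prop :=
  ContDiff ℝ (⊤ : ℕ∞) ζ ∧ tsupport ζ ⊆ closedBall z₀ (3 / 2 * r₁) ∧
  (∀ x ∈ closedBall z₀ r₁, ζ x = 1) ∧
  ∀ x : E3, |ζ x| + ‖fderiv ℝ ζ x‖ + ‖fderiv ℝ (fderiv ℝ ζ) x‖ ≤ Cζ

/-- `v` is the Neumann Green's function with pole `z₀` of `−Δ + 1` on the disk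
`D = B₁₀₀(z₀)` in the tangent plane at `z₀`: it is smooth away from the pole, satisfies
`∫_D (⟨∇v, ∇φ⟩ + v φ) = φ(z₀)` for every smooth test function, and differs from
`(1/2π) log‖· − z₀‖` by an `H²(D)`-function with norm at most `CG`. -/
def SmoothSurface.IsGreen (Srf : SmoothSurface) (z₀ : E3) (CG : ℝ) (v : E3 → ℝ) : Prop :=
  ContDiffOn ℝ (⊤ : ℕ∞) v (Srf.disk100 z₀ \ {z₀}) ∧
  (∀ φ : E3 → ℝ, ContDiff ℝ (⊤ : ℕ∞) φ →
    ∫ x in Srf.disk100 z₀,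
      (⟪tGrad (Srf.disk100 z₀) (Srf.tangent z₀) v x,
        tGrad (Srf.disk100 z₀) (Srf.tangent z₀) φ x⟫ + v x * φ x) ∂μH[2] = φ z₀) ∧
  (∫ x in Srf.disk100 z₀,
      ((v x - (1 / (2 * Real.pi)) * Real.log ‖x - z₀‖) ^ 2 +
        ‖fderivWithin ℝ (fun y => v y - (1 / (2 * Real.pi)) * Real.log ‖y - z₀‖)
            (Srf.disk100 z₀) x‖ ^ 2 +
        ‖fderivWithin ℝ
            (fun y => fderivWithin ℝ
              (fun y' => v y' - (1 / (2 * Real.pi)) * Real.log ‖y' - z₀‖)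
              (Srf.disk100 z₀) y)
            (Srf.disk100 z₀) x‖ ^ 2) ∂μH[2]) ≤ CG

/-- The approximate Green's function `g̃(x) = ζ(x) v(P₀(x))` on `S`. -/
def approxGreen (Srf : SmoothSurface) (z₀ : E3) (ζ v : E3 → ℝ) : E3 → ℝ :=
  fun x => ζ x * v (Srf.P0 z₀ x)

/-- The cut-off lifted logarithm `l̃(x) = ζ(x) log r(x)` on `S`. -/
def cutLog (Srf : SmoothSurface) (z₀ : E3) (ζ : E3 → ℝ) : E3 → ℝ :=
  fun x => ζ x * Real.log (Srf.rfn z₀ x)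

/-- `lh` is the discrete (Galerkin) projection of the function `w` on `S`:
`a_h(lh, v_h) = a(w, V_h)` for all `v_h ∈ V_h`, where `V_h` is the lift of `v_h` to `S`. -/
def Triangulation.IsDiscreteProjection {Srf : SmoothSurface} {γ₀ h : ℝ}
    (Tr : Triangulation Srf γ₀ h) (w lh : E3 → ℝ) : Prop :=
  Tr.IsVh lh ∧ ∀ vh : E3 → ℝ, Tr.IsVh vh → Tr.ahForm lh vh = Srf.aForm w (Tr.liftS vh)


lemma tri_lin (t : E3 × E3 × E3) (L : E3 →L[ℝ] ℝ) (c b : ℝ)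
    (hv : ∀ v ∈ vertsOf t, |L v - c| ≤ b) : ∀ p ∈ triOf t, |L p - c| ≤ b := by
  have hc : Convex ℝ (L.toLinearMap ⁻¹' (Set.Icc (c - b) (c + b))) :=
    (convex_Icc (c - b) (c + b)).linear_preimage L.toLinearMap
  have hsub : triOf t ⊆ L.toLinearMap ⁻¹' (Set.Icc (c - b) (c + b)) := by
    refine convexHull_min ?_ hc
    intro v hv'
    have := abs_le.1 (hv v hv')
    simp only [Set.mem_preimage, Set.mem_Icc, ContinuousLinearMap.coe_coe]
    constructor <;> linarith
  intro p hp
  have := hsub hp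
  simp only [Set.mem_preimage, Set.mem_Icc, ContinuousLinearMap.coe_coe] at this
  rw [abs_le]
  constructor <;> linarith

lemma verts_sub_tri (t : E3 × E3 × E3) : vertsOf t ⊆ triOf t := subset_convexHull ℝ _

lemma taylor_ball (F : E3 → ℝ) (hF : Differentiable ℝ F) (z : E3) (r K : ℝ)
    (hL : ∀ x ∈ ball z r, ∀ y ∈ ball z r, ‖fderiv ℝ F x - fderiv ℝ F y‖ ≤ K * ‖x - y‖)
    (hK : 0 ≤ K)
    (x : E3) (hx : x ∈ ball z r) (y : E3) (hy : y ∈ ball z r) :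
    |F y - F x - fderiv ℝ F x (y - x)| ≤ K * ‖y - x‖ ^ 2 := by
  have hseg : segment ℝ x y ⊆ ball z r := (convex_ball z r).segment_subset hx hy
  have h := Convex.norm_image_sub_le_of_norm_fderiv_le' (𝕜 := ℝ) (f := F)
    (φ := fderiv ℝ F x) (C := K * ‖y - x‖) (s := segment ℝ x y) (x := x) (y := y)
    (fun w _ => hF w) ?_ (convex_segment x y) (left_mem_segment ℝ x y) (right_mem_segment ℝ x y)
  · rw [Real.norm_eq_abs] at h
    calc _ ≤ _ := h
      _ = _ := by ring
  · intro w hw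
    refine (hL w (hseg hw) x hx).trans ?_
    refine mul_le_mul_of_nonneg_left ?_ hK
    obtain ⟨θ, hθ, rfl⟩ := (segment_eq_image' ℝ x y) ▸ hw
    simp only [add_sub_cancel_left, norm_smul, Real.norm_eq_abs, abs_of_nonneg hθ.1]
    nlinarith [norm_nonneg (y - x), hθ.2]

def QProp (Srf : SmoothSurface) (x : E3) (δ C : ℝ) : Prop :=
  (∀ y ∈ Srf.S ∩ ball x δ, ∀ z ∈ Srf.S ∩ ball x δ,
    |⟪Srf.n y, z - y⟫| ≤ C * ‖z - y‖ ^ 2 ∧ ‖Srf.n y - Srf.n z‖ ≤ C * ‖y - z‖) ∧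
  (∀ (t : E3 × E3 × E3) (h : ℝ), vertsOf t ⊆ Srf.S ∩ ball x δ →
    (∀ p ∈ triOf t, ∀ q ∈ triOf t, dist p q ≤ h) →
    ∀ p ∈ triOf t, Metric.infDist p Srf.S ≤ C * h ^ 2)

lemma QProp.mono {Srf : SmoothSurface} {x x' : E3} {δ δ' C C' : ℝ} (hQ : QProp Srf x δ C)
    (hb : ball x' δ' ⊆ ball x δ) (hC : C ≤ C') : QProp Srf x' δ' C' := by
  refine ⟨fun y hy z hz => ?_, fun t h ht hd p hp => ?_⟩
  · obtain ⟨h1, h2⟩ := hQ.1 y ⟨hy.1, hb hy.2⟩ z ⟨hz.1, hb hz.2⟩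
    exact ⟨h1.trans (by gcongr), h2.trans (by gcongr)⟩
  · exact (hQ.2 t h (fun v hv => ⟨(ht hv).1, hb (ht hv).2⟩) hd p hp).trans (by gcongr)

lemma local_Q (Srf : SmoothSurface) (z : E3) (hz : z ∈ Srf.S) :
    ∃ r > 0, ∃ C > 0, QProp Srf z r C := by
  obtain ⟨U, F, hUo, hzU, hF, hSU, hg, ht⟩ := Srf.localLevel z hz
  obtain ⟨V, hVo, hSV, hn⟩ := Srf.n_smooth
  set g := gradient F z with hgdef
  have hg0 : 0 < ‖g‖ := norm_pos_iff.2 (hg z hzU)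
  have hFd : Differentiable ℝ F := hF.differentiable (by simp)
  have hDg : ∀ y v, fderiv ℝ F y v = ⟪gradient F y, v⟫ := by
    intro y v
    simp [gradient]
  have hng : ∀ y, ‖fderiv ℝ F y‖ = ‖gradient F y‖ := by
    intro y
    simp [gradient]
  have hDF : ContDiff ℝ 1 (fderiv ℝ F) := hF.fderiv_right (by norm_cast)
  obtain ⟨K, sK, hsK, hK⟩ := (hDF.contDiffAt (x := z)).exists_lipschitzOnWith
  have hnz : ContDiffAt ℝ 1 Srf.n z :=
    ((hn.contDiffAt (hVo.mem_nhds (hSV hz))).of_le (by norm_cast))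
  obtain ⟨K', sK', hsK', hK'⟩ := hnz.exists_lipschitzOnWith
  have hstrict : HasStrictFDerivAt F (fderiv ℝ F z) z :=
    (hF.contDiffAt (x := z)).hasStrictFDerivAt (by simp)
  obtain ⟨sA, hsA, hA⟩ := hstrict.approximates_deriv_on_nhds (c := (‖g‖ / 2).toNNReal)
    (Or.inr (Real.toNNReal_pos.2 (by positivity)))
  have hlow : ∀ᶠ y in nhds z, ‖g‖ / 2 < ‖fderiv ℝ F y‖ := by
    have hc : ContinuousAt (fun y => ‖fderiv ℝ F y‖) z := hDF.continuous.norm.continuousAt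
    refine hc.eventually (lt_mem_nhds ?_)
    have := hng z
    show ‖g‖ / 2 < ‖fderiv ℝ F z‖
    rw [this]; linarith
  have hall : ∀ᶠ y in nhds z, y ∈ U ∧ y ∈ sK ∧ y ∈ sK' ∧ y ∈ sA ∧ ‖g‖ / 2 < ‖fderiv ℝ F y‖ := by
    filter_upwards [hUo.mem_nhds hzU, hsK, hsK', hsA, hlow] with y a b c d e
    exact ⟨a, b, c, d, e⟩
  obtain ⟨r1, hr1, hb⟩ := Metric.eventually_nhds_iff_ball.1 hall
  have hFz : F z = 0 := by
    have : z ∈ {y ∈ U | F y = 0} := hSU ▸ ⟨hz, hzU⟩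
    exact this.2
  have hsmall : ∀ᶠ y in nhds z, 2 * |F y| / ‖g‖ < r1 / 2 := by
    have hc : ContinuousAt (fun y => 2 * |F y| / ‖g‖) z := by
      have := hF.continuous
      fun_prop
    refine hc.eventually (gt_mem_nhds ?_)
    simp [hFz, hr1]
  obtain ⟨r2, hr2, hb2⟩ := Metric.eventually_nhds_iff_ball.1 hsmall
  have hT := taylor_ball F hFd z r1 K (fun x hx y hy => by
    have := hK.dist_le_mul x (hb x hx).2.1 y (hb y hy).2.1
    simpa [dist_eq_norm] using this) K.2
  have hr : min r2 (r1 / 2) ≤ r1 := (min_le_right _ _).trans (by linarith)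
  have hbr : ball z (min r2 (r1 / 2)) ⊆ ball z r1 := ball_subset_ball hr
  have hzero : ∀ y ∈ Srf.S ∩ ball z r1, F y = 0 := by
    intro y hy
    have : y ∈ {y ∈ U | F y = 0} := hSU ▸ ⟨hy.1, (hb y hy.2).1⟩
    exact this.2
  have hdist : ∀ p ∈ ball z (min r2 (r1 / 2)), Metric.infDist p Srf.S ≤ 2 * |F p| / ‖g‖ := by
    intro p hp
    have hp2 : 2 * |F p| / ‖g‖ < r1 / 2 := hb2 p (ball_subset_ball (min_le_left _ _) hp)
    have hp1 : dist p z < r1 / 2 := ball_subset_ball (min_le_right _ _) hp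
    set s0 := 2 * |F p| / ‖g‖ ^ 2 with hs0
    have hs0n : 0 ≤ s0 := by positivity
    have hs0g : s0 * ‖g‖ = 2 * |F p| / ‖g‖ := by rw [hs0]; field_simp
    have hs0g2 : s0 * ‖g‖ ^ 2 = 2 * |F p| := by rw [hs0]; field_simp
    have hnorm : ∀ s, |s| ≤ s0 → ‖s • g‖ ≤ 2 * |F p| / ‖g‖ := by
      intro s hs
      rw [norm_smul, Real.norm_eq_abs, ← hs0g]
      gcongr
    have hin : ∀ s, |s| ≤ s0 → p + s • g ∈ ball z r1 := by
      intro s hs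
      rw [mem_ball]
      calc dist (p + s • g) z ≤ dist (p + s • g) p + dist p z := dist_triangle _ _ _
        _ = ‖s • g‖ + dist p z := by simp [dist_eq_norm]
        _ < r1 := by linarith [hnorm s hs]
    have hkey : ∀ s, |s| ≤ s0 → |F (p + s • g) - F p - s * ‖g‖ ^ 2| ≤ ‖g‖ / 2 * (|s| * ‖g‖) := by
      intro s hs
      have h := hA (p + s • g) (hb _ (hin s hs)).2.2.2.1 p (hb _ (hbr hp)).2.2.2.1
      simp only [add_sub_cancel_left, map_smul, norm_smul, Real.norm_eq_abs, smul_eq_mul,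
        Real.coe_toNNReal _ (by positivity : 0 ≤ ‖g‖ / 2)] at h
      rw [hDg z g, ← hgdef, real_inner_self_eq_norm_sq] at h
      exact h
    have habs : |s0| = s0 := abs_of_nonneg hs0n
    have hplus : 0 ≤ F (p + s0 • g) := by
      have := (abs_le.1 (hkey s0 habs.le)).1
      rw [habs] at this
      nlinarith [neg_abs_le (F p)]
    have hminus : F (p + (-s0) • g) ≤ 0 := by
      have := (abs_le.1 (hkey (-s0) (by rw [abs_neg]; exact habs.le))).2
      rw [abs_neg, habs] at this
      nlinarith [le_abs_self (F p)]
    have hcont : ContinuousOn (fun s : ℝ => F (p + s • g)) (Set.Icc (-s0) s0) := by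
      have := hF.continuous
      fun_prop
    obtain ⟨s, hs, hs'⟩ := intermediate_value_Icc (by linarith : -s0 ≤ s0) hcont
      ⟨hminus, hplus⟩
    have hsabs : |s| ≤ s0 := abs_le.2 hs
    have hmem : p + s • g ∈ Srf.S := by
      have : p + s • g ∈ {y ∈ U | F y = 0} := ⟨(hb _ (hin s hsabs)).1, hs'⟩
      rw [← hSU] at this
      exact this.1
    refine (Metric.infDist_le_dist_of_mem hmem).trans ?_
    have := hnorm s hsabs
    simpa [dist_eq_norm] using this
  refine ⟨min r2 (r1 / 2), by positivity, 2 * K / ‖g‖ + K' + 1, by positivity, ?_, ?_⟩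
  · intro y hy w hw
    have hy1 := hbr hy.2
    have hw1 := hbr hw.2
    constructor
    · have h := hT y hy1 w hw1
      rw [hzero y ⟨hy.1, hy1⟩, hzero w ⟨hw.1, hw1⟩, hDg] at h
      obtain ⟨s, hs⟩ := ht y ⟨hy.1, (hb y hy1).1⟩
      have hl := (hb y hy1).2.2.2.2
      rw [hng, hs, norm_smul, Srf.n_unit y hy.1, mul_one, Real.norm_eq_abs] at hl
      rw [hs, real_inner_smul_left, sub_zero, zero_sub, abs_neg, abs_mul] at h
      have h2 : ‖g‖ / 2 * |⟪Srf.n y, w - y⟫| ≤ K * ‖w - y‖ ^ 2 :=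
        le_trans (by gcongr) h
      have h3 : |⟪Srf.n y, w - y⟫| ≤ 2 * K / ‖g‖ * ‖w - y‖ ^ 2 := by
        rw [div_mul_eq_mul_div, le_div_iff₀ hg0]
        linarith
      have h4 : 0 ≤ (K' : ℝ) * ‖w - y‖ ^ 2 := by positivity
      nlinarith [sq_nonneg ‖w - y‖]
    · have h := hK'.dist_le_mul y (hb y hy1).2.2.1 w (hb w hw1).2.2.1
      rw [dist_eq_norm, dist_eq_norm] at h
      have h4 : 0 ≤ 2 * K / ‖g‖ * ‖y - w‖ := by positivity
      nlinarith [norm_nonneg (y - w)]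
  · intro t h hv hd p hp
    have htb : triOf t ⊆ ball z (min r2 (r1 / 2)) :=
      convexHull_min (fun v hv' => (hv hv').2) (convex_ball _ _)
    have hp1 := htb hp
    have hFp : |F p| ≤ K * h ^ 2 := by
      have := tri_lin t (fderiv ℝ F p) (fderiv ℝ F p p - F p) (K * h ^ 2) ?_ p hp
      · simpa using this
      · intro v hv'
        have h1 := hT p (hbr hp1) v (hbr (hv hv').2)
        rw [hzero v ⟨(hv hv').1, hbr (hv hv').2⟩, map_sub, ← abs_neg] at h1
        have h2 : ‖v - p‖ ≤ h := by
          rw [← dist_eq_norm]; exact hd v (verts_sub_tri t hv') p hp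
        have h3 : (K : ℝ) * ‖v - p‖ ^ 2 ≤ K * h ^ 2 := by gcongr
        refine le_trans (le_of_eq ?_) (h1.trans h3)
        congr 1
        ring
    refine (hdist p hp1).trans ?_
    have h1 : 2 * |F p| / ‖g‖ ≤ 2 * (K * h ^ 2) / ‖g‖ := by gcongr
    have h2 : 2 * (K * h ^ 2) / ‖g‖ = 2 * K / ‖g‖ * h ^ 2 := by ring
    have h4 : 0 ≤ (K' : ℝ) * h ^ 2 := by positivity
    nlinarith [sq_nonneg h]

lemma uniform_Q (Srf : SmoothSurface) :
    ∃ δ > 0, ∃ C > 0, ∀ x ∈ Srf.S, QProp Srf x δ C := by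
  refine Srf.compact.induction_on (p := fun A => ∃ δ > 0, ∃ C > 0, ∀ x ∈ A, QProp Srf x δ C)
    ⟨1, one_pos, 1, one_pos, by simp⟩ ?_ ?_ ?_
  · rintro s t hst ⟨δ, hδ, C, hC, h⟩
    exact ⟨δ, hδ, C, hC, fun x hx => h x (hst hx)⟩
  · rintro s t ⟨δ, hδ, C, hC, h⟩ ⟨δ', hδ', C', hC', h'⟩
    refine ⟨min δ δ', lt_min hδ hδ', max C C', lt_max_of_lt_left hC, ?_⟩
    rintro x (hx | hx)
    · exact (h x hx).mono (ball_subset_ball (min_le_left _ _)) (le_max_left _ _)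
    · exact (h' x hx).mono (ball_subset_ball (min_le_right _ _)) (le_max_right _ _)
  · intro z hz
    obtain ⟨r, hr, C, hC, hQ⟩ := local_Q Srf z hz
    refine ⟨ball z (r / 2), mem_nhdsWithin_of_mem_nhds (ball_mem_nhds _ (by positivity)),
      r / 2, by positivity, C, hC, fun x hx => hQ.mono ?_ le_rfl⟩
    rw [mem_ball] at hx
    exact ball_subset_ball' (by linarith)

lemma exists_normal (W : Submodule ℝ E3) (m : E3) (hm : ‖m‖ = 1) (k : ℝ) (hk0 : 0 ≤ k) (hk : k ≤ 1 / 2)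
    (h : ∀ d ∈ W, |⟪m, d⟫| ≤ k * ‖d‖) :
    ∃ ν : E3, ‖ν‖ = 1 ∧ (∀ d ∈ W, ⟪ν, d⟫ = 0) ∧ ‖ν - m‖ ≤ 2 * k := by
  obtain ⟨q, hq, w, hw, hmqw⟩ := W.exists_add_mem_mem_orthogonal m
  have hwd : ∀ d ∈ W, ⟪w, d⟫ = 0 := fun d hd => Submodule.inner_left_of_mem_orthogonal hd hw
  have hqk : ‖q‖ ≤ k := by
    have h1 := h q hq
    rw [hmqw, inner_add_left, hwd q hq, add_zero, real_inner_self_eq_norm_sq,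
      abs_of_nonneg (sq_nonneg _)] at h1
    rcases (norm_nonneg q).eq_or_lt with h0 | h0
    · rw [← h0]; exact hk0
    · nlinarith
  have hw1 : |1 - ‖w‖| ≤ ‖q‖ := by
    have := abs_norm_sub_norm_le m w
    rw [hm] at this
    have h2 : m - w = q := by rw [hmqw]; abel
    rwa [h2] at this
  have hwpos : 0 < ‖w‖ := by
    have := (abs_le.1 hw1).2
    linarith
  refine ⟨‖w‖⁻¹ • w, ?_, ?_, ?_⟩
  · rw [norm_smul, norm_inv, norm_norm, inv_mul_cancel₀ hwpos.ne']
  · intro d hd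
    rw [real_inner_smul_left, hwd d hd, mul_zero]
  · have e : ‖w‖⁻¹ • w - m = (‖w‖⁻¹ * (1 - ‖w‖)) • w - q := by
      rw [hmqw, mul_sub, inv_mul_cancel₀ hwpos.ne', mul_one, sub_smul, one_smul]
      abel
    rw [e]
    refine (norm_sub_le _ _).trans ?_
    have e2 : ‖(‖w‖⁻¹ * (1 - ‖w‖)) • w‖ = |1 - ‖w‖| := by
      rw [norm_smul, norm_mul, norm_inv, norm_norm, Real.norm_eq_abs]
      field_simp
    rw [e2]
    linarith

/-- **Geometric estimates for the polyhedral approximation.**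
(i) every point of `S_h` has distance at most `c h²` to `S`; and (ii) each triangle has a unit
normal `ν_τ` with `‖ν_τ − n(a(x))‖ ≤ c h` for all `x` in the triangle. -/
theorem geometric_estimates (Srf : SmoothSurface) (γ₀ : ℝ) (hγ₀ : 0 < γ₀) :
    ∃ c > 0, ∃ h₀ > 0,
      ∀ h : ℝ, 0 < h → h ≤ h₀ →
        ∀ Tr : Triangulation Srf γ₀ h,
          (∀ x ∈ Tr.Sh, Metric.infDist x Srf.S ≤ c * h ^ 2) ∧
          (∀ t ∈ Tr.T, ∃ ν : E3, ‖ν‖ = 1 ∧ (∀ d ∈ dirOf t, ⟪ν, d⟫ = 0) ∧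
            ∀ x ∈ triOf t, ‖ν - Srf.n (Tr.a x)‖ ≤ c * h) := by
  obtain ⟨δ, hδ, C, hC, hQ⟩ := uniform_Q Srf
  set κ := 2 * C / γ₀ with hκ
  have hκ0 : 0 < κ := by positivity
  refine ⟨2 * κ + 2 * C, by positivity, min (δ / 3) (1 / (2 * κ)), by positivity, ?_⟩
  intro h hh hh0 Tr
  have hhδ : h ≤ δ / 3 := hh0.trans (min_le_left _ _)
  have hhκ : κ * h ≤ 1 / 2 := by
    have := hh0.trans (min_le_right _ _)
    rw [le_div_iff₀ (by positivity)] at this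
    linarith
  have hd : ∀ t ∈ Tr.T, ∀ p ∈ triOf t, ∀ q ∈ triOf t, dist p q ≤ h := by
    intro t ht p hp q hq
    have hbd : Bornology.IsBounded (triOf t) := by
      have hf : ({t.1, t.2.1, t.2.2} : Set E3).Finite := by simp
      exact (isBounded_convexHull).2 hf.isBounded
    exact (Metric.dist_le_diam_of_mem hbd hp hq).trans (Tr.diam_le t ht)
  have hv1 : ∀ t : E3 × E3 × E3, t.1 ∈ vertsOf t := fun t => by simp [vertsOf]
  have hvb : ∀ t ∈ Tr.T, vertsOf t ⊆ Srf.S ∩ ball t.1 δ := by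
    intro t ht v hv
    refine ⟨Tr.verts_on t ht hv, ?_⟩
    have := hd t ht v (verts_sub_tri t hv) t.1 (verts_sub_tri t (hv1 t))
    rw [mem_ball]; linarith
  constructor
  · intro x hx
    simp only [Triangulation.Sh, Set.mem_iUnion] at hx
    obtain ⟨t, ht, hxt⟩ := hx
    refine ((hQ t.1 (Tr.verts_on t ht (hv1 t))).2 t h (hvb t ht) (hd t ht) x hxt).trans ?_
    gcongr
    linarith
  · intro t ht
    have hS1 := Tr.verts_on t ht (hv1 t)
    have hself : t.1 ∈ Srf.S ∩ ball t.1 δ := ⟨hS1, mem_ball_self hδ⟩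
    have hlin : ∀ p ∈ triOf t, |⟪Srf.n t.1, p⟫ - ⟪Srf.n t.1, t.1⟫| ≤ C * h ^ 2 := by
      have := tri_lin t (innerSL ℝ (Srf.n t.1)) ⟪Srf.n t.1, t.1⟫ (C * h ^ 2) ?_
      · simpa using this
      · intro v hv
        have h1 := ((hQ t.1 hS1).1 t.1 hself v (hvb t ht hv)).1
        rw [inner_sub_right] at h1
        have h2 : ‖v - t.1‖ ≤ h := by
          rw [← dist_eq_norm]
          exact hd t ht v (verts_sub_tri t hv) t.1 (verts_sub_tri t (hv1 t))
        simp only [innerSL_apply_apply]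
        exact h1.trans (by gcongr)
    obtain ⟨y, hy, hball⟩ := Tr.disk t ht
    have hyp : y ∈ affineSpan ℝ (vertsOf t) := convexHull_subset_affineSpan _ hy
    have hdir : ∀ d ∈ dirOf t, |⟪Srf.n t.1, d⟫| ≤ κ * h * ‖d‖ := by
      intro d hdd
      rcases (norm_nonneg d).eq_or_lt with h0 | h0
      · have : d = 0 := norm_eq_zero.1 h0.symm
        simp [this]
      · set e := (γ₀ * h / ‖d‖) • d with he
        have hen : ‖e‖ = γ₀ * h := by
          rw [he, norm_smul, Real.norm_of_nonneg (by positivity)]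
          field_simp
        have hmem : y + e ∈ triOf t := by
          apply hball
          refine ⟨by simp [hen], ?_⟩
          have := AffineSubspace.vadd_mem_of_mem_direction
            (Submodule.smul_mem _ (γ₀ * h / ‖d‖) hdd) hyp
          rw [vadd_eq_add, add_comm] at this
          exact this
        have h1 := abs_le.1 (hlin _ hmem)
        have h2 := abs_le.1 (hlin _ hy)
        rw [inner_add_right] at h1
        have h3 : |⟪Srf.n t.1, e⟫| ≤ 2 * C * h ^ 2 := by
          rw [abs_le]; constructor <;> linarith [h1.1, h1.2, h2.1, h2.2]
        rw [he, real_inner_smul_right, abs_mul, abs_of_nonneg (by positivity),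
          div_mul_eq_mul_div, div_le_iff₀ h0] at h3
        rw [hκ, div_mul_eq_mul_div, div_mul_eq_mul_div, le_div_iff₀ hγ₀]
        refine le_of_mul_le_mul_left ?_ hh
        linarith
    obtain ⟨ν, hν1, hν2, hν3⟩ := exists_normal (dirOf t) (Srf.n t.1) (Srf.n_unit _ hS1)
      (κ * h) (by positivity) hhκ hdir
    refine ⟨ν, hν1, hν2, fun x hx => ?_⟩
    have hxN : x ∈ Tr.N := Tr.Sh_sub (Set.mem_biUnion ht hx)
    have hx1 : dist x t.1 ≤ h := hd t ht x hx t.1 (verts_sub_tri t (hv1 t))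
    have hax := Tr.a_nearest x hxN t.1 hS1
    have ha1 : dist t.1 (Tr.a x) ≤ 2 * h := by
      have := dist_triangle t.1 x (Tr.a x)
      rw [dist_comm t.1 x] at this
      linarith
    have h1 := ((hQ t.1 hS1).1 t.1 hself (Tr.a x) ⟨Tr.a_mem x hxN, by
      rw [mem_ball, dist_comm]; linarith⟩).2
    rw [← dist_eq_norm t.1] at h1
    have h2 : C * dist t.1 (Tr.a x) ≤ C * (2 * h) := by gcongr
    have h3 := norm_sub_le_norm_sub_add_norm_sub ν (Srf.n t.1) (Srf.n (Tr.a x))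
    linarith

end
end

section
/- Let S be a compact, orientable, two-dimensional embedded C^∞ submanifold of ℝ³ without boundary. There exist constants c > 0 and h₀ > 0, depending only on S and γ₀, such that for every admissible quasi-uniform triangulation T_h with h ≤ h₀ and every continuous function F : S → ℝ, the integral of F over S and the integral over S_h of its lift F∘a differ by at most c h² times the L¹-norm of F: | ∫_S F − ∫_{S_h} F∘a | ≤ c h² ∫_S |F|. -/
open MeasureTheory Metric
open scoped RealInnerProductSpace ENNReal NNReal

noncomputable section

/-! ### Helper lemmas -/

lemma aux_compact_bound {S : Set E3} (hS : IsCompact S) (g : E3 → E3 → ℝ) (k : ℕ) (M : ℝ)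
    (hM : ∀ p ∈ S, ∀ q ∈ S, g p q ≤ M)
    (hloc : ∀ x ∈ S, ∃ C : ℝ, ∃ t ∈ nhds x, ∀ p ∈ S ∩ t, ∀ q ∈ S ∩ t, g p q ≤ C * dist p q ^ k) :
    ∃ C : ℝ, 0 < C ∧ ∀ p ∈ S, ∀ q ∈ S, g p q ≤ C * dist p q ^ k := by
  have key : ∃ C : ℝ, 0 < C ∧ ∀ z ∈ S ×ˢ S, (z.1 ∈ S ∧ z.2 ∈ S) →
      g z.1 z.2 ≤ C * dist z.1 z.2 ^ k := by
    refine (hS.prod hS).induction_on (p := fun s => ∃ C : ℝ, 0 < C ∧ ∀ z ∈ s,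
      (z.1 ∈ S ∧ z.2 ∈ S) → g z.1 z.2 ≤ C * dist z.1 z.2 ^ k) ?_ ?_ ?_ ?_
    · exact ⟨1, one_pos, by simp⟩
    · rintro s t hst ⟨C, hC, h⟩
      exact ⟨C, hC, fun z hz => h z (hst hz)⟩
    · rintro s t ⟨C, hC, h⟩ ⟨D, hD, h'⟩
      refine ⟨C + D, by positivity, ?_⟩
      rintro z (hz | hz) hzS
      · refine (h z hz hzS).trans ?_
        gcongr; linarith
      · refine (h' z hz hzS).trans ?_
        gcongr; linarith
    · rintro ⟨x, y⟩ ⟨hx, hy⟩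
      by_cases hxy : x = y
      · subst hxy
        obtain ⟨C, t, ht, h⟩ := hloc x hx
        refine ⟨t ×ˢ t, mem_nhdsWithin_of_mem_nhds (prod_mem_nhds ht ht), |C| + 1, by positivity, ?_⟩
        rintro ⟨p, q⟩ ⟨hp, hq⟩ ⟨hpS, hqS⟩
        refine (h p ⟨hpS, hp⟩ q ⟨hqS, hq⟩).trans ?_
        have := le_abs_self C
        gcongr
        linarith
      · have hd : 0 < dist x y := dist_pos.2 hxy
        have ho : {z : E3 × E3 | dist x y / 2 < dist z.1 z.2} ∈ nhds (x, y) := by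
          refine IsOpen.mem_nhds (isOpen_lt (by fun_prop) (by fun_prop)) ?_
          simp only [Set.mem_ofPred_eq]; linarith
        refine ⟨_, mem_nhdsWithin_of_mem_nhds ho, (|M| + 1) / (dist x y / 2) ^ k,
          by positivity, ?_⟩
        rintro ⟨p, q⟩ hpq ⟨hpS, hqS⟩
        simp only [Set.mem_ofPred_eq] at hpq
        refine (hM p hpS q hqS).trans ?_
        have h1 : M ≤ |M| + 1 := by linarith [le_abs_self M]
        refine h1.trans ?_
        rw [div_mul_eq_mul_div, le_div_iff₀ (by positivity)]
        have : (dist x y / 2) ^ k ≤ dist p q ^ k := by gcongr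
        exact mul_le_mul_of_nonneg_left this (by positivity)
  obtain ⟨C, hC, h⟩ := key
  exact ⟨C, hC, fun p hp q hq => h (p, q) ⟨hp, hq⟩ ⟨hp, hq⟩⟩

lemma aux_inner_gradient (F : E3 → ℝ) (y v : E3) : ⟪gradient F y, v⟫ = fderiv ℝ F y v := by
  simp [gradient]

lemma aux_normal_lip (Srf : SmoothSurface) :
    ∃ L : ℝ, 0 < L ∧ ∀ p ∈ Srf.S, ∀ q ∈ Srf.S, ‖Srf.n p - Srf.n q‖ ≤ L * ‖p - q‖ := by
  obtain ⟨L, hL, h⟩ := aux_compact_bound Srf.compact (fun p q => ‖Srf.n p - Srf.n q‖) 1 2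
    (fun p hp q hq => by
      have := norm_sub_le (Srf.n p) (Srf.n q)
      rw [Srf.n_unit p hp, Srf.n_unit q hq] at this
      linarith)
    (by
      intro x hx
      obtain ⟨U, hU, hSU, hn⟩ := Srf.n_smooth
      have h1 : ContDiffAt ℝ 1 Srf.n x :=
        (hn.contDiffAt (hU.mem_nhds (hSU hx))).of_le (by exact_mod_cast le_top)
      obtain ⟨K, t, ht, hK⟩ := h1.exists_lipschitzOnWith
      refine ⟨K, t, ht, fun p hp q hq => ?_⟩
      have := hK.dist_le_mul p hp.2 q hq.2
      rw [dist_eq_norm (Srf.n p)] at this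
      simpa using this)
  exact ⟨L, hL, fun p hp q hq => by simpa [dist_eq_norm] using h p hp q hq⟩

lemma aux_tangent (Srf : SmoothSurface) :
    ∃ C : ℝ, 0 < C ∧ ∀ p ∈ Srf.S, ∀ q ∈ Srf.S, |⟪q - p, Srf.n p⟫| ≤ C * ‖q - p‖ ^ 2 := by
  obtain ⟨C, hC, h⟩ := aux_compact_bound Srf.compact (fun p q => |⟪q - p, Srf.n p⟫|) 2
    (Metric.diam Srf.S)
    (fun p hp q hq => by
      have := abs_real_inner_le_norm (q - p) (Srf.n p)
      rw [Srf.n_unit p hp, mul_one, ← dist_eq_norm] at this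
      exact this.trans (Metric.dist_le_diam_of_mem Srf.compact.isBounded hq hp))
    (by
      intro x hx
      obtain ⟨U, F, hU, hxU, hF, hSU, hg0, hgn⟩ := Srf.localLevel x hx
      have h1 : ContDiff ℝ 1 (fderiv ℝ F) :=
        hF.fderiv_right (m := 1) (by rw [one_add_one_eq_two]; exact WithTop.coe_le_coe.2 le_top)
      obtain ⟨K, t, ht, hK⟩ := h1.contDiffAt.exists_lipschitzOnWith (x := x)
      have hm : 0 < ‖gradient F x‖ := norm_pos_iff.2 (hg0 x hxU)
      have hcont : Continuous (gradient F) :=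
        (InnerProductSpace.toDual ℝ E3).symm.continuous.comp h1.continuous
      have hV : {y | ‖gradient F x‖ / 2 < ‖gradient F y‖} ∈ nhds x := by
        refine IsOpen.mem_nhds (isOpen_lt (by fun_prop) (by fun_prop)) ?_
        simp only [Set.mem_ofPred_eq]; linarith
      obtain ⟨r, hr, hball⟩ := Metric.mem_nhds_iff.1
        (Filter.inter_mem (Filter.inter_mem ht (hU.mem_nhds hxU)) hV)
      refine ⟨K / (‖gradient F x‖ / 2), ball x r, ball_mem_nhds x hr, ?_⟩
      rintro p ⟨hpS, hpb⟩ q ⟨hqS, hqb⟩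
      have hFz : ∀ y ∈ Srf.S, y ∈ ball x r → F y = 0 := by
        intro y hy hyb
        have : y ∈ {y ∈ U | F y = 0} := hSU ▸ ⟨hy, (hball hyb).1.2⟩
        exact this.2
      have hseg : segment ℝ p q ⊆ ball x r := (convex_ball x r).segment_subset hpb hqb
      have hmv := Convex.norm_image_sub_le_of_norm_fderiv_le' (𝕜 := ℝ) (f := F)
        (C := K * ‖q - p‖) (s := segment ℝ p q) (x := p) (y := q) (φ := fderiv ℝ F p)
        (fun z _ => (hF.differentiable (by simp)).differentiableAt)
        (fun z hz => by
          have := hK.dist_le_mul z (hball (hseg hz)).1.1 p (hball hpb).1.1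
          rw [dist_eq_norm, dist_eq_norm] at this
          refine this.trans ?_
          gcongr
          exact norm_sub_le_of_mem_segment hz)
        (convex_segment p q) (left_mem_segment ℝ p q) (right_mem_segment ℝ p q)
      rw [hFz p hpS hpb, hFz q hqS hqb, sub_zero, zero_sub, norm_neg, Real.norm_eq_abs,
        ← aux_inner_gradient] at hmv
      obtain ⟨s, hs⟩ := hgn p ⟨hpS, (hball hpb).1.2⟩
      have hsn : ‖gradient F p‖ = |s| := by
        rw [hs, norm_smul, Srf.n_unit p hpS, mul_one, Real.norm_eq_abs]
      have hs2 : ‖gradient F x‖ / 2 < |s| := hsn ▸ (hball hpb).2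
      rw [hs, inner_smul_left, abs_mul, real_inner_comm] at hmv
      simp only [RCLike.conj_to_real] at hmv
      rw [div_mul_eq_mul_div, le_div_iff₀ (by positivity), dist_comm p q, dist_eq_norm q p]
      have := mul_le_mul_of_nonneg_right hs2.le (abs_nonneg ⟪q - p, Srf.n p⟫)
      nlinarith)
  exact ⟨C, hC, fun p hp q hq => by simpa [dist_comm p q, dist_eq_norm q p] using h p hp q hq⟩

lemma aux_normal_dir (Srf : SmoothSurface) (x p : E3) (hp : p ∈ Srf.S)
    (hmin : ∀ y ∈ Srf.S, dist x p ≤ dist x y) : ∃ s : ℝ, x - p = s • Srf.n p := by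
  obtain ⟨U, F, hU, hxU, hF, hSU, hg0, hgn⟩ := Srf.localLevel p hp
  have hFp : F p = 0 := by
    have : p ∈ {y ∈ U | F y = 0} := hSU ▸ ⟨hp, hxU⟩
    exact this.2
  have hext : IsLocalExtrOn (fun y => ‖y - x‖ ^ 2) {y | F y = F p} p := by
    left
    have : ∀ᶠ y in nhdsWithin p {y | F y = F p}, y ∈ U :=
      mem_nhdsWithin_of_mem_nhds (hU.mem_nhds hxU)
    filter_upwards [this, self_mem_nhdsWithin] with y hyU hy
    have hyS : y ∈ Srf.S ∩ U := by
      have : y ∈ {y ∈ U | F y = 0} := ⟨hyU, by rw [← hFp]; exact hy⟩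
      rw [← hSU] at this
      exact this
    have := hmin y hyS.1
    rw [dist_comm x p, dist_comm x y, dist_eq_norm, dist_eq_norm] at this
    gcongr
  have hd : HasStrictFDerivAt (fun y : E3 => ‖y - x‖ ^ 2)
      ((2 : ℝ) • (innerSL ℝ (p - x))) p := by
    have h1 := hasStrictFDerivAt_norm_sq (p - x)
    have h2 : HasStrictFDerivAt (fun y : E3 => y - x) (ContinuousLinearMap.id ℝ E3) p :=
      (hasStrictFDerivAt_id p).sub_const x
    have := h1.comp p h2
    have e : (2 : ℝ) • innerSL ℝ (p - x) =
        (2 • innerSL ℝ (p - x)).comp (ContinuousLinearMap.id ℝ E3) := by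
      ext v; simp
    rw [e]
    exact this
  have hFd : HasStrictFDerivAt F (fderiv ℝ F p) p :=
    hF.contDiffAt.hasStrictFDerivAt (by simp)
  obtain ⟨α, β, hne, heq⟩ := hext.exists_multipliers_of_hasStrictFDerivAt_1d hFd hd
  have hv : α • gradient F p + (2 * β) • (p - x) = 0 := by
    refine ext_inner_right ℝ fun v => ?_
    have := congrArg (fun f => f v) heq
    simp only [add_apply, smul_apply, innerSL_apply_apply,
      smul_eq_mul, zero_apply] at this
    rw [inner_add_left, inner_smul_left, inner_smul_left, aux_inner_gradient, inner_zero_left]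
    simp only [RCLike.conj_to_real]
    linarith
  have hβ : β ≠ 0 := by
    rintro rfl
    simp only [mul_zero, zero_smul, add_zero, smul_eq_zero] at hv
    rcases hv with h | h
    · exact hne (by simp [h])
    · exact hg0 p hxU h
  obtain ⟨t, ht⟩ := hgn p ⟨hp, hxU⟩
  refine ⟨α * t / (2 * β), ?_⟩
  rw [ht, smul_smul] at hv
  have h2 : (2 * β) • (x - p) = (α * t) • Srf.n p := by
    have : (2 * β) • (x - p) = -((2 * β) • (p - x)) := by
      rw [← smul_neg, neg_sub]
    rw [this, neg_eq_iff_add_eq_zero, add_comm]; exact hv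
  rw [div_eq_inv_mul, mul_smul, ← h2, smul_smul, inv_mul_cancel₀ (by simpa using hβ), one_smul]

lemma aux_algebra (x y p q N M : E3) (s r A B D L h : ℝ) (hA : 0 ≤ A) (hB : 0 ≤ B)
    (hL : 0 ≤ L) (hh : 0 ≤ h) (hh1 : h ≤ 1) (hx : x - p = s • N) (hy : y - q = r • M)
    (hN : ‖N‖ = 1) (hM : ‖M‖ = 1)
    (hs : |s| ≤ A * h ^ 2) (hr : |r| ≤ A * h ^ 2)
    (hpN : |⟪p - q, N⟫| ≤ A * ‖p - q‖ ^ 2) (hpM : |⟪p - q, M⟫| ≤ A * ‖p - q‖ ^ 2)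
    (hNM : ‖N - M‖ ≤ L * ‖p - q‖) (hP : ‖p - q‖ ≤ B * h)
    (hD : |⟪x - y, N⟫| ≤ D * h * ‖x - y‖) :
    |‖x - y‖ ^ 2 - ‖p - q‖ ^ 2| ≤
      (4 * A ^ 2 + 2 * D ^ 2 + 2 * (A * B + 2 * (A * L)) ^ 2) * h ^ 2 *
        (‖x - y‖ ^ 2 + ‖p - q‖ ^ 2) := by
  set X := ‖x - y‖ with hX
  set P := ‖p - q‖ with hPdef
  have hX0 : 0 ≤ X := norm_nonneg _
  have hP0 : 0 ≤ P := norm_nonneg _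
  have hxy : x - y = (p - q) + (s • N - r • M) := by
    rw [← hx, ← hy]; abel
  have hNN : ⟪N, N⟫ = 1 := by rw [real_inner_self_eq_norm_sq, hN]; norm_num
  have h1 : s - r = ⟪x - y, N⟫ - ⟪p - q, N⟫ - r * ⟪N - M, N⟫ := by
    rw [hxy, inner_add_left, inner_sub_left (s • N), inner_sub_left N, inner_smul_left,
      inner_smul_left, hNN]
    simp only [RCLike.conj_to_real]
    ring
  have h2 : |⟪N - M, N⟫| ≤ L * P := by
    have := abs_real_inner_le_norm (N - M) N
    rw [hN, mul_one] at this
    exact this.trans hNM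
  have hrNM : |r| * (L * P) ≤ A * L * h * P := by
    have : |r| ≤ A * h := by nlinarith [mul_nonneg hA hh]
    nlinarith [mul_le_mul_of_nonneg_right this (mul_nonneg hL hP0)]
  have hPP : A * P ^ 2 ≤ A * B * h * P := by
    nlinarith [mul_le_mul_of_nonneg_left hP (mul_nonneg hA hP0)]
  have h3 : |s - r| ≤ D * h * X + (A * B + A * L) * h * P := by
    rw [h1]
    have e1 := abs_sub (⟪x - y, N⟫ - ⟪p - q, N⟫) (r * ⟪N - M, N⟫)
    have e2 := abs_sub (⟪x - y, N⟫) (⟪p - q, N⟫)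
    have e3 : |r * ⟪N - M, N⟫| ≤ A * L * h * P := by
      rw [abs_mul]
      exact (mul_le_mul_of_nonneg_left h2 (abs_nonneg r)).trans hrNM
    linarith
  have h4 : ‖s • N - r • M‖ ≤ D * h * X + (A * B + 2 * (A * L)) * h * P := by
    have : s • N - r • M = (s - r) • N + r • (N - M) := by
      rw [sub_smul, smul_sub]; abel
    rw [this]
    refine (norm_add_le _ _).trans ?_
    rw [norm_smul, norm_smul, hN, Real.norm_eq_abs, Real.norm_eq_abs]
    have := (mul_le_mul_of_nonneg_left hNM (abs_nonneg r)).trans hrNM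
    linarith
  have h5 : X ^ 2 - P ^ 2 = 2 * (s * ⟪p - q, N⟫ - r * ⟪p - q, M⟫) + ‖s • N - r • M‖ ^ 2 := by
    rw [hX, hxy, norm_add_sq_real, inner_sub_right, inner_smul_right, inner_smul_right]
    ring
  have h6 : ‖s • N - r • M‖ ^ 2 ≤
      2 * (D * h * X) ^ 2 + 2 * ((A * B + 2 * (A * L)) * h * P) ^ 2 := by
    have := pow_le_pow_left₀ (norm_nonneg (s • N - r • M)) h4 2
    linarith [sq_nonneg (D * h * X - (A * B + 2 * (A * L)) * h * P),
      add_sq (D * h * X) ((A * B + 2 * (A * L)) * h * P),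
      sub_sq (D * h * X) ((A * B + 2 * (A * L)) * h * P)]
  have h7 : |s * ⟪p - q, N⟫| ≤ A ^ 2 * h ^ 2 * P ^ 2 := by
    rw [abs_mul]
    calc _ ≤ (A * h ^ 2) * (A * P ^ 2) := by gcongr
      _ = _ := by ring
  have h8 : |r * ⟪p - q, M⟫| ≤ A ^ 2 * h ^ 2 * P ^ 2 := by
    rw [abs_mul]
    calc _ ≤ (A * h ^ 2) * (A * P ^ 2) := by gcongr
      _ = _ := by ring
  have h9 := sq_nonneg ‖s • N - r • M‖
  rw [abs_le] at h7 h8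
  have g1 : 0 ≤ A ^ 2 * h ^ 2 * X ^ 2 := by positivity
  have g2 : 0 ≤ D ^ 2 * h ^ 2 * P ^ 2 := by positivity
  have g3 : 0 ≤ (A * B + 2 * (A * L)) ^ 2 * h ^ 2 * X ^ 2 := by positivity
  have g4 : 0 ≤ D ^ 2 * h ^ 2 * X ^ 2 := by positivity
  have g5 : 0 ≤ (A * B + 2 * (A * L)) ^ 2 * h ^ 2 * P ^ 2 := by positivity
  rw [h5, abs_le]
  constructor <;> linarith [h7.1, h7.2, h8.1, h8.2]

lemma aux_measure {f : E3 → E3} {ι : Type*} [DecidableEq ι] (T : Finset ι) (tri : ι → Set E3)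
    (htri : ∀ t ∈ T, MeasurableSet (tri t)) (κ : ℝ≥0∞)
    (hf : ContinuousOn f (⋃ t ∈ T, tri t)) (hinj : Set.InjOn f (⋃ t ∈ T, tri t))
    (h1 : ∀ t ∈ T, ∀ A ⊆ tri t, μH[2] (f '' A) ≤ κ * μH[2] A)
    (h2 : ∀ t ∈ T, ∀ A ⊆ tri t, μH[2] A ≤ κ * μH[2] (f '' A)) :
    ∀ A ⊆ (⋃ t ∈ T, tri t), MeasurableSet A →
      μH[2] (f '' A) ≤ κ * μH[2] A ∧ μH[2] A ≤ κ * μH[2] (f '' A) := by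
  induction T using Finset.induction_on with
  | empty =>
    intro A hA _
    have : A = ∅ := by simpa using hA
    subst this; simp
  | insert t T ht ih =>
    intro A hA hAm
    have hsub : (⋃ s ∈ T, tri s) ⊆ ⋃ s ∈ insert t T, tri s :=
      Set.biUnion_subset_biUnion_left (fun s hs => Finset.mem_insert_of_mem hs)
    have hmt := htri t (Finset.mem_insert_self _ _)
    have ih' := ih (fun s hs => htri s (Finset.mem_insert_of_mem hs)) (hf.mono hsub)
      (hinj.mono hsub) (fun s hs => h1 s (Finset.mem_insert_of_mem hs))
      (fun s hs => h2 s (Finset.mem_insert_of_mem hs)) (A \ tri t) (by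
        rintro z ⟨hz, hzt⟩
        have := hA hz
        rw [Finset.set_biUnion_insert] at this
        exact this.resolve_left hzt) (hAm.diff hmt)
    have e1 := h1 t (Finset.mem_insert_self _ _) (A ∩ tri t) Set.inter_subset_right
    have e2 := h2 t (Finset.mem_insert_self _ _) (A ∩ tri t) Set.inter_subset_right
    have hA1 : μH[2] (A ∩ tri t) + μH[2] (A \ tri t) = (μH[2] : Measure E3) A :=
      measure_inter_add_sdiff A hmt
    have himg : f '' A = f '' (A ∩ tri t) ∪ f '' (A \ tri t) := by
      rw [← Set.image_union, Set.inter_union_sdiff]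
    have hA2 : (μH[2] : Measure E3) (f '' A) = μH[2] (f '' (A ∩ tri t)) + μH[2] (f '' (A \ tri t)) := by
      rw [himg]
      refine measure_union ?_ ?_
      · rw [Set.disjoint_iff_inter_eq_empty, ← hinj.image_inter
          (Set.inter_subset_left.trans hA) (Set.sdiff_subset.trans hA)]
        have : A ∩ tri t ∩ (A \ tri t) = ∅ := by
          ext z; simp; tauto
        rw [this, Set.image_empty]
      · exact (hAm.diff hmt).image_of_continuousOn_injOn (hf.mono (Set.sdiff_subset.trans hA))
          (hinj.mono (Set.sdiff_subset.trans hA))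
    rw [hA2, ← hA1, mul_add, mul_add]
    exact ⟨add_le_add e1 ih'.1, add_le_add e2 ih'.2⟩

lemma aux_integral_nonneg {α : Type*} [MeasurableSpace α] (μ ν : Measure α) (ε : ℝ) (hε : 0 ≤ ε)
    (h1 : μ ≤ ENNReal.ofReal (1 + ε) • ν) (h2 : ν ≤ ENNReal.ofReal (1 + ε) • μ)
    (g : α → ℝ) (hg : ∀ x, 0 ≤ g x) (hμ : Integrable g μ) (hν : Integrable g ν) :
    |∫ x, g x ∂μ - ∫ x, g x ∂ν| ≤ ε * ∫ x, g x ∂μ := by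
  have a1 : ∫ x, g x ∂μ ≤ (1 + ε) * ∫ x, g x ∂ν := by
    have := integral_mono_measure h1 (Filter.Eventually.of_forall hg)
      (hν.smul_measure ENNReal.ofReal_ne_top)
    rwa [integral_smul_measure, ENNReal.toReal_ofReal (by positivity), smul_eq_mul] at this
  have a2 : ∫ x, g x ∂ν ≤ (1 + ε) * ∫ x, g x ∂μ := by
    have := integral_mono_measure h2 (Filter.Eventually.of_forall hg)
      (hμ.smul_measure ENNReal.ofReal_ne_top)
    rwa [integral_smul_measure, ENNReal.toReal_ofReal (by positivity), smul_eq_mul] at this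
  have a3 : 0 ≤ ∫ x, g x ∂μ := integral_nonneg hg
  rw [abs_le]
  constructor
  · linarith
  · by_cases h : ∫ x, g x ∂ν ≤ ∫ x, g x ∂μ
    · nlinarith [mul_le_mul_of_nonneg_left h hε]
    · nlinarith [mul_nonneg hε a3]

lemma aux_integral {α : Type*} [MeasurableSpace α] (μ ν : Measure α) (ε : ℝ) (hε : 0 ≤ ε)
    (h1 : μ ≤ ENNReal.ofReal (1 + ε) • ν) (h2 : ν ≤ ENNReal.ofReal (1 + ε) • μ)
    (F : α → ℝ) :
    |∫ x, F x ∂μ - ∫ x, F x ∂ν| ≤ ε * ∫ x, |F x| ∂μ := by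
  by_cases hμ : Integrable F μ
  · have hν : Integrable F ν := hμ.of_measure_le_smul ENNReal.ofReal_ne_top h2
    have b1 := aux_integral_nonneg μ ν ε hε h1 h2 (fun x => max (F x) 0)
      (fun x => le_max_right _ _) hμ.pos_part hν.pos_part
    have b2 := aux_integral_nonneg μ ν ε hε h1 h2 (fun x => max (-F x) 0)
      (fun x => le_max_right _ _) hμ.neg_part hν.neg_part
    have e : ∀ m : Measure α, Integrable F m →
        ∫ x, F x ∂m = ∫ x, max (F x) 0 ∂m - ∫ x, max (-F x) 0 ∂m := by
      intro m hm
      rw [← integral_sub hm.pos_part hm.neg_part]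
      congr 1; ext x
      rcases le_total 0 (F x) with h | h
      · simp [h]
      · simp [h]
    have e' : ∫ x, |F x| ∂μ = ∫ x, max (F x) 0 ∂μ + ∫ x, max (-F x) 0 ∂μ := by
      rw [← integral_add hμ.pos_part hμ.neg_part]
      congr 1; ext x
      rcases le_total 0 (F x) with h | h
      · simp [h, abs_of_nonneg]
      · simp [h, abs_of_nonpos]
    rw [e μ hμ, e ν hν, e', mul_add]
    rw [abs_le] at *
    constructor <;> linarith [b1.1, b1.2, b2.1, b2.2]
  · have hν : ¬ Integrable F ν := fun h => hμ (h.of_measure_le_smul ENNReal.ofReal_ne_top h1)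
    rw [integral_undef hμ, integral_undef hν]
    simp only [sub_self, abs_zero]
    exact mul_nonneg hε (integral_nonneg fun x => abs_nonneg _)

lemma aux_hausdorff (f : E3 → E3) (A : Set E3) (k : ℝ) (hk : 0 ≤ k)
    (hf : ∀ x ∈ A, ∀ y ∈ A, ‖f x - f y‖ ^ 2 ≤ k * ‖x - y‖ ^ 2) :
    μH[2] (f '' A) ≤ ENNReal.ofReal k * μH[2] A := by
  have hl : LipschitzOnWith (Real.toNNReal (√k)) f A := by
    refine LipschitzOnWith.of_dist_le_mul fun x hx y hy => ?_
    rw [dist_eq_norm, dist_eq_norm, Real.coe_toNNReal _ (Real.sqrt_nonneg _)]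
    refine abs_le_of_sq_le_sq' ?_ (by positivity) |>.2
    rw [mul_pow, Real.sq_sqrt hk]
    exact hf x hx y hy
  have := hl.hausdorffMeasure_image_le (d := 2) (by norm_num)
  refine this.trans (le_of_eq ?_)
  congr 1
  rw [ENNReal.rpow_ofNat, ← ENNReal.ofReal, ← ENNReal.ofReal_pow (Real.sqrt_nonneg _),
    Real.sq_sqrt hk]

lemma aux_hausdorff_inv (f : E3 → E3) (A : Set E3) (k : ℝ) (hk : 0 ≤ k)
    (hf : ∀ x ∈ A, ∀ y ∈ A, ‖x - y‖ ^ 2 ≤ k * ‖f x - f y‖ ^ 2) :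
    μH[2] A ≤ ENNReal.ofReal k * μH[2] (f '' A) := by
  have hinj : Set.InjOn f A := by
    intro x hx y hy hxy
    have := hf x hx y hy
    rw [hxy, sub_self, norm_zero] at this
    have h0 : ‖x - y‖ ^ 2 = 0 := le_antisymm (by simpa using this) (by positivity)
    exact sub_eq_zero.1 (norm_eq_zero.1 (pow_eq_zero_iff (by norm_num) |>.1 h0))
  have hl := hinj.leftInvOn_invFunOn
  have := aux_hausdorff (Function.invFunOn f A) (f '' A) k hk (by
    rintro _ ⟨x, hx, rfl⟩ _ ⟨y, hy, rfl⟩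
    rw [hl hx, hl hy]
    exact hf x hx y hy)
  rwa [hl.image_image] at this

lemma aux_bilip (Srf : SmoothSurface) (γ₀ : ℝ) (hγ₀ : 0 < γ₀) :
    ∃ C : ℝ, 0 < C ∧ ∀ h : ℝ, 0 < h → h ≤ 1 → ∀ Tr : Triangulation Srf γ₀ h, ∀ t ∈ Tr.T,
      ∀ x ∈ triOf t, ∀ y ∈ triOf t,
        |‖x - y‖ ^ 2 - ‖Tr.a x - Tr.a y‖ ^ 2| ≤
          C * h ^ 2 * (‖x - y‖ ^ 2 + ‖Tr.a x - Tr.a y‖ ^ 2) := by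
  obtain ⟨C, hC, hT⟩ := aux_tangent Srf
  obtain ⟨L, hL, hLip⟩ := aux_normal_lip Srf
  refine ⟨4 * (4 * C) ^ 2 + 2 * (8 * C / γ₀) ^ 2 + 2 * ((4 * C) * 3 + 2 * ((4 * C) * L)) ^ 2,
    by positivity, ?_⟩
  intro h hh hh1 Tr t ht
  have hbdd : Bornology.IsBounded (triOf t) :=
    (Set.Finite.isCompact_convexHull ℝ (by simp)).isBounded
  have hv : vertsOf t ⊆ triOf t := subset_convexHull ℝ _
  have hdist : ∀ x ∈ triOf t, ∀ y ∈ triOf t, ‖x - y‖ ≤ h := fun x hx y hy => by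
    rw [← dist_eq_norm]
    exact (Metric.dist_le_diam_of_mem hbdd hx hy).trans (Tr.diam_le t ht)
  have hN : ∀ x ∈ triOf t, x ∈ Tr.N := fun x hx => Tr.Sh_sub (Set.mem_biUnion ht hx)
  have hv1 : t.1 ∈ vertsOf t := by simp [vertsOf]
  have hnear : ∀ x ∈ triOf t, ‖x - Tr.a x‖ ≤ h := fun x hx => by
    have := Tr.a_nearest x (hN x hx) t.1 (Tr.verts_on t ht hv1)
    rw [dist_eq_norm, dist_eq_norm] at this
    exact this.trans (hdist x hx _ (hv hv1))
  -- the triangle lies in a thin slab around the tangent plane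
  have hslab : ∀ x ∈ triOf t, ∀ z ∈ triOf t,
      |⟪z - Tr.a x, Srf.n (Tr.a x)⟫| ≤ 4 * C * h ^ 2 := by
    intro x hx
    have hconv : Convex ℝ {z : E3 | |⟪z - Tr.a x, Srf.n (Tr.a x)⟫| ≤ 4 * C * h ^ 2} := by
      intro z hz w hw α β hα hβ hab
      simp only [Set.mem_ofPred_eq] at *
      have : α • z + β • w - Tr.a x = α • (z - Tr.a x) + β • (w - Tr.a x) := by
        have h1 : Tr.a x = (α + β) • Tr.a x := by rw [hab, one_smul]
        nth_rewrite 1 [h1]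
        rw [smul_sub, smul_sub, add_smul]; abel
      rw [this, inner_add_left, inner_smul_left, inner_smul_left]
      simp only [RCLike.conj_to_real]
      rw [abs_le] at *
      constructor <;> nlinarith
    have hsub : triOf t ⊆ {z : E3 | |⟪z - Tr.a x, Srf.n (Tr.a x)⟫| ≤ 4 * C * h ^ 2} := by
      refine convexHull_min ?_ hconv
      intro z hz
      have hz' : z ∈ vertsOf t := hz
      have h1 := hT (Tr.a x) (Tr.a_mem x (hN x hx)) z (Tr.verts_on t ht hz')
      have h2 : ‖z - Tr.a x‖ ≤ 2 * h := by
        have e : z - Tr.a x = (z - x) + (x - Tr.a x) := by abel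
        rw [e]
        refine (norm_add_le _ _).trans ?_
        linarith [hdist z (hv hz') x hx, hnear x hx]
      refine h1.trans ?_
      calc C * ‖z - Tr.a x‖ ^ 2 ≤ C * (2 * h) ^ 2 := by gcongr
        _ = _ := by ring
    exact fun z hz => hsub hz
  have hdir : ∀ x ∈ triOf t, ∃ s : ℝ, x - Tr.a x = s • Srf.n (Tr.a x) ∧ |s| ≤ 4 * C * h ^ 2 := by
    intro x hx
    have hS := Tr.a_mem x (hN x hx)
    obtain ⟨s, hs⟩ := aux_normal_dir Srf x (Tr.a x) hS (Tr.a_nearest x (hN x hx))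
    refine ⟨s, hs, ?_⟩
    have := hslab x hx x hx
    rwa [hs, inner_smul_left, real_inner_self_eq_norm_sq, Srf.n_unit _ hS, one_pow, mul_one] at this
  intro x hx y hy
  obtain ⟨s, hs, hsb⟩ := hdir x hx
  obtain ⟨r, hr, hrb⟩ := hdir y hy
  have hpS := Tr.a_mem x (hN x hx)
  have hqS := Tr.a_mem y (hN y hy)
  have hple : ∀ z : ℝ, C * z ^ 2 ≤ 4 * C * z ^ 2 := fun z => by
    nlinarith [mul_nonneg hC.le (sq_nonneg z)]
  refine aux_algebra x y (Tr.a x) (Tr.a y) (Srf.n (Tr.a x)) (Srf.n (Tr.a y)) s r (4 * C) 3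
    (8 * C / γ₀) L h (by positivity) (by norm_num) hL.le hh.le hh1 hs hr (Srf.n_unit _ hpS)
    (Srf.n_unit _ hqS) hsb hrb ?_ ?_ (hLip _ hpS _ hqS) ?_ ?_
  · have := hT _ hpS _ hqS
    rw [← neg_sub, inner_neg_left, abs_neg, norm_neg] at this
    exact this.trans (hple _)
  · exact (hT _ hqS _ hpS).trans (hple _)
  · have e : Tr.a x - Tr.a y = (x - y) - (x - Tr.a x) + (y - Tr.a y) := by abel
    rw [e]
    have e1 := norm_add_le ((x - y) - (x - Tr.a x)) (y - Tr.a y)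
    have e2 := norm_sub_le (x - y) (x - Tr.a x)
    linarith [hnear x hx, hnear y hy, hdist x hx y hy]
  · by_cases hxy : x = y
    · subst hxy; simp
    have hX : 0 < ‖x - y‖ := norm_pos_iff.2 (sub_ne_zero.2 hxy)
    obtain ⟨y0, hy0, hdisk⟩ := Tr.disk t ht
    have hplane : triOf t ⊆ planeOf t := convexHull_subset_affineSpan _
    have hmem : y0 + (γ₀ * h / ‖x - y‖) • (x - y) ∈ triOf t := by
      apply hdisk
      constructor
      · rw [mem_closedBall, dist_eq_norm, add_sub_cancel_left, norm_smul, norm_div, norm_norm,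
          div_mul_cancel₀ _ hX.ne', Real.norm_of_nonneg (by positivity)]
      · have hd : x - y ∈ (affineSpan ℝ (vertsOf t)).direction :=
          AffineSubspace.vsub_mem_direction (hplane hx) (hplane hy)
        have := AffineSubspace.vadd_mem_of_mem_direction
          (Submodule.smul_mem _ (γ₀ * h / ‖x - y‖) hd) (hplane hy0)
        rw [vadd_eq_add, add_comm] at this
        exact this
    have k1 := hslab x hx _ hmem
    have k2 := hslab x hx _ hy0
    rw [add_sub_right_comm, inner_add_left, inner_smul_left] at k1
    simp only [RCLike.conj_to_real] at k1
    have k3 : |γ₀ * h / ‖x - y‖ * ⟪x - y, Srf.n (Tr.a x)⟫| ≤ 8 * C * h ^ 2 := by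
      rw [abs_le] at *
      constructor <;> linarith [k1.1, k1.2, k2.1, k2.2]
    rw [abs_mul, abs_of_pos (by positivity), div_mul_eq_mul_div, div_le_iff₀ hX] at k3
    have k4 : γ₀ * |⟪x - y, Srf.n (Tr.a x)⟫| ≤ 8 * C * h * ‖x - y‖ := by
      have : h * (γ₀ * |⟪x - y, Srf.n (Tr.a x)⟫|) ≤ h * (8 * C * h * ‖x - y‖) := by
        nlinarith
      exact le_of_mul_le_mul_left this hh
    rw [div_mul_eq_mul_div, div_mul_eq_mul_div, le_div_iff₀ hγ₀]
    linarith

lemma aux_ratio (δ u v : ℝ) (hδ : 0 ≤ δ) (hδ2 : δ ≤ 1 / 2) (hu : 0 ≤ u) (hv : 0 ≤ v)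
    (h : |u - v| ≤ δ * (u + v)) : v ≤ (1 + 4 * δ) * u ∧ u ≤ (1 + 4 * δ) * v := by
  rw [abs_le] at h
  have m1 : 0 ≤ δ * u := mul_nonneg hδ hu
  have m2 : 0 ≤ δ * v := mul_nonneg hδ hv
  have n1 : δ * v ≤ 1 / 2 * v := mul_le_mul_of_nonneg_right hδ2 hv
  have n2 : δ * u ≤ 1 / 2 * u := mul_le_mul_of_nonneg_right hδ2 hu
  have o1 : v ≤ 3 * u := by linarith [h.1]
  have o2 : u ≤ 3 * v := by linarith [h.2]
  have p1 := mul_le_mul_of_nonneg_left o1 hδ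
  have p2 := mul_le_mul_of_nonneg_left o2 hδ
  constructor <;> linarith [h.1, h.2]

/-- **Comparison of integrals over `S` and `S_h`.**
`|∫_S F − ∫_{S_h} F∘a| ≤ c h² ∫_S |F|` for every continuous `F : S → ℝ`. -/
theorem integral_comparison (Srf : SmoothSurface) (γ₀ : ℝ) (hγ₀ : 0 < γ₀) :
    ∃ c > 0, ∃ h₀ > 0,
      ∀ h : ℝ, 0 < h → h ≤ h₀ →
        ∀ Tr : Triangulation Srf γ₀ h, ∀ F : E3 → ℝ, ContinuousOn F Srf.S →
          |(∫ x in Srf.S, F x ∂μH[2]) - ∫ x in Tr.Sh, F (Tr.a x) ∂μH[2]| ≤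
            c * h ^ 2 * ∫ x in Srf.S, |F x| ∂μH[2] := by
  obtain ⟨C, hC, hbl⟩ := aux_bilip Srf γ₀ hγ₀
  refine ⟨4 * C, by positivity, min 1 (√(1 / (2 * C))), by positivity, ?_⟩
  intro h hh hh0 Tr F hF
  have hh1 : h ≤ 1 := hh0.trans (min_le_left _ _)
  have hδ : C * h ^ 2 ≤ 1 / 2 := by
    have h1 : h ≤ √(1 / (2 * C)) := hh0.trans (min_le_right _ _)
    have h2 : h ^ 2 ≤ 1 / (2 * C) := (Real.le_sqrt' hh).1 h1
    rw [le_div_iff₀ (by positivity)] at h2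
    linarith
  set ε : ℝ := 4 * (C * h ^ 2) with hε
  have hε0 : 0 ≤ ε := by positivity
  have hcomp : ∀ t ∈ Tr.T, IsCompact (triOf t) := fun t _ =>
    Set.Finite.isCompact_convexHull ℝ (by simp)
  have hShm : MeasurableSet Tr.Sh := (Tr.T.isCompact_biUnion hcomp).measurableSet
  have hSm : MeasurableSet Srf.S := Srf.compact.measurableSet
  have hac : ContinuousOn Tr.a Tr.Sh := Tr.a_smooth.continuousOn.mono Tr.Sh_sub
  have hr : ∀ t ∈ Tr.T, ∀ x ∈ triOf t, ∀ y ∈ triOf t,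
      ‖Tr.a x - Tr.a y‖ ^ 2 ≤ (1 + ε) * ‖x - y‖ ^ 2 ∧
      ‖x - y‖ ^ 2 ≤ (1 + ε) * ‖Tr.a x - Tr.a y‖ ^ 2 := fun t ht x hx y hy =>
    aux_ratio (C * h ^ 2) _ _ (by positivity) hδ (by positivity) (by positivity)
      (hbl h hh hh1 Tr t ht x hx y hy)
  classical
  have hm := aux_measure (f := Tr.a) Tr.T triOf (fun t ht => (hcomp t ht).measurableSet)
    (ENNReal.ofReal (1 + ε)) hac Tr.a_bij.injOn
    (fun t ht A hA => aux_hausdorff Tr.a A (1 + ε) (by positivity)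
      fun x hx y hy => (hr t ht x (hA hx) y (hA hy)).1)
    (fun t ht A hA => aux_hausdorff_inv Tr.a A (1 + ε) (by positivity)
      fun x hx y hy => (hr t ht x (hA hx) y (hA hy)).2)
  have hae : AEMeasurable Tr.a ((μH[2] : Measure E3).restrict Tr.Sh) := hac.aemeasurable hShm
  -- the measure of preimages
  have hpre : ∀ B : Set E3, MeasurableSet B →
      MeasurableSet (Tr.Sh ∩ Tr.a ⁻¹' B) := fun B hB => by
    have h1 : Measurable (Tr.Sh.domRestrict Tr.a) := (continuousOn_iff_continuous_domRestrict.1 hac).measurable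
    have h2 := hShm.subtype_image (h1 hB)
    convert h2 using 1
    ext z
    constructor
    · rintro ⟨hz, hzB⟩
      exact ⟨⟨z, hz⟩, hzB, rfl⟩
    · rintro ⟨⟨w, hw⟩, hwB, rfl⟩
      exact ⟨hw, hwB⟩
  have himg : ∀ B : Set E3, Tr.a '' (Tr.Sh ∩ Tr.a ⁻¹' B) = B ∩ Srf.S := fun B => by
    rw [Set.image_inter_preimage, Set.inter_comm]
    congr 1
    exact Tr.a_bij.image_eq
  have hν : ∀ B : Set E3, MeasurableSet B →
      (Measure.map Tr.a ((μH[2] : Measure E3).restrict Tr.Sh)) B = μH[2] (Tr.Sh ∩ Tr.a ⁻¹' B) := by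
    intro B hB
    rw [Measure.map_apply_of_aemeasurable hae hB, Measure.restrict_apply' hShm, Set.inter_comm]
  have hle1 : (μH[2] : Measure E3).restrict Srf.S ≤
      ENNReal.ofReal (1 + ε) • Measure.map Tr.a ((μH[2] : Measure E3).restrict Tr.Sh) := by
    refine Measure.le_iff.2 fun B hB => ?_
    rw [Measure.smul_apply, hν B hB, Measure.restrict_apply hB, ← himg B, smul_eq_mul]
    exact (hm _ Set.inter_subset_left (hpre B hB)).1
  have hle2 : Measure.map Tr.a ((μH[2] : Measure E3).restrict Tr.Sh) ≤
      ENNReal.ofReal (1 + ε) • (μH[2] : Measure E3).restrict Srf.S := by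
    refine Measure.le_iff.2 fun B hB => ?_
    rw [Measure.smul_apply, hν B hB, Measure.restrict_apply hB, ← himg B, smul_eq_mul]
    exact (hm _ Set.inter_subset_left (hpre B hB)).2
  have hFm : AEStronglyMeasurable F ((μH[2] : Measure E3).restrict Srf.S) :=
    hF.aestronglyMeasurable hSm
  have hFν : AEStronglyMeasurable F (Measure.map Tr.a ((μH[2] : Measure E3).restrict Tr.Sh)) :=
    hFm.mono_ac (Measure.absolutelyContinuous_of_le_smul hle2)
  rw [← integral_map hae hFν]
  have := aux_integral _ _ ε hε0 hle1 hle2 F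
  rw [show 4 * C * h ^ 2 = ε by rw [hε]; ring]
  exact this

end
end

section
/- Let S be a compact, orientable, two-dimensional embedded C^∞ submanifold of ℝ³ without boundary, and let 1 ≤ p ≤ ∞ with Hölder conjugate p*. There exist constants c > 0 and h₀ > 0, depending only on S and γ₀ (not on p), such that for every admissible quasi-uniform triangulation T_h with h ≤ h₀ and all Lipschitz functions f, g : S → ℝ, with lifts f̃ = f∘a and g̃ = g∘a to S_h, | ∫_S ⟨∇_S f, ∇_S g⟩ − ∫_{S_h} ⟨∇_{S_h} f̃, ∇_{S_h} g̃⟩ | ≤ c h² ‖f‖_{W^{1,p}(S)} ‖g‖_{W^{1,p*}(S)}, where ‖f‖_{W^{1,p}(S)} = ( ∫_S |f|^p + |∇_S f|^p )^{1/p} (with the usual sup-norm modification for p = ∞). -/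
open MeasureTheory Metric
open scoped RealInnerProductSpace ENNReal NNReal

noncomputable section

/-- The `W^{1,p}(S)`-norm `(∫_S |f|^p + |∇_S f|^p)^{1/p}` (with the sup-norm modification
for `p = ∞`), as an extended nonnegative real. -/
def W1pNorm (Srf : SmoothSurface) (f : E3 → ℝ) (p : ℝ≥0∞) : ℝ≥0∞ :=
  if p = ∞ then
    essSup (fun x => ENNReal.ofReal (max |f x| ‖Srf.grad f x‖)) (μH[2].restrict Srf.S)
  else
    (∫⁻ x in Srf.S,
        ENNReal.ofReal (|f x| ^ p.toReal + ‖Srf.grad f x‖ ^ p.toReal) ∂μH[2]) ^ (1 / p.toReal)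

lemma surf_local (Srf : SmoothSurface) (z : E3) (hz : z ∈ Srf.S) :
    ∃ r > 0, ∃ C : ℝ, 0 ≤ C ∧ ∀ X ∈ Srf.S ∩ ball z r, ∀ Y ∈ Srf.S ∩ ball z r,
      |⟪Srf.n X, Y - X⟫| ≤ C * ‖Y - X‖ ^ 2 := by
  obtain ⟨U, F, hU, hzU, hF, hSU, hne, hn⟩ := Srf.localLevel z hz
  have hF2 : ContDiff ℝ 1 (fderiv ℝ F) := hF.fderiv_right (m := 1) (by norm_cast)
  obtain ⟨K, s, hs, hK⟩ := hF2.contDiffAt.exists_lipschitzOnWith (x := z)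
  have hgz : 0 < ‖fderiv ℝ F z‖ := by
    have := hne z hzU
    rw [norm_pos_iff]
    intro h0
    apply this
    simp [gradient, h0]
  have hcont : ContinuousAt (fun y => ‖fderiv ℝ F y‖) z := hF2.continuous.norm.continuousAt
  have hev : ∀ᶠ y in nhds z, ‖fderiv ℝ F z‖ / 2 < ‖fderiv ℝ F y‖ :=
    hcont.eventually (lt_mem_nhds (by linarith))
  obtain ⟨r, hr, hball⟩ := Metric.mem_nhds_iff.1 (Filter.inter_mem (Filter.inter_mem hs hev) (hU.mem_nhds hzU))
  refine ⟨r, hr, K / (‖fderiv ℝ F z‖ / 2), by positivity, ?_⟩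
  rintro X ⟨hXS, hXb⟩ Y ⟨hYS, hYb⟩
  have hX := hball hXb
  have hY := hball hYb
  have hFX : F X = 0 := by
    have : X ∈ Srf.S ∩ U := ⟨hXS, hX.2⟩
    rw [hSU] at this; exact this.2
  have hFY : F Y = 0 := by
    have : Y ∈ Srf.S ∩ U := ⟨hYS, hY.2⟩
    rw [hSU] at this; exact this.2
  have hseg : segment ℝ X Y ⊆ ball z r := (convex_ball z r).segment_subset hXb hYb
  have hmv := (convex_segment X Y).norm_image_sub_le_of_norm_hasFDerivWithin_le' (f := F)
    (f' := fderiv ℝ F) (φ := fderiv ℝ F X) (C := K * ‖Y - X‖) (x := X) (y := Y)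
    (fun w _ => (hF.differentiable (by simp) w).hasFDerivAt.hasFDerivWithinAt)
    (fun w hw => by
      have h1 := hK.norm_sub_le (hball (hseg hw)).1.1 hX.1.1
      refine h1.trans ?_
      gcongr
      have := norm_sub_le_of_mem_segment hw
      exact this)
    (left_mem_segment ℝ X Y) (right_mem_segment ℝ X Y)
  rw [hFX, hFY] at hmv
  obtain ⟨c, hc⟩ := hn X ⟨hXS, hX.2⟩
  have hfd : ∀ v, fderiv ℝ F X v = c * ⟪Srf.n X, v⟫ := by
    intro v
    have : ⟪gradient F X, v⟫ = fderiv ℝ F X v := by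
      simp [gradient]
    rw [← this, hc, real_inner_smul_left]
  have hcn : ‖fderiv ℝ F X‖ = |c| := by
    have : ‖gradient F X‖ = ‖fderiv ℝ F X‖ := by simp [gradient]
    rw [← this, hc, norm_smul, Srf.n_unit X hXS]; simp
  have hcl : ‖fderiv ℝ F z‖ / 2 < |c| := by rw [← hcn]; exact hX.1.2
  have hmv' : |c| * |⟪Srf.n X, Y - X⟫| ≤ K * ‖Y - X‖ ^ 2 := by
    rw [← abs_mul, ← hfd]
    simp only [sub_zero, zero_sub, norm_neg, Real.norm_eq_abs] at hmv
    calc _ ≤ _ := hmv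
      _ = _ := by ring
  rw [div_mul_eq_mul_div, le_div_iff₀ (by positivity)]
  calc _ = ‖fderiv ℝ F z‖ / 2 * |⟪Srf.n X, Y - X⟫| := by ring
    _ ≤ |c| * |⟪Srf.n X, Y - X⟫| := by gcongr
    _ ≤ _ := hmv'

lemma surf_quad (Srf : SmoothSurface) :
    ∃ C : ℝ, 0 ≤ C ∧ ∀ X ∈ Srf.S, ∀ Y ∈ Srf.S, |⟪Srf.n X, Y - X⟫| ≤ C * ‖Y - X‖ ^ 2 := by
  have key : ∃ C : ℝ, 0 ≤ C ∧ ∀ X ∈ Srf.S ∩ Srf.S, ∀ Y ∈ Srf.S,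
      |⟪Srf.n X, Y - X⟫| ≤ C * ‖Y - X‖ ^ 2 := by
    refine Srf.compact.induction_on (p := fun s => ∃ C : ℝ, 0 ≤ C ∧ ∀ X ∈ s ∩ Srf.S, ∀ Y ∈ Srf.S,
      |⟪Srf.n X, Y - X⟫| ≤ C * ‖Y - X‖ ^ 2) ?_ ?_ ?_ ?_
    · exact ⟨0, le_rfl, by simp⟩
    · rintro s t hst ⟨C, hC, h⟩
      exact ⟨C, hC, fun X hX => h X ⟨hst hX.1, hX.2⟩⟩
    · rintro s t ⟨C, hC, h⟩ ⟨D, hD, h'⟩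
      refine ⟨max C D, hC.trans (le_max_left _ _), ?_⟩
      rintro X ⟨hX | hX, hXS⟩ Y hY
      · exact (h X ⟨hX, hXS⟩ Y hY).trans (by gcongr; exact le_max_left _ _)
      · exact (h' X ⟨hX, hXS⟩ Y hY).trans (by gcongr; exact le_max_right _ _)
    · intro z hz
      obtain ⟨r, hr, C, hC, h⟩ := surf_local Srf z hz
      refine ⟨ball z (r/2), mem_nhdsWithin_of_mem_nhds (ball_mem_nhds z (by positivity)),
        max C (2 / r), hC.trans (le_max_left _ _), ?_⟩
      rintro X ⟨hX, hXS⟩ Y hY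
      by_cases hYb : Y ∈ ball z r
      · exact (h X ⟨hXS, ball_subset_ball (by linarith) hX⟩ Y ⟨hY, hYb⟩).trans
          (by gcongr; exact le_max_left _ _)
      · have h1 : r / 2 ≤ ‖Y - X‖ := by
          rw [← dist_eq_norm]
          have := dist_triangle Y X z
          simp only [mem_ball] at hX hYb
          linarith
        have h2 : |⟪Srf.n X, Y - X⟫| ≤ ‖Y - X‖ := by
          have := abs_real_inner_le_norm (Srf.n X) (Y - X)
          rwa [Srf.n_unit X hXS, one_mul] at this
        calc _ ≤ ‖Y - X‖ := h2
          _ ≤ 2 / r * ‖Y - X‖ ^ 2 := by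
            rw [div_mul_eq_mul_div, le_div_iff₀ hr]; nlinarith [norm_nonneg (Y - X)]
          _ ≤ _ := by gcongr; exact le_max_right _ _
  obtain ⟨C, hC, h⟩ := key
  exact ⟨C, hC, fun X hX => h X ⟨hX, hX⟩⟩

lemma n_lip (Srf : SmoothSurface) : ∃ C : ℝ≥0, LipschitzOnWith C Srf.n Srf.S := by
  obtain ⟨U, hU, hSU, hn⟩ := Srf.n_smooth
  apply LocallyLipschitzOn.exists_lipschitzOnWith_of_compact Srf.compact
  intro x hx
  have : ContDiffAt ℝ 1 Srf.n x := (hn.contDiffAt (hU.mem_nhds (hSU hx))).of_le (by norm_cast)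
  obtain ⟨K, t, ht, h⟩ := this.exists_lipschitzOnWith
  exact ⟨K, t, mem_nhdsWithin_of_mem_nhds ht, h⟩

lemma surf_const (Srf : SmoothSurface) :
    ∃ C : ℝ, 1 ≤ C ∧ (∀ X ∈ Srf.S, ∀ Y ∈ Srf.S, |⟪Srf.n X, Y - X⟫| ≤ C * ‖Y - X‖ ^ 2) ∧
      (∀ X ∈ Srf.S, ∀ Y ∈ Srf.S, ‖Srf.n X - Srf.n Y‖ ≤ C * ‖X - Y‖) := by
  obtain ⟨C, hC, h⟩ := surf_quad Srf
  obtain ⟨D, hD⟩ := n_lip Srf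
  refine ⟨max 1 (max C D), le_max_left _ _, fun X hX Y hY => (h X hX Y hY).trans ?_,
    fun X hX Y hY => (hD.norm_sub_le hX hY).trans ?_⟩
  · gcongr; exact (le_max_left _ _).trans (le_max_right _ _)
  · gcongr; exact (le_max_right _ _).trans (le_max_right _ _)

/-- The nearest point projection moves along the normal. -/
lemma nearest_normal (Srf : SmoothSurface) (x X : E3) (hX : X ∈ Srf.S)
    (hmin : ∀ y ∈ Srf.S, dist x X ≤ dist x y) :
    ∃ d : ℝ, x - X = d • Srf.n X := by
  obtain ⟨U, F, hU, hzU, hF, hSU, hne, hn⟩ := Srf.localLevel X hX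
  have hFX : F X = 0 := by
    have : X ∈ Srf.S ∩ U := ⟨hX, hzU⟩
    rw [hSU] at this; exact this.2
  have hloc : IsLocalExtrOn (fun y => ‖y - x‖ ^ 2) {y | F y = F X} X := by
    left
    have : ∀ᶠ y in nhdsWithin X {y | F y = F X}, y ∈ U :=
      mem_nhdsWithin_of_mem_nhds (hU.mem_nhds hzU)
    filter_upwards [this, self_mem_nhdsWithin] with y hy hy2
    have hyS : y ∈ Srf.S ∩ U := by
      rw [hSU]; exact ⟨hy, by rw [← hFX]; exact hy2⟩
    have := hmin y hyS.1
    rw [dist_comm, dist_comm x y, dist_eq_norm, dist_eq_norm] at this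
    gcongr
  have hφ : HasStrictFDerivAt (fun y : E3 => ‖y - x‖ ^ 2) (2 • (innerSL ℝ (X - x))) X := by
    have h1 := (hasStrictFDerivAt_id (𝕜 := ℝ) X).sub_const x
    have h2 := (hasStrictFDerivAt_norm_sq (X - x)).comp X h1
    simpa using h2
  obtain ⟨a, b, hab, heq⟩ := hloc.exists_multipliers_of_hasStrictFDerivAt_1d
    (hF.contDiffAt.hasStrictFDerivAt (by simp)) hφ
  obtain ⟨c, hc⟩ := hn X ⟨hX, hzU⟩
  have hv : ∀ v, a * (c * ⟪Srf.n X, v⟫) + b * (2 * ⟪X - x, v⟫) = 0 := by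
    intro v
    have h1 := congrArg (fun L => L v) heq
    have : ⟪gradient F X, v⟫ = fderiv ℝ F X v := by simp [gradient]
    rw [hc, real_inner_smul_left] at this
    simp at h1
    rw [← this] at h1
    rw [inner_sub_left]
    linarith
  have hc0 : c ≠ 0 := by
    rintro rfl
    exact hne X hzU (by simpa using hc)
  have hb : b ≠ 0 := by
    rintro rfl
    have := hv (Srf.n X)
    rw [real_inner_self_eq_norm_sq, Srf.n_unit X hX] at this
    simp at this
    rcases this with rfl | h
    · simp at hab
    · exact hc0 h
  refine ⟨a * c / (2 * b), ?_⟩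
  apply ext_inner_right ℝ
  intro v
  have := hv v
  rw [real_inner_smul_left, div_mul_eq_mul_div, eq_div_iff (by positivity)]
  rw [← neg_sub, inner_neg_left] 
  linarith

lemma mem_dirOf (t : E3 × E3 × E3) (v : E3) :
    v ∈ dirOf t ↔ ∃ α β : ℝ, v = α • (t.2.1 - t.1) + β • (t.2.2 - t.1) := by
  have h1 : t.1 ∈ vertsOf t := by simp [vertsOf]
  have h2 : (· -ᵥ t.1) '' vertsOf t = {0, t.2.1 - t.1, t.2.2 - t.1} := by
    simp [vertsOf, Set.image_insert_eq]
  rw [dirOf, direction_affineSpan, vectorSpan_eq_span_vsub_set_right ℝ h1, h2,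
    Submodule.mem_span_insert]
  simp only [Submodule.mem_span_insert, Submodule.mem_span_singleton]
  constructor
  · rintro ⟨a, z, ⟨α, z', ⟨β, rfl⟩, rfl⟩, rfl⟩
    exact ⟨α, β, by simp⟩
  · rintro ⟨α, β, rfl⟩
    exact ⟨0, _, ⟨α, _, ⟨β, rfl⟩, rfl⟩, by simp⟩

lemma mem_planeOf (t : E3 × E3 × E3) (x p : E3) (hp : p ∈ planeOf t) :
    x ∈ planeOf t ↔ x - p ∈ dirOf t := by
  have := AffineSubspace.vsub_right_mem_direction_iff_mem (s := affineSpan ℝ (vertsOf t)) hp x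
  exact this.symm

lemma triOf_subset_planeOf (t : E3 × E3 × E3) : triOf t ⊆ planeOf t :=
  convexHull_subset_affineSpan _

lemma vert_mem_triOf (t : E3 × E3 × E3) {v : E3} (hv : v ∈ vertsOf t) : v ∈ triOf t :=
  subset_convexHull ℝ _ hv

lemma tri_coords (t : E3 × E3 × E3) (hi : AffineIndependent ℝ ![t.1, t.2.1, t.2.2]) :
    ∃ l1 l2 : E3 →L[ℝ] ℝ, l1 (t.2.1 - t.1) = 1 ∧ l1 (t.2.2 - t.1) = 0 ∧
      l2 (t.2.1 - t.1) = 0 ∧ l2 (t.2.2 - t.1) = 1 := by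
  have hlin : ∀ α β : ℝ, α • (t.2.1 - t.1) + β • (t.2.2 - t.1) = 0 → α = 0 ∧ β = 0 := by
    intro α β h
    rw [affineIndependent_iff] at hi
    have := hi Finset.univ ![-(α + β), α, β] (by simp [Fin.sum_univ_three])
      (by
        simp only [Fin.sum_univ_three, Matrix.cons_val]
        rw [← h]; module)
    exact ⟨by simpa using this 1, by simpa using this 2⟩
  let φ : ℝ × ℝ →ₗ[ℝ] E3 :=
    (LinearMap.fst ℝ ℝ ℝ).smulRight (t.2.1 - t.1) + (LinearMap.snd ℝ ℝ ℝ).smulRight (t.2.2 - t.1)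
  have hφ : LinearMap.ker φ = ⊥ := by
    rw [LinearMap.ker_eq_bot']
    rintro ⟨α, β⟩ h
    have := hlin α β (by simpa [φ] using h)
    simp [this.1, this.2]
  obtain ⟨g, hg⟩ := φ.exists_leftInverse_of_injective hφ
  have e1 : g (t.2.1 - t.1) = (1, 0) := by
    have := congrArg (fun L => L ((1, 0) : ℝ × ℝ)) hg
    simpa [φ] using this
  have e2 : g (t.2.2 - t.1) = (0, 1) := by
    have := congrArg (fun L => L ((0, 1) : ℝ × ℝ)) hg
    simpa [φ] using this
  refine ⟨LinearMap.toContinuousLinearMap (LinearMap.fst ℝ ℝ ℝ ∘ₗ g),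
    LinearMap.toContinuousLinearMap (LinearMap.snd ℝ ℝ ℝ ∘ₗ g), ?_, ?_, ?_, ?_⟩ <;>
  simp only [LinearMap.coe_toContinuousLinearMap', LinearMap.comp_apply, e1, e2] <;> rfl

lemma dirOf_coords (t : E3 × E3 × E3) (l1 l2 : E3 →L[ℝ] ℝ) (h11 : l1 (t.2.1 - t.1) = 1)
    (h12 : l1 (t.2.2 - t.1) = 0) (h21 : l2 (t.2.1 - t.1) = 0) (h22 : l2 (t.2.2 - t.1) = 1)
    {v : E3} (hv : v ∈ dirOf t) :
    v = l1 v • (t.2.1 - t.1) + l2 v • (t.2.2 - t.1) := by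
  obtain ⟨α, β, rfl⟩ := (mem_dirOf t v).1 hv
  rw [map_add, map_add, map_smul, map_smul, map_smul, map_smul, h11, h12, h21, h22]
  simp

lemma mem_triOf (t : E3 × E3 × E3) (x : E3) :
    x ∈ triOf t ↔ ∃ α β : ℝ, 0 ≤ α ∧ 0 ≤ β ∧ α + β ≤ 1 ∧
      x = t.1 + (α • (t.2.1 - t.1) + β • (t.2.2 - t.1)) := by
  constructor
  · intro hx
    have hsub : triOf t ⊆ {x | ∃ α β : ℝ, 0 ≤ α ∧ 0 ≤ β ∧ α + β ≤ 1 ∧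
      x = t.1 + (α • (t.2.1 - t.1) + β • (t.2.2 - t.1))} := by
      apply convexHull_min
      · rintro y (rfl | rfl | rfl)
        · exact ⟨0, 0, by simp⟩
        · exact ⟨1, 0, by simp⟩
        · exact ⟨0, 1, by simp⟩
      · rintro _ ⟨α, β, h1, h2, h3, rfl⟩ _ ⟨α', β', h1', h2', h3', rfl⟩ a b ha hb hab
        refine ⟨a * α + b * α', a * β + b * β', by positivity, by positivity, by nlinarith, ?_⟩
        have : b = 1 - a := by linarith
        subst this
        module
    exact hsub hx
  · rintro ⟨α, β, h1, h2, h3, rfl⟩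
    have hc : Convex ℝ (triOf t) := convex_convexHull ℝ _
    have := hc.sum_mem (t := Finset.univ) (w := ![1 - α - β, α, β]) (z := ![t.1, t.2.1, t.2.2])
      (by intro i _; fin_cases i <;> simp <;> linarith) (by simp [Fin.sum_univ_three]; ring)
      (by intro i _; apply vert_mem_triOf; fin_cases i <;> simp [vertsOf])
    simp only [Fin.sum_univ_three, Matrix.cons_val] at this
    convert this using 1
    module

/-- Relative interior of the triangle. -/
def triI (t : E3 × E3 × E3) : Set E3 :=
  {x | x ∈ triOf t ∧ ∃ r > 0, ball x r ∩ planeOf t ⊆ triOf t}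

def triE (t : E3 × E3 × E3) : Set E3 :=
  segment ℝ t.1 t.2.1 ∪ segment ℝ t.1 t.2.2 ∪ segment ℝ t.2.1 t.2.2

lemma mem_triI (t : E3 × E3 × E3) (l1 l2 : E3 →L[ℝ] ℝ) (h11 : l1 (t.2.1 - t.1) = 1)
    (h12 : l1 (t.2.2 - t.1) = 0) (h21 : l2 (t.2.1 - t.1) = 0) (h22 : l2 (t.2.2 - t.1) = 1)
    (x : E3) : x ∈ triI t ↔ x ∈ triOf t ∧ 0 < l1 (x - t.1) ∧ 0 < l2 (x - t.1) ∧
      l1 (x - t.1) + l2 (x - t.1) < 1 := by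
  have hp1 : t.1 ∈ planeOf t := triOf_subset_planeOf t (vert_mem_triOf t (by simp [vertsOf]))
  have hmem : ∀ y ∈ triOf t, 0 ≤ l1 (y - t.1) ∧ 0 ≤ l2 (y - t.1) ∧
      l1 (y - t.1) + l2 (y - t.1) ≤ 1 := by
    intro y hy
    obtain ⟨α, β, h1, h2, h3, rfl⟩ := (mem_triOf t y).1 hy
    rw [add_sub_cancel_left, map_add, map_add, map_smul, map_smul, map_smul, map_smul, h11, h12,
      h21, h22]
    simp [h1, h2, h3]
  constructor
  · rintro ⟨hx, r, hr, hsub⟩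
    refine ⟨hx, ?_⟩
    have key : ∀ v ∈ dirOf t, ∃ s > 0, x + (s : ℝ) • v ∈ triOf t := by
      intro v hv
      have hlim : Filter.Tendsto (fun s : ℝ => x + s • v) (nhdsWithin 0 (Set.Ioi 0)) (nhds x) := by
        have : Continuous (fun s : ℝ => x + s • v) := by fun_prop
        have h := this.tendsto 0
        simp only [zero_smul, add_zero] at h
        exact h.mono_left nhdsWithin_le_nhds
      have hev := (hlim.eventually (ball_mem_nhds x hr)).and self_mem_nhdsWithin
      obtain ⟨s, hs1, hs2⟩ := hev.exists
      refine ⟨s, hs2, hsub ⟨hs1, ?_⟩⟩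
      rw [mem_planeOf t _ x (triOf_subset_planeOf t hx)]
      simpa using Submodule.smul_mem _ s hv
    have hd1 : t.2.1 - t.1 ∈ dirOf t := (mem_dirOf t _).2 ⟨1, 0, by simp⟩
    have hd2 : t.2.2 - t.1 ∈ dirOf t := (mem_dirOf t _).2 ⟨0, 1, by simp⟩
    refine ⟨?_, ?_, ?_⟩
    · obtain ⟨s, hs, h⟩ := key (-(t.2.1 - t.1)) (neg_mem hd1)
      have := (hmem _ h).1
      rw [add_sub_right_comm, map_add, map_smul, map_neg, h11] at this
      simp at this
      simp; linarith
    · obtain ⟨s, hs, h⟩ := key (-(t.2.2 - t.1)) (neg_mem hd2)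
      have := (hmem _ h).2.1
      rw [add_sub_right_comm, map_add, map_smul, map_neg, h22] at this
      simp at this
      simp; linarith
    · obtain ⟨s, hs, h⟩ := key (t.2.1 - t.1) hd1
      have := (hmem _ h).2.2
      rw [add_sub_right_comm, map_add, map_smul, h11, map_add, map_smul, h21] at this
      simp at this
      simp; linarith
  · rintro ⟨hx, h1, h2, h3⟩
    refine ⟨hx, ?_⟩
    have hopen : IsOpen {y : E3 | 0 < l1 (y - t.1) ∧ 0 < l2 (y - t.1) ∧
      l1 (y - t.1) + l2 (y - t.1) < 1} := by
      have o1 : IsOpen {y : E3 | 0 < l1 (y - t.1)} := isOpen_lt (by fun_prop) (by fun_prop)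
      have o2 : IsOpen {y : E3 | 0 < l2 (y - t.1)} := isOpen_lt (by fun_prop) (by fun_prop)
      have o3 : IsOpen {y : E3 | l1 (y - t.1) + l2 (y - t.1) < 1} :=
        isOpen_lt (by fun_prop) (by fun_prop)
      exact o1.inter (o2.inter o3)
    obtain ⟨r, hr, hb⟩ := Metric.isOpen_iff.1 hopen x ⟨h1, h2, h3⟩
    refine ⟨r, hr, ?_⟩
    rintro y ⟨hyb, hyp⟩
    obtain ⟨k1, k2, k3⟩ := hb hyb
    rw [mem_planeOf t _ t.1 hp1] at hyp
    refine (mem_triOf t y).2 ⟨_, _, k1.le, k2.le, k3.le, ?_⟩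
    rw [← dirOf_coords t l1 l2 h11 h12 h21 h22 hyp]; simp

lemma triI_not_seg (t : E3 × E3 × E3) (hi : AffineIndependent ℝ ![t.1, t.2.1, t.2.2])
    {x v w : E3} (hx : x ∈ triI t) (hv : v ∈ vertsOf t) (hw : w ∈ vertsOf t) :
    x ∉ segment ℝ v w := by
  obtain ⟨l1, l2, h11, h12, h21, h22⟩ := tri_coords t hi
  obtain ⟨-, k1, k2, k3⟩ := (mem_triI t l1 l2 h11 h12 h21 h22 x).1 hx
  rintro ⟨a, b, ha, hb, hab, rfl⟩
  have hb' : b = 1 - a := by linarith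
  subst hb'
  rw [map_sub] at h11 h12 h21 h22
  simp only [map_sub, map_add, map_smul, smul_eq_mul] at k1 k2 k3
  rcases hv with rfl | rfl | rfl <;> rcases hw with rfl | rfl | rfl <;> nlinarith

lemma triOf_diff (t : E3 × E3 × E3) (hi : AffineIndependent ℝ ![t.1, t.2.1, t.2.2]) :
    triI t = triOf t \ triE t := by
  ext x
  constructor
  · intro hx
    refine ⟨hx.1, ?_⟩
    rintro ((h | h) | h)
    all_goals exact triI_not_seg t hi hx (by simp [vertsOf]) (by simp [vertsOf]) h
  · rintro ⟨hx, hE⟩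
    obtain ⟨l1, l2, h11, h12, h21, h22⟩ := tri_coords t hi
    refine (mem_triI t l1 l2 h11 h12 h21 h22 x).2 ⟨hx, ?_⟩
    obtain ⟨α, β, h1, h2, h3, rfl⟩ := (mem_triOf t x).1 hx
    rw [add_sub_cancel_left, map_add, map_add, map_smul, map_smul, map_smul, map_smul, h11, h12,
      h21, h22]
    simp only [smul_eq_mul, mul_one, mul_zero, add_zero, zero_add]
    refine ⟨?_, ?_, ?_⟩
    · refine lt_of_le_of_ne h1 ?_
      rintro rfl
      exact hE (Or.inl (Or.inr ⟨1 - β, β, by linarith, h2, by ring, by module⟩))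
    · refine lt_of_le_of_ne h2 ?_
      rintro rfl
      exact hE (Or.inl (Or.inl ⟨1 - α, α, by linarith, h1, by ring, by module⟩))
    · refine lt_of_le_of_ne h3 ?_
      intro h
      have : β = 1 - α := by linarith
      subst this
      exact hE (Or.inr ⟨α, 1 - α, h1, h2, by ring, by module⟩)

lemma segment_null (x y : E3) : (μH[2] : Measure E3) (segment ℝ x y) = 0 := by
  rcases Measure.hausdorffMeasure_zero_or_top (show (1:ℝ) < 2 by norm_num) (segment ℝ x y) with h | h
  · exact h
  · rw [hausdorffMeasure_segment] at h
    exact absurd h (edist_ne_top _ _)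

lemma triE_null (t : E3 × E3 × E3) : (μH[2] : Measure E3) (triE t) = 0 := by
  simp [triE, segment_null]

lemma triOf_compact (t : E3 × E3 × E3) : IsCompact (triOf t) :=
  (Set.toFinite _).isCompact_convexHull ℝ

lemma triE_compact (t : E3 × E3 × E3) : IsCompact (triE t) := by
  have : ∀ x y : E3, IsCompact (segment ℝ x y) := fun x y => by
    rw [← convexHull_pair]; exact (Set.toFinite _).isCompact_convexHull ℝ
  exact ((this _ _).union (this _ _)).union (this _ _)

lemma finrank_dirOf (t : E3 × E3 × E3) (hi : AffineIndependent ℝ ![t.1, t.2.1, t.2.2]) :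
    Module.finrank ℝ (dirOf t) = 2 := by
  have := hi.finrank_vectorSpan (n := 2) (by simp)
  have hr : Set.range ![t.1, t.2.1, t.2.2] = vertsOf t := by
    ext x
    simp only [Set.mem_range, vertsOf, Set.mem_insert_iff, Set.mem_singleton_iff, Fin.exists_fin_succ]
    simp [eq_comm]
  rw [hr] at this
  rw [dirOf, direction_affineSpan]
  exact this

lemma comb3 (A α β b1 b2 b3 B : ℝ) (hA : 0 ≤ A) (hα : 0 ≤ α) (hβ : 0 ≤ β) (hs : A + α + β = 1)
    (h1 : |b1| ≤ B) (h2 : |b2| ≤ B) (h3 : |b3| ≤ B) : |A * b1 + α * b2 + β * b3| ≤ B := by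
  calc |A * b1 + α * b2 + β * b3| ≤ |A * b1| + |α * b2| + |β * b3| := abs_add_three _ _ _
    _ = A * |b1| + α * |b2| + β * |b3| := by
      rw [abs_mul, abs_mul, abs_mul, abs_of_nonneg hA, abs_of_nonneg hα, abs_of_nonneg hβ]
    _ ≤ A * B + α * B + β * B := by gcongr
    _ = B := by rw [← add_mul, ← add_mul, hs, one_mul]

lemma arith1 (u : ℝ) (h0 : 0 ≤ u) (h : u ≤ 1 / 2) : 1 ≤ (1 + 2 * u) * (1 - u) := by nlinarith

lemma arith2 (u v : ℝ) (h0 : 0 ≤ u) (h : 0 ≤ v) :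
    (1 + 2 * u) * (1 + 16 * v) ≤ (1 + (16 * v + 2 * u)) ^ 2 := by
  nlinarith [mul_nonneg h0 h]

lemma arith3 (M h : ℝ) (hh : 0 < h) (h1 : h ≤ 1) (hM : M * h ≤ 1) (hM0 : 0 < M) :
    M * h ^ 2 ≤ 1 := by
  calc M * h ^ 2 = (M * h) * h := by ring
    _ ≤ 1 * 1 := by gcongr
    _ = 1 := by ring

lemma dir_coef_bound {γ₀ h : ℝ} (hγ₀ : 0 < γ₀) (hh : 0 < h) (t : E3 × E3 × E3)
    (l1 l2 : E3 →L[ℝ] ℝ) (h11 : l1 (t.2.1 - t.1) = 1)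
    (h12 : l1 (t.2.2 - t.1) = 0) (h21 : l2 (t.2.1 - t.1) = 0) (h22 : l2 (t.2.2 - t.1) = 1)
    (hd : ∃ y ∈ triOf t, closedBall y (γ₀ * h) ∩ planeOf t ⊆ triOf t)
    {v : E3} (hv : v ∈ dirOf t) :
    |l1 v| ≤ ‖v‖ / (γ₀ * h) ∧ |l2 v| ≤ ‖v‖ / (γ₀ * h) := by
  obtain ⟨y, hy, hsub⟩ := hd
  have hmem : ∀ y ∈ triOf t, 0 ≤ l1 (y - t.1) ∧ 0 ≤ l2 (y - t.1) ∧
      l1 (y - t.1) + l2 (y - t.1) ≤ 1 := by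
    intro y hy
    obtain ⟨α, β, h1, h2, h3, rfl⟩ := (mem_triOf t y).1 hy
    rw [add_sub_cancel_left, map_add, map_add, map_smul, map_smul, map_smul, map_smul, h11, h12,
      h21, h22]
    simp [h1, h2, h3]
  have hg : 0 < γ₀ * h := by positivity
  by_cases hv0 : v = 0
  · simp [hv0]
  have hvn : 0 < ‖v‖ := norm_pos_iff.2 hv0
  have hk : ∀ s : ℝ, |s| = γ₀ * h / ‖v‖ → y + s • v ∈ triOf t := by
    intro s hs
    apply hsub
    refine ⟨?_, ?_⟩
    · rw [mem_closedBall, dist_eq_norm, add_sub_cancel_left, norm_smul, Real.norm_eq_abs, hs]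
      rw [div_mul_cancel₀ _ hvn.ne']
    · rw [mem_planeOf t _ y (triOf_subset_planeOf t hy)]
      simpa using Submodule.smul_mem _ s hv
  have hs0 : 0 < γ₀ * h / ‖v‖ := by positivity
  have k0 := hmem _ hy
  have k1 := hmem _ (hk (γ₀ * h / ‖v‖) (abs_of_pos hs0))
  have k2 := hmem _ (hk (-(γ₀ * h / ‖v‖)) (by rw [abs_neg, abs_of_pos hs0]))
  simp only [add_sub_right_comm, map_add, map_smul, smul_eq_mul] at k1 k2
  have e : ‖v‖ / (γ₀ * h) = 1 / (γ₀ * h / ‖v‖) := by rw [one_div_div]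
  generalize γ₀ * h / ‖v‖ = s at *
  rw [e]
  constructor
  · rw [le_div_iff₀ hs0]
    rw [← abs_of_pos hs0, ← abs_mul, abs_le]
    constructor <;> nlinarith
  · rw [le_div_iff₀ hs0]
    rw [← abs_of_pos hs0, ← abs_mul, abs_le]
    constructor <;> nlinarith

set_option maxHeartbeats 2000000 in
lemma bilip (Srf : SmoothSurface) (γ₀ : ℝ) (hγ₀ : 0 < γ₀) :
    ∃ M > 0, ∃ h₀ > 0, ∀ h : ℝ, 0 < h → h ≤ h₀ → M * h ^ 2 ≤ 1 ∧
      ∀ Tr : Triangulation Srf γ₀ h, ∀ t ∈ Tr.T, ∀ x ∈ triOf t, ∀ y ∈ triOf t,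
        ‖Tr.a x - Tr.a y‖ ≤ (1 + M * h ^ 2) * ‖x - y‖ ∧
        ‖x - y‖ ≤ (1 + M * h ^ 2) * ‖Tr.a x - Tr.a y‖ := by
  obtain ⟨C, hC, hQ, hL⟩ := surf_const Srf
  set D : ℝ := 6 * C / γ₀ + 4 * C + 16 * C ^ 2 with hD
  have hDpos : 0 < D := by positivity
  set M : ℝ := 16 * C ^ 2 + 2 * D ^ 2 with hM
  have hMpos : 0 < M := by positivity
  have hM1 : 1 ≤ M := by
    have : 1 ≤ C ^ 2 := one_le_pow₀ hC
    have := sq_nonneg D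
    linarith
  refine ⟨M, hMpos, 1 / M, by positivity, ?_⟩
  intro h hh hh0
  have hMh : M * h ≤ 1 := by
    rw [le_div_iff₀ hMpos] at hh0; linarith
  have hh1 : h ≤ 1 := by
    have := mul_le_mul_of_nonneg_right hM1 hh.le
    linarith
  have hMh2 : M * h ^ 2 ≤ 1 := arith3 M h hh hh1 hMh hMpos
  refine ⟨hMh2, ?_⟩
  have hε : 8 * C ^ 2 * h ^ 2 ≤ 1 / 2 := by
    have := mul_nonneg (sq_nonneg D) (sq_nonneg h)
    rw [hM] at hMh2; linarith
  have hDh : D ^ 2 * h ^ 2 ≤ 1 / 2 := by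
    have := mul_nonneg (sq_nonneg C) (sq_nonneg h)
    rw [hM] at hMh2; linarith
  intro Tr t ht
  obtain ⟨l1, l2, h11, h12, h21, h22⟩ := tri_coords t (Tr.indep t ht)
  have hdist : ∀ x ∈ triOf t, ∀ y ∈ triOf t, ‖x - y‖ ≤ h := by
    intro x hx y hy
    rw [← dist_eq_norm]
    exact (Metric.dist_le_diam_of_mem (triOf_compact t).isBounded hx hy).trans (Tr.diam_le t ht)
  have hxN : ∀ x ∈ triOf t, x ∈ Tr.N := fun x hx => Tr.Sh_sub (Set.mem_biUnion ht hx)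
  have hX : ∀ x ∈ triOf t, Tr.a x ∈ Srf.S := fun x hx => Tr.a_mem x (hxN x hx)
  have hxX : ∀ x ∈ triOf t, ‖x - Tr.a x‖ ≤ h := by
    intro x hx
    have h1 : t.1 ∈ vertsOf t := by simp [vertsOf]
    have := Tr.a_nearest x (hxN x hx) t.1 (Tr.verts_on t ht h1)
    rw [dist_eq_norm, dist_eq_norm] at this
    exact this.trans (hdist x hx _ (vert_mem_triOf t h1))
  have hXp : ∀ x ∈ triOf t, ∀ p ∈ vertsOf t, ‖p - Tr.a x‖ ≤ 2 * h := by
    intro x hx p hp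
    have := norm_add_le (p - x) (x - Tr.a x)
    rw [sub_add_sub_cancel] at this
    linarith [hdist p (vert_mem_triOf t hp) x hx, hxX x hx]
  have hdex : ∀ x ∈ triOf t, ∃ d : ℝ, x - Tr.a x = d • Srf.n (Tr.a x) ∧ |d| ≤ 4 * C * h ^ 2 := by
    intro x hx
    obtain ⟨d, hd⟩ := nearest_normal Srf x (Tr.a x) (hX x hx) (Tr.a_nearest x (hxN x hx))
    refine ⟨d, hd, ?_⟩
    have hdin : d = ⟪Srf.n (Tr.a x), x - Tr.a x⟫ := by
      rw [hd, real_inner_smul_right, real_inner_self_eq_norm_sq, Srf.n_unit _ (hX x hx)]; simp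
    have hb : ∀ p ∈ vertsOf t, |⟪Srf.n (Tr.a x), p - Tr.a x⟫| ≤ 4 * C * h ^ 2 := by
      intro p hp
      refine (hQ _ (hX x hx) p (Tr.verts_on t ht hp)).trans ?_
      have := hXp x hx p hp
      calc C * ‖p - Tr.a x‖ ^ 2 ≤ C * (2 * h) ^ 2 := by gcongr
        _ = _ := by ring
    obtain ⟨α, β, h1, h2, h3, hxe⟩ := (mem_triOf t x).1 hx
    have b1 := (hb t.1 (by simp [vertsOf]))
    have b2 := (hb t.2.1 (by simp [vertsOf]))
    have b3 := (hb t.2.2 (by simp [vertsOf]))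
    have hcomb : x - Tr.a x = (1 - α - β) • (t.1 - Tr.a x) + α • (t.2.1 - Tr.a x) +
        β • (t.2.2 - Tr.a x) := by
      nth_rewrite 1 [hxe]; module
    rw [hcomb] at hdin
    simp only [inner_add_right, real_inner_smul_right] at hdin
    rw [hdin]
    exact comb3 _ _ _ _ _ _ _ (by linarith) h1 h2 (by ring) b1 b2 b3
  intro x hx y hy
  obtain ⟨dx, hdx, hdxb⟩ := hdex x hx
  obtain ⟨dy, hdy, hdyb⟩ := hdex y hy
  have hnX := Srf.n_unit _ (hX x hx)
  have hnY := Srf.n_unit _ (hX y hy)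
  have hQ1 := hQ _ (hX x hx) _ (hX y hy)
  have hQ2 := hQ _ (hX y hy) _ (hX x hx)
  have hLn := hL _ (hX x hx) _ (hX y hy)
  have hXS := hX x hx
  -- bound on the normal component
  have hnorm : |⟪x - y, Srf.n (Tr.a x)⟫| ≤ 6 * C / γ₀ * h * ‖x - y‖ := by
    have hdir : x - y ∈ dirOf t :=
      (mem_planeOf t x y (triOf_subset_planeOf t hy)).1 (triOf_subset_planeOf t hx)
    obtain ⟨c1, c2⟩ := dir_coef_bound hγ₀ hh t l1 l2 h11 h12 h21 h22 (Tr.disk t ht) hdir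
    have hv1 : t.1 ∈ vertsOf t := by simp [vertsOf]
    have he : ∀ p ∈ vertsOf t, |⟪p - t.1, Srf.n (Tr.a x)⟫| ≤ 3 * C * h ^ 2 := by
      intro p hp
      have e1 := hQ t.1 (Tr.verts_on t ht hv1) p (Tr.verts_on t ht hp)
      have e2 := hL _ (hX x hx) t.1 (Tr.verts_on t ht hv1)
      have e3 := hdist p (vert_mem_triOf t hp) t.1 (vert_mem_triOf t hv1)
      have e4 := hXp x hx t.1 hv1
      rw [norm_sub_rev] at e4
      have e5 : ⟪p - t.1, Srf.n (Tr.a x)⟫ = ⟪Srf.n t.1, p - t.1⟫ +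
          ⟪p - t.1, Srf.n (Tr.a x) - Srf.n t.1⟫ := by
        rw [inner_sub_right (p - t.1), real_inner_comm (p - t.1) (Srf.n t.1)]; ring
      rw [e5]
      calc _ ≤ |⟪Srf.n t.1, p - t.1⟫| + |⟪p - t.1, Srf.n (Tr.a x) - Srf.n t.1⟫| := abs_add_le _ _
        _ ≤ C * ‖p - t.1‖ ^ 2 + ‖p - t.1‖ * (C * ‖Tr.a x - t.1‖) := by
          gcongr
          exact (abs_real_inner_le_norm _ _).trans (by gcongr)
        _ ≤ C * h ^ 2 + h * (C * (2 * h)) := by gcongr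
        _ = _ := by ring
    have f1 := he t.2.1 (by simp [vertsOf])
    have f2 := he t.2.2 (by simp [vertsOf])
    have hdec := dirOf_coords t l1 l2 h11 h12 h21 h22 hdir
    have : ⟪x - y, Srf.n (Tr.a x)⟫ = l1 (x - y) * ⟪t.2.1 - t.1, Srf.n (Tr.a x)⟫ +
        l2 (x - y) * ⟪t.2.2 - t.1, Srf.n (Tr.a x)⟫ := by
      nth_rewrite 1 [hdec]
      rw [inner_add_left, real_inner_smul_left, real_inner_smul_left]
    rw [this]
    calc _ ≤ |l1 (x - y)| * |⟪t.2.1 - t.1, Srf.n (Tr.a x)⟫| +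
        |l2 (x - y)| * |⟪t.2.2 - t.1, Srf.n (Tr.a x)⟫| := by
          rw [← abs_mul, ← abs_mul]; exact abs_add_le _ _
      _ ≤ ‖x - y‖ / (γ₀ * h) * (3 * C * h ^ 2) + ‖x - y‖ / (γ₀ * h) * (3 * C * h ^ 2) := by
          gcongr
      _ = _ := by field_simp; ring
  have hwh := hdist x hx y hy
  -- abbreviations
  set nX := Srf.n (Tr.a x) with hnXd
  set nY := Srf.n (Tr.a y) with hnYd
  set X := Tr.a x with hXd
  set Y := Tr.a y with hYd
  set w := x - y with hw
  set W := X - Y with hW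
  have hYX : Y - X = -W := by rw [hW]; abel
  rw [hYX, inner_neg_right, abs_neg, norm_neg] at hQ1
  have hwW : w = W + (dx • nX - dy • nY) := by
    rw [← hdx, ← hdy, hw, hW]; abel
  clear hdex hXp hxX hX hxN hdist hQ hL
  clear_value w W nX nY X Y
  -- cross term
  have hcross : |⟪W, dx • nX - dy • nY⟫| ≤ 8 * C ^ 2 * h ^ 2 * ‖W‖ ^ 2 := by
    rw [inner_sub_right, real_inner_smul_right, real_inner_smul_right, real_inner_comm,
      real_inner_comm nY]
    calc _ ≤ |dx| * |⟪nX, W⟫| + |dy| * |⟪nY, W⟫| := by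
          rw [← abs_mul, ← abs_mul]; exact abs_sub _ _
      _ ≤ (4 * C * h ^ 2) * (C * ‖W‖ ^ 2) + (4 * C * h ^ 2) * (C * ‖W‖ ^ 2) := by gcongr
      _ = _ := by ring
  have hc := abs_le.1 hcross
  have hwWin : ⟪W, w⟫ = ‖W‖ ^ 2 + ⟪W, dx • nX - dy • nY⟫ := by
    rw [hwW, inner_add_right, real_inner_self_eq_norm_sq]
  have hcs := real_inner_le_norm W w
  have hW0 := norm_nonneg W
  have hw0 := norm_nonneg w
  have hup : (1 - 8 * C ^ 2 * h ^ 2) * ‖W‖ ≤ ‖w‖ := by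
    rcases hW0.eq_or_lt with h0 | h0
    · rw [← h0]; simp
    · have : (1 - 8 * C ^ 2 * h ^ 2) * ‖W‖ * ‖W‖ ≤ ‖w‖ * ‖W‖ := by
        have : (1 - 8 * C ^ 2 * h ^ 2) * ‖W‖ * ‖W‖ = ‖W‖ ^ 2 - 8 * C ^ 2 * h ^ 2 * ‖W‖ ^ 2 := by ring
        rw [mul_comm ‖w‖]
        linarith only [this, hc.1, hcs, hwWin]
      exact le_of_mul_le_mul_right this h0
  have hW2 : ‖W‖ ≤ 2 * ‖w‖ := by
    have := mul_le_mul_of_nonneg_right hε hW0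
    linarith only [this, hup]
  have hC2 : 0 ≤ C ^ 2 * h ^ 2 := by positivity
  have hD2 : 0 ≤ D ^ 2 * h ^ 2 := by positivity
  constructor
  · have : ‖W‖ ≤ (1 + 16 * C ^ 2 * h ^ 2) * ‖w‖ := by
      have h1 : 8 * C ^ 2 * h ^ 2 * ‖W‖ ≤ 8 * C ^ 2 * h ^ 2 * (2 * ‖w‖) := by gcongr
      linarith only [h1, hup]
    refine this.trans ?_
    gcongr ?_ * _
    rw [hM]
    linarith only [hD2]
  · -- bound of the normal displacement
    have hdd : |dx - dy| ≤ (6 * C / γ₀ + 4 * C + 8 * C ^ 2) * h * ‖w‖ := by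
      have e1 : ⟪w, nX⟫ = ⟪nX, W⟫ + dx - dy * ⟪nY, nX⟫ := by
        rw [hwW, inner_add_left, inner_sub_left, real_inner_smul_left, real_inner_smul_left,
          real_inner_self_eq_norm_sq, hnX, real_inner_comm W]; ring
      have e2 : ⟪nY, nX⟫ = 1 - ⟪nX - nY, nX⟫ := by
        rw [inner_sub_left, real_inner_self_eq_norm_sq, hnX]; ring
      have e3 : |⟪nX - nY, nX⟫| ≤ C * ‖W‖ := by
        have := abs_real_inner_le_norm (nX - nY) nX
        rw [hnX, mul_one] at this
        exact this.trans hLn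
      have e4 : dx - dy = ⟪w, nX⟫ - ⟪nX, W⟫ - dy * ⟪nX - nY, nX⟫ := by
        rw [e1, e2]; ring
      rw [e4]
      have e5 : |dy * ⟪nX - nY, nX⟫| ≤ 4 * C * h ^ 2 * (C * ‖W‖) := by
        rw [abs_mul]; gcongr
      have e6 : C * ‖W‖ ^ 2 ≤ 4 * C * h * ‖w‖ := by
        calc C * ‖W‖ ^ 2 ≤ C * (2 * ‖w‖) ^ 2 := by gcongr
          _ = 4 * C * ‖w‖ * ‖w‖ := by ring
          _ ≤ 4 * C * h * ‖w‖ := by gcongr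
      have e7 : 4 * C * h ^ 2 * (C * ‖W‖) ≤ 8 * C ^ 2 * h * ‖w‖ := by
        calc _ = 4 * C ^ 2 * h * (h * ‖W‖) := by ring
          _ ≤ 4 * C ^ 2 * h * (1 * (2 * ‖w‖)) := by gcongr
          _ = _ := by ring
      calc _ ≤ |⟪w, nX⟫| + |⟪nX, W⟫| + |dy * ⟪nX - nY, nX⟫| :=
            (abs_sub _ _).trans (by gcongr; exact abs_sub _ _)
        _ ≤ 6 * C / γ₀ * h * ‖w‖ + 4 * C * h * ‖w‖ + 8 * C ^ 2 * h * ‖w‖ := by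
          gcongr
          · exact hQ1.trans e6
          · exact e5.trans e7
        _ = _ := by ring
    have hs : ‖dx • nX - dy • nY‖ ≤ D * h * ‖w‖ := by
      have e1 : dx • nX - dy • nY = (dx - dy) • nX + dy • (nX - nY) := by module
      rw [e1]
      calc _ ≤ ‖(dx - dy) • nX‖ + ‖dy • (nX - nY)‖ := norm_add_le _ _
        _ = |dx - dy| + |dy| * ‖nX - nY‖ := by
          rw [norm_smul, norm_smul, hnX, Real.norm_eq_abs, Real.norm_eq_abs, mul_one]
        _ ≤ (6 * C / γ₀ + 4 * C + 8 * C ^ 2) * h * ‖w‖ + (4 * C * h ^ 2) * (C * (2 * ‖w‖)) := by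
          gcongr
          exact hLn.trans (by gcongr)
        _ ≤ (6 * C / γ₀ + 4 * C + 8 * C ^ 2) * h * ‖w‖ + (4 * C * (h * 1)) * (C * (2 * ‖w‖)) := by
          gcongr
          rw [pow_two]; gcongr
        _ = _ := by rw [hD]; ring
    have hsq : ‖w‖ ^ 2 = ‖W‖ ^ 2 + 2 * ⟪W, dx • nX - dy • nY⟫ + ‖dx • nX - dy • nY‖ ^ 2 := by
      nth_rewrite 1 [hwW]; exact norm_add_sq_real _ _
    have hs2 : ‖dx • nX - dy • nY‖ ^ 2 ≤ D ^ 2 * h ^ 2 * ‖w‖ ^ 2 := by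
      calc _ ≤ (D * h * ‖w‖) ^ 2 := by gcongr
        _ = _ := by ring
    have hfin : (1 - D ^ 2 * h ^ 2) * ‖w‖ ^ 2 ≤ (1 + 16 * C ^ 2 * h ^ 2) * ‖W‖ ^ 2 := by
      linarith only [hc.2, hs2, hsq]
    have hfin2 : ‖w‖ ^ 2 ≤ ((1 + M * h ^ 2) * ‖W‖) ^ 2 := by
      set u := D ^ 2 * h ^ 2
      set v := C ^ 2 * h ^ 2
      have hMu : M * h ^ 2 = 16 * v + 2 * u := by rw [hM]; ring
      rw [hMu]
      have g1 : 1 ≤ (1 + 2 * u) * (1 - u) := arith1 u hD2 hDh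
      calc ‖w‖ ^ 2 = 1 * ‖w‖ ^ 2 := by ring
        _ ≤ ((1 + 2 * u) * (1 - u)) * ‖w‖ ^ 2 := by gcongr
        _ = (1 + 2 * u) * ((1 - u) * ‖w‖ ^ 2) := by ring
        _ ≤ (1 + 2 * u) * ((1 + 16 * C ^ 2 * h ^ 2) * ‖W‖ ^ 2) := by gcongr
        _ = ((1 + 2 * u) * (1 + 16 * v)) * ‖W‖ ^ 2 := by ring
        _ ≤ ((1 + (16 * v + 2 * u)) ^ 2) * ‖W‖ ^ 2 := by
          gcongr
          exact arith2 u v hD2 hC2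
        _ = _ := by ring
    exact (pow_le_pow_iff_left₀ hw0 (by positivity) two_ne_zero).1 hfin2

lemma curve_mem (t : E3 × E3 × E3) {x w : E3} (hx : x ∈ triI t) (hw : w ∈ dirOf t) :
    ∀ᶠ s in nhds (0:ℝ), x + s • w ∈ triOf t := by
  obtain ⟨hxt, r, hr, hb⟩ := hx
  have hc : Filter.Tendsto (fun s : ℝ => x + s • w) (nhds 0) (nhds x) := by
    have : Continuous (fun s : ℝ => x + s • w) := by fun_prop
    simpa using this.tendsto 0
  filter_upwards [hc (ball_mem_nhds x hr)] with s hs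
  refine hb ⟨hs, ?_⟩
  rw [mem_planeOf t _ x (triOf_subset_planeOf t hxt)]
  simpa using (dirOf t).smul_mem s hw

lemma curve_deriv {F : Type*} [NormedAddCommGroup F] [NormedSpace ℝ F]
    (t : E3 × E3 × E3) {x w : E3} (hx : x ∈ triI t) (hw : w ∈ dirOf t)
    {g : E3 → F} {L : E3 →L[ℝ] F} (hg : HasFDerivWithinAt g L (triOf t) x) :
    HasDerivAt (fun s : ℝ => g (x + s • w)) (L w) 0 := by
  have h1 : HasDerivAt (fun s : ℝ => x + s • w) w 0 := by
    simpa using ((hasDerivAt_id (0:ℝ)).smul_const w).const_add x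
  have := hg.comp_hasDerivAt_of_eq (0:ℝ) h1 (curve_mem t hx hw) (by simp)
  exact this

lemma curve_unique {F : Type*} [NormedAddCommGroup F] [NormedSpace ℝ F]
    (t : E3 × E3 × E3) {x w : E3} (hx : x ∈ triI t) (hw : w ∈ dirOf t)
    {g : E3 → F} {L L' : E3 →L[ℝ] F} (hg : HasFDerivWithinAt g L (triOf t) x)
    (hg' : HasFDerivWithinAt g L' (triOf t) x) : L w = L' w :=
  (curve_deriv t hx hw hg).unique (curve_deriv t hx hw hg')

lemma tGrad_inner (A : Set E3) (P : Submodule ℝ E3) (f : E3 → ℝ) (x w : E3) (hw : w ∈ P) :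
    ⟪tGrad A P f x, w⟫ = fderivWithin ℝ f A x w := by
  unfold tGrad
  rw [← InnerProductSpace.toDual_symm_apply (𝕜 := ℝ) (x := w) (y := fderivWithin ℝ f A x)]
  exact Submodule.inner_orthogonalProjectionOnto_eq_of_mem_right (⟨w, hw⟩ : P) _

lemma tGrad_mem (A : Set E3) (P : Submodule ℝ E3) (f : E3 → ℝ) (x : E3) :
    tGrad A P f x ∈ P := by
  unfold tGrad; exact Submodule.coe_mem _

section pt
variable {Srf : SmoothSurface} {γ₀ h : ℝ} (Tr : Triangulation Srf γ₀ h)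

lemma tri_sub_N {t : E3 × E3 × E3} (ht : t ∈ Tr.T) {x : E3} (hx : x ∈ triOf t) : x ∈ Tr.N :=
  Tr.Sh_sub (Set.mem_biUnion ht hx)

lemma a_has {x : E3} (hx : x ∈ Tr.N) : HasFDerivAt Tr.a (fderiv ℝ Tr.a x) x :=
  ((Tr.a_smooth.contDiffAt (Tr.N_open.mem_nhds hx)).differentiableAt (by simp)).hasFDerivAt

lemma a_fix {X : E3} (hX : X ∈ Srf.S) : Tr.a X = X := by
  have h1 := Tr.a_nearest X (Tr.S_sub hX) X hX
  rw [dist_self] at h1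
  exact (dist_le_zero.1 h1).symm

lemma quot_tendsto {x : E3} {w : E3} (hx : x ∈ Tr.N) :
    Filter.Tendsto (fun s : ℝ => s⁻¹ • (Tr.a (x + s • w) - Tr.a x)) (nhdsWithin 0 {0}ᶜ)
      (nhds (fderiv ℝ Tr.a x w)) := by
  have h1 : HasDerivAt (fun s : ℝ => x + s • w) w 0 := by
    simpa using ((hasDerivAt_id (0:ℝ)).smul_const w).const_add x
  have h2 : HasDerivAt (fun s : ℝ => Tr.a (x + s • w)) (fderiv ℝ Tr.a x w) 0 :=
    (a_has Tr hx).comp_hasDerivAt_of_eq (0:ℝ) h1 (by simp)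
  have := hasDerivAt_iff_tendsto_slope_zero.1 h2
  simpa using this

lemma dA_bounds {t : E3 × E3 × E3} (ht : t ∈ Tr.T) {x : E3} (hx : x ∈ triI t) {K : ℝ}
    (hK : ∀ x ∈ triOf t, ∀ y ∈ triOf t, ‖Tr.a x - Tr.a y‖ ≤ K * ‖x - y‖ ∧
      ‖x - y‖ ≤ K * ‖Tr.a x - Tr.a y‖) {w : E3} (hw : w ∈ dirOf t) :
    ‖fderiv ℝ Tr.a x w‖ ≤ K * ‖w‖ ∧ ‖w‖ ≤ K * ‖fderiv ℝ Tr.a x w‖ := by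
  have hq := (quot_tendsto Tr (w := w) (tri_sub_N Tr ht hx.1)).norm
  have hev : ∀ᶠ s in nhdsWithin (0:ℝ) {0}ᶜ, x + s • w ∈ triOf t :=
    (curve_mem t hx hw).filter_mono nhdsWithin_le_nhds
  constructor
  · refine le_of_tendsto hq ?_
    filter_upwards [hev, self_mem_nhdsWithin] with s hs hs0
    have := (hK _ hs x hx.1).1
    rw [add_sub_cancel_left, norm_smul] at this
    rw [norm_smul, norm_inv]
    have hs1 : 0 < ‖s‖ := norm_pos_iff.2 hs0
    rw [inv_mul_le_iff₀ hs1]; linarith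
  · refine ge_of_tendsto (hq.const_mul K) ?_
    filter_upwards [hev, self_mem_nhdsWithin] with s hs hs0
    have := (hK _ hs x hx.1).2
    rw [add_sub_cancel_left, norm_smul] at this
    rw [norm_smul, norm_inv]
    have hs1 : 0 < ‖s‖ := norm_pos_iff.2 hs0
    rw [mul_left_comm, le_inv_mul_iff₀ hs1]; linarith

lemma dA_tangent {x : E3} (hx : x ∈ Tr.N) (w : E3) :
    fderiv ℝ Tr.a x w ∈ Srf.tangent (Tr.a x) := by
  unfold SmoothSurface.tangent
  rw [Submodule.mem_orthogonal_singleton_iff_inner_right]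
  obtain ⟨C, hC, hq⟩ := surf_quad Srf
  have ht := quot_tendsto Tr (w := w) hx
  have h0 : Filter.Tendsto (fun s : ℝ => C * |s| * ‖s⁻¹ • (Tr.a (x + s • w) - Tr.a x)‖ ^ 2)
      (nhdsWithin 0 {0}ᶜ) (nhds (C * |0| * ‖fderiv ℝ Tr.a x w‖ ^ 2)) := by
    refine Filter.Tendsto.mul ?_ (ht.norm.pow 2)
    exact ((continuous_const.mul continuous_abs).tendsto 0).mono_left nhdsWithin_le_nhds
  have h1 : Filter.Tendsto (fun s : ℝ => |⟪Srf.n (Tr.a x), s⁻¹ • (Tr.a (x + s • w) - Tr.a x)⟫|)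
      (nhdsWithin 0 {0}ᶜ) (nhds |⟪Srf.n (Tr.a x), fderiv ℝ Tr.a x w⟫|) :=
    (Filter.Tendsto.inner tendsto_const_nhds ht).abs
  have hN : ∀ᶠ s in nhdsWithin (0:ℝ) {0}ᶜ, x + s • w ∈ Tr.N := by
    have hc : Filter.Tendsto (fun s : ℝ => x + s • w) (nhds 0) (nhds x) := by
      have : Continuous (fun s : ℝ => x + s • w) := by fun_prop
      simpa using this.tendsto 0
    have he : ∀ᶠ s in nhds (0:ℝ), x + s • w ∈ Tr.N := hc (Tr.N_open.mem_nhds hx)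
    exact he.filter_mono nhdsWithin_le_nhds
  have := le_of_tendsto_of_tendsto h1 h0 (by
    filter_upwards [hN, self_mem_nhdsWithin] with s hs hs0
    have h2 := hq _ (Tr.a_mem x hx) _ (Tr.a_mem _ hs)
    have hs1 : 0 < |s| := abs_pos.2 hs0
    rw [inner_smul_right, abs_mul, abs_inv, norm_smul, norm_inv, Real.norm_eq_abs,
      inv_mul_le_iff₀ hs1]
    refine h2.trans (le_of_eq ?_)
    field_simp)
  rw [abs_zero, mul_zero, zero_mul] at this
  exact abs_nonpos_iff.1 this

lemma finrank_tangent {X : E3} (hX : X ∈ Srf.S) :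
    Module.finrank ℝ (Srf.tangent X) = 2 := by
  have : Fact (Module.finrank ℝ E3 = 2 + 1) := ⟨by simp⟩
  refine Submodule.finrank_orthogonal_span_singleton (𝕜 := ℝ) ?_
  intro h0
  have := Srf.n_unit X hX
  rw [h0, norm_zero] at this; norm_num at this

lemma dA_surj {t : E3 × E3 × E3} (ht : t ∈ Tr.T) {x : E3} (hx : x ∈ triI t) {K : ℝ}
    (hK : ∀ x ∈ triOf t, ∀ y ∈ triOf t, ‖Tr.a x - Tr.a y‖ ≤ K * ‖x - y‖ ∧
      ‖x - y‖ ≤ K * ‖Tr.a x - Tr.a y‖) {v : E3} (hv : v ∈ Srf.tangent (Tr.a x)) :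
    ∃ w ∈ dirOf t, fderiv ℝ Tr.a x w = v := by
  have hN := tri_sub_N Tr ht hx.1
  let φ : dirOf t →ₗ[ℝ] Srf.tangent (Tr.a x) :=
    ((fderiv ℝ Tr.a x : E3 →ₗ[ℝ] E3).domRestrict (dirOf t)).codRestrict _
      (fun w => dA_tangent Tr hN w)
  have hφ : Function.Injective φ := by
    rw [← LinearMap.ker_eq_bot, LinearMap.ker_eq_bot']
    intro w hw
    have h1 : fderiv ℝ Tr.a x w = 0 := congrArg Subtype.val hw
    have h2 := (dA_bounds Tr ht hx hK w.2).2
    rw [h1, norm_zero, mul_zero] at h2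
    exact Subtype.ext (norm_le_zero_iff.1 h2)
  have hs : Function.Surjective φ :=
    (LinearMap.injective_iff_surjective_of_finrank_eq_finrank (by
      rw [finrank_dirOf t (Tr.indep t ht), finrank_tangent (Tr.a_mem x hN)])).1 hφ
  obtain ⟨w, hw⟩ := hs ⟨v, hv⟩
  exact ⟨w, w.2, congrArg Subtype.val hw⟩

lemma triI_not_mem {t t' : E3 × E3 × E3} (ht : t ∈ Tr.T) (ht' : t' ∈ Tr.T) (hne : t ≠ t')
    {x : E3} (hx : x ∈ triI t) : x ∉ triOf t' := by
  intro hx'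
  have hm : x ∈ triOf t ∩ triOf t' := ⟨hx.1, hx'⟩
  rcases Tr.meet t ht t' ht' hne with h0 | ⟨v, hv, h0⟩ | ⟨v, w, -, hv, hw, h0⟩
  · rw [h0] at hm; exact hm
  · rw [h0] at hm
    apply triI_not_seg t (Tr.indep t ht) hx hv.1 hv.1
    rw [segment_same]; exact hm
  · rw [h0] at hm
    exact triI_not_seg t (Tr.indep t ht) hx hv.1 hw.1 hm

lemma a_cont_tri {t : E3 × E3 × E3} (ht : t ∈ Tr.T) : ContinuousOn Tr.a (triOf t) :=
  Tr.a_smooth.continuousOn.mono (fun _ hx => tri_sub_N Tr ht hx)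

lemma image_nhds {t : E3 × E3 × E3} (ht : t ∈ Tr.T) {x : E3} (hx : x ∈ triI t) :
    Tr.a '' triOf t ∈ nhdsWithin (Tr.a x) Srf.S := by
  classical
  let C : Set E3 := ⋃ t' ∈ Tr.T.erase t, Tr.a '' triOf t'
  have hC : IsClosed C := by
    refine Set.Finite.isClosed_biUnion (Finset.finite_toSet _) ?_
    intro t' ht'
    have ht'' : t' ∈ Tr.T := Finset.mem_of_mem_erase ht'
    exact ((triOf_compact t').image_of_continuousOn (a_cont_tri Tr ht'')).isClosed
  have hxC : Tr.a x ∉ C := by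
    intro hc
    simp only [C, Set.mem_iUnion] at hc
    obtain ⟨t', ht', y, hy, hyx⟩ := hc
    have ht'' : t' ∈ Tr.T := Finset.mem_of_mem_erase ht'
    have : y = x := Tr.a_bij.injOn (Set.mem_biUnion ht'' hy) (Set.mem_biUnion ht hx.1) hyx
    exact triI_not_mem Tr ht ht'' (Finset.ne_of_mem_erase ht').symm hx (this ▸ hy)
  filter_upwards [mem_nhdsWithin_of_mem_nhds (hC.isOpen_compl.mem_nhds hxC),
    self_mem_nhdsWithin] with Y hY hYS
  obtain ⟨y, hy, rfl⟩ := Tr.a_bij.surjOn hYS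
  obtain ⟨t', ht', hy'⟩ := Set.mem_iUnion₂.1 hy
  by_cases he : t' = t
  · exact ⟨y, he ▸ hy', rfl⟩
  · exfalso; apply hY
    exact Set.mem_biUnion (x := t') (Finset.mem_erase.2 ⟨he, ht'⟩) ⟨y, hy', rfl⟩

lemma lift_diff {t : E3 × E3 × E3} (ht : t ∈ Tr.T) {x : E3} {f : E3 → ℝ}
    {L : E3 →L[ℝ] ℝ} (hx : x ∈ triI t) (hf : HasFDerivWithinAt f L Srf.S (Tr.a x)) :
    HasFDerivWithinAt (Tr.liftSh f) (L.comp (fderiv ℝ Tr.a x)) (triOf t) x := by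
  have hN := tri_sub_N Tr ht hx.1
  exact hf.comp x (a_has Tr hN).hasFDerivWithinAt
    (fun y hy => Tr.a_mem y (tri_sub_N Tr ht hy))

lemma lift_diff_conv {t : E3 × E3 × E3} (ht : t ∈ Tr.T) {x : E3} (hx : x ∈ triI t) {K : ℝ}
    (hK : ∀ x ∈ triOf t, ∀ y ∈ triOf t, ‖Tr.a x - Tr.a y‖ ≤ K * ‖x - y‖ ∧
      ‖x - y‖ ≤ K * ‖Tr.a x - Tr.a y‖) {f : E3 → ℝ}
    (hf : DifferentiableWithinAt ℝ (Tr.liftSh f) (triOf t) x) :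
    DifferentiableWithinAt ℝ f Srf.S (Tr.a x) := by
  classical
  have hN := tri_sub_N Tr ht hx.1
  set A := fderiv ℝ Tr.a x with hA
  -- left inverse
  let φ : dirOf t →ₗ[ℝ] E3 := (A : E3 →ₗ[ℝ] E3).domRestrict (dirOf t)
  have hφ : LinearMap.ker φ = ⊥ := by
    rw [LinearMap.ker_eq_bot']
    intro w hw
    have h1 : A w = 0 := hw
    have h2 := (dA_bounds Tr ht hx hK w.2).2
    rw [← hA, h1, norm_zero, mul_zero] at h2
    exact Subtype.ext (norm_le_zero_iff.1 h2)
  obtain ⟨ψ, hψ⟩ := LinearMap.exists_leftInverse_of_injective φ hφ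
  let B : E3 →L[ℝ] E3 := LinearMap.toContinuousLinearMap ((dirOf t).subtype ∘ₗ ψ)
  have hB : ∀ w ∈ dirOf t, B (A w) = w := by
    intro w hw
    have := congrArg Subtype.val (LinearMap.congr_fun hψ ⟨w, hw⟩)
    exact this
  let b : E3 → E3 := Function.invFunOn Tr.a (triOf t)
  have hbm : ∀ Y ∈ Tr.a '' triOf t, b Y ∈ triOf t ∧ Tr.a (b Y) = Y := fun Y hY =>
    ⟨Function.invFunOn_mem hY, Function.invFunOn_eq hY⟩
  have hinj : Set.InjOn Tr.a (triOf t) := Tr.a_bij.injOn.mono (Set.subset_biUnion_of_mem (u := triOf) ht)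
  have hbx : b (Tr.a x) = x := by
    have h1 := hbm (Tr.a x) ⟨x, hx.1, rfl⟩
    exact hinj h1.1 hx.1 h1.2
  have hlip : ∀ Y ∈ Tr.a '' triOf t, ‖b Y - x‖ ≤ K * ‖Y - Tr.a x‖ := by
    intro Y hY
    have := (hK (b Y) (hbm Y hY).1 x hx.1).2
    rwa [(hbm Y hY).2] at this
  have htend : Filter.Tendsto b (nhdsWithin (Tr.a x) (Tr.a '' triOf t)) (nhds x) := by
    rw [tendsto_iff_norm_sub_tendsto_zero]
    have hz : Filter.Tendsto (fun Y => K * ‖Y - Tr.a x‖)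
        (nhdsWithin (Tr.a x) (Tr.a '' triOf t)) (nhds 0) := by
      have : Continuous (fun Y => K * ‖Y - Tr.a x‖) := by fun_prop
      have := (this.tendsto (Tr.a x)).mono_left (nhdsWithin_le_nhds (s := Tr.a '' triOf t))
      simpa using this
    refine squeeze_zero' (Filter.Eventually.of_forall fun _ => norm_nonneg _) ?_ hz
    filter_upwards [self_mem_nhdsWithin] with Y hY using hlip Y hY
  have hb : HasFDerivWithinAt b B (Tr.a '' triOf t) (Tr.a x) := by
    rw [hasFDerivWithinAt_iff_isLittleO]
    have h1 := (a_has Tr hN).isLittleO.comp_tendsto htend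
    have h2 := (B.isBigO_comp _ _).trans_isLittleO h1
    have h3 : (fun Y => b Y - x) =O[nhdsWithin (Tr.a x) (Tr.a '' triOf t)]
        (fun Y => Y - Tr.a x) := by
      refine Asymptotics.IsBigO.of_bound K ?_
      filter_upwards [self_mem_nhdsWithin] with Y hY using hlip Y hY
    have h4 := (h2.trans_isBigO h3).neg_left
    refine h4.congr' ?_ (Filter.EventuallyEq.refl _ _)
    filter_upwards [self_mem_nhdsWithin] with Y hY
    obtain ⟨hy, hyY⟩ := hbm Y hY
    have hd : b Y - x ∈ dirOf t :=
      (mem_planeOf t _ x (triOf_subset_planeOf t hx.1)).1 (triOf_subset_planeOf t hy)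
    simp only [Function.comp, hyY, hbx]
    rw [map_sub, hB _ hd]; abel
  have hc : DifferentiableWithinAt ℝ (Tr.liftSh f ∘ b) (Tr.a '' triOf t) (Tr.a x) := by
    refine DifferentiableWithinAt.comp (t := triOf t) (Tr.a x) (by rw [hbx]; exact hf)
      hb.differentiableWithinAt (fun Y hY => (hbm Y hY).1)
  have hc2 : DifferentiableWithinAt ℝ f (Tr.a '' triOf t) (Tr.a x) := by
    refine hc.congr (fun Y hY => ?_) ?_
    · simp [Triangulation.liftSh, (hbm Y hY).2]
    · simp [Triangulation.liftSh, hbx]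
  exact hc2.mono_of_mem_nhdsWithin (image_nhds Tr ht hx)

lemma grad_rel {t : E3 × E3 × E3} (ht : t ∈ Tr.T) {x : E3} (hx : x ∈ triI t) {K : ℝ}
    (hK : ∀ x ∈ triOf t, ∀ y ∈ triOf t, ‖Tr.a x - Tr.a y‖ ≤ K * ‖x - y‖ ∧
      ‖x - y‖ ≤ K * ‖Tr.a x - Tr.a y‖) (f : E3 → ℝ) {w : E3} (hw : w ∈ dirOf t) :
    ⟪gradTri t (Tr.liftSh f) x, w⟫ = ⟪Srf.grad f (Tr.a x), fderiv ℝ Tr.a x w⟫ := by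
  have hN := tri_sub_N Tr ht hx.1
  unfold gradTri SmoothSurface.grad
  rw [tGrad_inner _ _ _ _ _ hw, tGrad_inner _ _ _ _ _ (dA_tangent Tr hN w)]
  by_cases hf : DifferentiableWithinAt ℝ f Srf.S (Tr.a x)
  · have h1 := lift_diff Tr ht hx hf.hasFDerivWithinAt
    have h2 := h1.differentiableWithinAt.hasFDerivWithinAt
    rw [curve_unique t hx hw h2 h1]; rfl
  · have hn : ¬ DifferentiableWithinAt ℝ (Tr.liftSh f) (triOf t) x :=
      fun hc => hf (lift_diff_conv Tr ht hx hK hc)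
    rw [fderivWithin_zero_of_not_differentiableWithinAt hf,
      fderivWithin_zero_of_not_differentiableWithinAt hn]; rfl

lemma grad_formula {t : E3 × E3 × E3} (ht : t ∈ Tr.T) {x : E3} (hx : x ∈ triI t) {K : ℝ}
    (hK : ∀ x ∈ triOf t, ∀ y ∈ triOf t, ‖Tr.a x - Tr.a y‖ ≤ K * ‖x - y‖ ∧
      ‖x - y‖ ≤ K * ‖Tr.a x - Tr.a y‖) (f : E3 → ℝ) {v : E3} (hv : v ∈ Srf.tangent (Tr.a x)) :
    ⟪Srf.grad f (Tr.a x), v⟫ = fderiv ℝ (Tr.liftSh f) (Tr.a x) v := by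
  have hN := tri_sub_N Tr ht hx.1
  have hXS := Tr.a_mem x hN
  have hXN := Tr.S_sub hXS
  have hXX := a_fix Tr hXS
  have hDv : fderiv ℝ Tr.a (Tr.a x) v = v := by
    obtain ⟨w, -, rfl⟩ := dA_surj Tr ht hx hK hv
    have h1 : HasFDerivAt (fun y => Tr.a (Tr.a y))
        ((fderiv ℝ Tr.a (Tr.a x)).comp (fderiv ℝ Tr.a x)) x :=
      (a_has Tr hXN).comp x (a_has Tr hN)
    have h2 : HasFDerivAt Tr.a ((fderiv ℝ Tr.a (Tr.a x)).comp (fderiv ℝ Tr.a x)) x := by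
      refine h1.congr_of_eventuallyEq ?_
      filter_upwards [Tr.N_open.mem_nhds hN] with y hy
      exact (a_fix Tr (Tr.a_mem y hy)).symm
    have h3 := h2.unique (a_has Tr hN)
    exact congrArg (fun T : E3 →L[ℝ] E3 => T w) h3
  unfold SmoothSurface.grad
  rw [tGrad_inner _ _ _ _ _ hv]
  by_cases hf : DifferentiableWithinAt ℝ f Srf.S (Tr.a x)
  · have h1 : HasFDerivAt (Tr.liftSh f)
        ((fderivWithin ℝ f Srf.S (Tr.a x)).comp (fderiv ℝ Tr.a (Tr.a x))) (Tr.a x) := by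
      have h0 : HasFDerivWithinAt f (fderivWithin ℝ f Srf.S (Tr.a x)) Srf.S (Tr.a (Tr.a x)) := by
        rw [hXX]; exact hf.hasFDerivWithinAt
      have h2 := h0.comp (s := Tr.N) (Tr.a x) (a_has Tr hXN).hasFDerivWithinAt
        (fun y hy => Tr.a_mem y hy)
      exact h2.hasFDerivAt (Tr.N_open.mem_nhds hXN)
    rw [h1.fderiv, ContinuousLinearMap.comp_apply, hDv]
  · have hn : ¬ DifferentiableAt ℝ (Tr.liftSh f) (Tr.a x) := by
      intro hc
      apply hf
      refine hc.differentiableWithinAt.congr (fun Y hY => ?_) ?_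
      · simp only [Triangulation.liftSh]; rw [a_fix Tr hY]
      · simp only [Triangulation.liftSh]; rw [hXX]
    rw [fderivWithin_zero_of_not_differentiableWithinAt hf,
      fderiv_zero_of_not_differentiableAt hn]

end pt

lemma quad_near (A : E3 →L[ℝ] E3) (P : Submodule ℝ E3) {η : ℝ} (h0 : 0 ≤ η) (h1 : η ≤ 1)
    (hA : ∀ w ∈ P, ‖A w‖ ≤ (1 + η) * ‖w‖ ∧ ‖w‖ ≤ (1 + η) * ‖A w‖) {w : E3} (hw : w ∈ P) :
    |‖A w‖ ^ 2 - ‖w‖ ^ 2| ≤ 3 * η * ‖w‖ ^ 2 := by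
  obtain ⟨ha, hb⟩ := hA w hw
  have e1 : ‖A w‖ ^ 2 ≤ ((1 + η) * ‖w‖) ^ 2 := pow_le_pow_left₀ (norm_nonneg _) ha 2
  have e2 : ‖w‖ ^ 2 ≤ ((1 + η) * ‖A w‖) ^ 2 := pow_le_pow_left₀ (norm_nonneg _) hb 2
  rw [mul_pow] at e1 e2
  have e3 : (1 + η) ^ 2 ≤ 1 + 3 * η := by nlinarith only [h0, h1]
  have hw2 : 0 ≤ ‖w‖ ^ 2 := sq_nonneg _
  have hA2 : 0 ≤ ‖A w‖ ^ 2 := sq_nonneg _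
  generalize ‖w‖ ^ 2 = r at *
  generalize ‖A w‖ ^ 2 = s at *
  have e4 : s ≤ (1 + 3 * η) * r := e1.trans (mul_le_mul_of_nonneg_right e3 hw2)
  have e5 : r ≤ (1 + 3 * η) * s := e2.trans (mul_le_mul_of_nonneg_right e3 hA2)
  rw [abs_le]
  constructor
  · by_cases hsr : s ≤ r
    · have := mul_le_mul_of_nonneg_left hsr h0
      linarith
    · have := mul_nonneg h0 hw2
      linarith
  · linarith

lemma bil_near (A : E3 →L[ℝ] E3) (P : Submodule ℝ E3) {η : ℝ} (h0 : 0 ≤ η) (h1 : η ≤ 1)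
    (hA : ∀ w ∈ P, ‖A w‖ ≤ (1 + η) * ‖w‖ ∧ ‖w‖ ≤ (1 + η) * ‖A w‖) {w z : E3} (hw : w ∈ P)
    (hz : z ∈ P) : |⟪A w, A z⟫ - ⟪w, z⟫| ≤ 3 * η * (‖w‖ * ‖z‖) := by
  have key : ∀ w ∈ P, ∀ z ∈ P, |⟪A w, A z⟫ - ⟪w, z⟫| ≤ 3 / 2 * η * (‖w‖ ^ 2 + ‖z‖ ^ 2) := by
    intro w hw z hz
    have e1 := quad_near A P h0 h1 hA (P.add_mem hw hz)
    have e2 := quad_near A P h0 h1 hA (P.sub_mem hw hz)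
    rw [map_add, norm_add_sq_real, norm_add_sq_real w z] at e1
    rw [map_sub, norm_sub_sq_real, norm_sub_sq_real w z] at e2
    rw [abs_le] at e1 e2 ⊢
    constructor <;> linarith only [e1.1, e1.2, e2.1, e2.2]
  by_cases hw0 : w = 0
  · simp [hw0]
  by_cases hz0 : z = 0
  · simp [hz0]
  have pw : 0 < ‖w‖ := norm_pos_iff.2 hw0
  have pz : 0 < ‖z‖ := norm_pos_iff.2 hz0
  have := key (‖z‖ • w) (P.smul_mem _ hw) (‖w‖ • z) (P.smul_mem _ hz)
  rw [map_smul, map_smul, real_inner_smul_left, real_inner_smul_right, real_inner_smul_left,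
    real_inner_smul_right, norm_smul, norm_smul, norm_norm, norm_norm] at this
  have e : ‖z‖ * (‖w‖ * ⟪A w, A z⟫) - ‖z‖ * (‖w‖ * ⟪w, z⟫) =
    (‖w‖ * ‖z‖) * (⟪A w, A z⟫ - ⟪w, z⟫) := by ring
  have pp : 0 < ‖w‖ * ‖z‖ := mul_pos pw pz
  rw [e, abs_mul, abs_of_pos pp] at this
  refine le_of_mul_le_mul_left ?_ pp
  refine this.trans (le_of_eq ?_)
  ring

lemma pt_est (A : E3 →L[ℝ] E3) (P : Submodule ℝ E3) {η : ℝ} (h0 : 0 ≤ η) (h1 : η ≤ 1)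
    (hA : ∀ w ∈ P, ‖A w‖ ≤ (1 + η) * ‖w‖ ∧ ‖w‖ ≤ (1 + η) * ‖A w‖)
    {u u' v v' w' : E3} (hu : u ∈ P) (hu' : u' ∈ P) (hw' : w' ∈ P) (hv' : A w' = v')
    (r : ∀ w ∈ P, ⟪u, w⟫ = ⟪v, A w⟫) (r' : ∀ w ∈ P, ⟪u', w⟫ = ⟪v', A w⟫) :
    |⟪u, u'⟫ - ⟪v, v'⟫| ≤ 12 * η * (‖v‖ * ‖v'‖) := by
  have nu : ‖u‖ ≤ 2 * ‖v‖ := by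
    by_cases hu0 : ‖u‖ = 0
    · rw [hu0]; positivity
    have pu : 0 < ‖u‖ := lt_of_le_of_ne (norm_nonneg _) (Ne.symm hu0)
    have e1 := r u hu
    rw [real_inner_self_eq_norm_sq] at e1
    have e2 := (real_inner_le_norm v (A u)).trans
      (mul_le_mul_of_nonneg_left (hA u hu).1 (norm_nonneg v))
    have e3 : (1 + η) * (‖v‖ * ‖u‖) ≤ 2 * (‖v‖ * ‖u‖) :=
      mul_le_mul_of_nonneg_right (by linarith) (by positivity)
    refine le_of_mul_le_mul_right ?_ pu
    linarith only [e1, e2, e3]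
  have nw : ‖w'‖ ≤ 2 * ‖v'‖ := by
    have := (hA w' hw').2
    rw [hv'] at this
    exact this.trans (mul_le_mul_of_nonneg_right (by linarith) (norm_nonneg _))
  have hz : u' - w' ∈ P := P.sub_mem hu' hw'
  have nz : ‖u' - w'‖ ≤ 3 * η * ‖w'‖ := by
    by_cases hz0 : ‖u' - w'‖ = 0
    · rw [hz0]; positivity
    have pz : 0 < ‖u' - w'‖ := lt_of_le_of_ne (norm_nonneg _) (Ne.symm hz0)
    have e1 : ‖u' - w'‖ ^ 2 = ⟪A w', A (u' - w')⟫ - ⟪w', u' - w'⟫ := by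
      rw [hv', ← r' _ hz, ← inner_sub_left, real_inner_self_eq_norm_sq]
    have e2 := (le_abs_self _).trans (bil_near A P h0 h1 hA hw' hz)
    rw [← e1] at e2
    refine le_of_mul_le_mul_right ?_ pz
    linarith only [e2]
  have e : ⟪u, u'⟫ - ⟪v, v'⟫ = ⟪u, u' - w'⟫ := by
    rw [inner_sub_right, r w' hw', hv']
  rw [e]
  refine (abs_real_inner_le_norm _ _).trans ?_
  calc ‖u‖ * ‖u' - w'‖ ≤ (2 * ‖v‖) * (3 * η * (2 * ‖v'‖)) := by
        refine mul_le_mul nu (nz.trans ?_) (norm_nonneg _) (by positivity)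
        exact mul_le_mul_of_nonneg_left nw (by positivity)
    _ = _ := by ring

section pt
variable {Srf : SmoothSurface} {γ₀ h : ℝ} (Tr : Triangulation Srf γ₀ h)

/-- explicit measurable version of the surface gradient -/
def gradM (f : E3 → ℝ) (X : E3) : E3 :=
  (InnerProductSpace.toDual ℝ E3).symm (fderiv ℝ (Tr.liftSh f) X) -
    ⟪Srf.n X, (InnerProductSpace.toDual ℝ E3).symm (fderiv ℝ (Tr.liftSh f) X)⟫ • Srf.n X

lemma grad_eq_gradM {t : E3 × E3 × E3} (ht : t ∈ Tr.T) {x : E3} (hx : x ∈ triI t) {K : ℝ}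
    (hK : ∀ x ∈ triOf t, ∀ y ∈ triOf t, ‖Tr.a x - Tr.a y‖ ≤ K * ‖x - y‖ ∧
      ‖x - y‖ ≤ K * ‖Tr.a x - Tr.a y‖) (f : E3 → ℝ) :
    Srf.grad f (Tr.a x) = gradM Tr f (Tr.a x) := by
  have hXS := Tr.a_mem x (tri_sub_N Tr ht hx.1)
  have hn1 : ⟪Srf.n (Tr.a x), Srf.n (Tr.a x)⟫ = (1:ℝ) := by
    rw [real_inner_self_eq_norm_sq, Srf.n_unit _ hXS]; norm_num
  have m1 : Srf.grad f (Tr.a x) ∈ Srf.tangent (Tr.a x) := tGrad_mem _ _ _ _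
  have m2 : gradM Tr f (Tr.a x) ∈ Srf.tangent (Tr.a x) := by
    unfold SmoothSurface.tangent gradM
    rw [Submodule.mem_orthogonal_singleton_iff_inner_right, inner_sub_right, inner_smul_right,
      hn1]; ring
  have m3 := Submodule.sub_mem _ m1 m2
  have e1 := grad_formula Tr ht hx hK f m3
  have e2 : ⟪gradM Tr f (Tr.a x), Srf.grad f (Tr.a x) - gradM Tr f (Tr.a x)⟫ =
      fderiv ℝ (Tr.liftSh f) (Tr.a x) (Srf.grad f (Tr.a x) - gradM Tr f (Tr.a x)) := by
    generalize Srf.grad f (Tr.a x) - gradM Tr f (Tr.a x) = z at *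
    unfold gradM
    unfold SmoothSurface.tangent at m3
    rw [Submodule.mem_orthogonal_singleton_iff_inner_right] at m3
    rw [inner_sub_left, real_inner_smul_left, m3, mul_zero, sub_zero]
    exact InnerProductSpace.toDual_symm_apply
  rw [← e2, ← sub_eq_zero, ← inner_sub_left, inner_self_eq_zero] at e1
  exact sub_eq_zero.1 e1

lemma point_est {t : E3 × E3 × E3} (ht : t ∈ Tr.T) {x : E3} (hx : x ∈ triI t) {η : ℝ}
    (h0 : 0 ≤ η) (h1 : η ≤ 1)
    (hK : ∀ x ∈ triOf t, ∀ y ∈ triOf t, ‖Tr.a x - Tr.a y‖ ≤ (1 + η) * ‖x - y‖ ∧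
      ‖x - y‖ ≤ (1 + η) * ‖Tr.a x - Tr.a y‖) (f g : E3 → ℝ) :
    |⟪gradTri t (Tr.liftSh f) x, gradTri t (Tr.liftSh g) x⟫ -
      ⟪Srf.grad f (Tr.a x), Srf.grad g (Tr.a x)⟫| ≤
      12 * η * (‖Srf.grad f (Tr.a x)‖ * ‖Srf.grad g (Tr.a x)‖) := by
  obtain ⟨w', hw', hv'⟩ := dA_surj Tr ht hx hK (v := Srf.grad g (Tr.a x)) (tGrad_mem _ _ _ _)
  exact pt_est (fderiv ℝ Tr.a x) (dirOf t) h0 h1 (fun w hw => dA_bounds Tr ht hx hK hw)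
    (tGrad_mem _ _ _ _) (tGrad_mem _ _ _ _) hw' hv' (fun w hw => grad_rel Tr ht hx hK f hw)
    (fun w hw => grad_rel Tr ht hx hK g hw)

lemma tri_inner {t : E3 × E3 × E3} (ht : t ∈ Tr.T) {x : E3} (hx : x ∈ triI t) {K : ℝ}
    (hK : ∀ x ∈ triOf t, ∀ y ∈ triOf t, ‖Tr.a x - Tr.a y‖ ≤ K * ‖x - y‖ ∧
      ‖x - y‖ ≤ K * ‖Tr.a x - Tr.a y‖) (f g : E3 → ℝ) :
    ⟪gradTri t (Tr.liftSh f) x, gradTri t (Tr.liftSh g) x⟫ =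
      ∑ i, ⟪gradM Tr f (Tr.a x), fderiv ℝ Tr.a x (stdOrthonormalBasis ℝ (dirOf t) i : E3)⟫ *
        ⟪gradM Tr g (Tr.a x), fderiv ℝ Tr.a x (stdOrthonormalBasis ℝ (dirOf t) i : E3)⟫ := by
  rw [← grad_eq_gradM Tr ht hx hK f, ← grad_eq_gradM Tr ht hx hK g]
  have mf : gradTri t (Tr.liftSh f) x ∈ dirOf t := tGrad_mem _ _ _ _
  have mg : gradTri t (Tr.liftSh g) x ∈ dirOf t := tGrad_mem _ _ _ _
  have h1 := (stdOrthonormalBasis ℝ (dirOf t)).sum_inner_mul_inner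
    ⟨gradTri t (Tr.liftSh f) x, mf⟩ ⟨gradTri t (Tr.liftSh g) x, mg⟩
  refine Eq.trans h1.symm ?_
  refine Finset.sum_congr rfl fun i _ => ?_
  have k1 := grad_rel Tr ht hx hK f (Submodule.coe_mem (stdOrthonormalBasis ℝ (dirOf t) i))
  have k2 := grad_rel Tr ht hx hK g (Submodule.coe_mem (stdOrthonormalBasis ℝ (dirOf t) i))
  rw [← k1, ← k2]
  congr 1
  exact real_inner_comm _ _

lemma n_contOn : ContinuousOn Srf.n Srf.S := by
  obtain ⟨C, hC⟩ := n_lip Srf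
  exact hC.continuousOn

lemma meas_D (f : E3 → ℝ) : Measurable
    (fun X => (InnerProductSpace.toDual ℝ E3).symm (fderiv ℝ (Tr.liftSh f) X)) :=
  (InnerProductSpace.toDual ℝ E3).symm.continuous.measurable.comp (measurable_fderiv ℝ _)

lemma gradM_meas (f : E3 → ℝ) {s : Set E3} (hs : s ⊆ Srf.S) (hm : MeasurableSet s) :
    AEMeasurable (gradM Tr f) (μH[2].restrict s) := by
  have hn : AEMeasurable Srf.n (μH[2].restrict s) :=
    (n_contOn.mono hs).aemeasurable hm
  have hD : AEMeasurable _ (μH[2].restrict s) := (meas_D Tr f).aemeasurable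
  exact hD.sub ((hn.inner (𝕜 := ℝ) hD).smul hn)

lemma gradM_meas_comp (f : E3 → ℝ) {t : E3 × E3 × E3} (ht : t ∈ Tr.T) :
    AEMeasurable (fun x => gradM Tr f (Tr.a x)) (μH[2].restrict (triOf t)) := by
  have hm : MeasurableSet (triOf t) := (triOf_compact t).isClosed.measurableSet
  have ha : AEMeasurable Tr.a (μH[2].restrict (triOf t)) := (a_cont_tri Tr ht).aemeasurable hm
  have hn : AEMeasurable (fun x => Srf.n (Tr.a x)) (μH[2].restrict (triOf t)) :=
    (n_contOn.comp (a_cont_tri Tr ht) (fun x hx => Tr.a_mem x (tri_sub_N Tr ht hx))).aemeasurable hm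
  have hD := (meas_D Tr f).comp_aemeasurable ha
  exact hD.sub ((hn.inner (𝕜 := ℝ) hD).smul hn)

lemma tri_ae {t : E3 × E3 × E3} (ht : t ∈ Tr.T) :
    ∀ᵐ x ∂(μH[2].restrict (triOf t)), x ∈ triI t := by
  have hm : MeasurableSet (triOf t) := (triOf_compact t).isClosed.measurableSet
  have h1 : ∀ᵐ x ∂(μH[2] : Measure E3), x ∉ triE t := by
    rw [ae_iff]; simpa using triE_null t
  filter_upwards [ae_restrict_mem hm, ae_restrict_of_ae h1] with x hx hE
  rw [triOf_diff t (Tr.indep t ht)]; exact ⟨hx, hE⟩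

lemma tri_inner_meas {t : E3 × E3 × E3} (ht : t ∈ Tr.T) {K : ℝ}
    (hK : ∀ x ∈ triOf t, ∀ y ∈ triOf t, ‖Tr.a x - Tr.a y‖ ≤ K * ‖x - y‖ ∧
      ‖x - y‖ ≤ K * ‖Tr.a x - Tr.a y‖) (f g : E3 → ℝ) :
    AEMeasurable (fun x => ⟪gradTri t (Tr.liftSh f) x, gradTri t (Tr.liftSh g) x⟫)
      (μH[2].restrict (triOf t)) := by
  have h1 : AEMeasurable (fun x =>
      ∑ i, ⟪gradM Tr f (Tr.a x), fderiv ℝ Tr.a x (stdOrthonormalBasis ℝ (dirOf t) i : E3)⟫ *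
        ⟪gradM Tr g (Tr.a x), fderiv ℝ Tr.a x (stdOrthonormalBasis ℝ (dirOf t) i : E3)⟫)
      (μH[2].restrict (triOf t)) := by
    refine Finset.aemeasurable_fun_sum _ fun i _ => ?_
    have hd := (measurable_fderiv_apply_const ℝ Tr.a
      (stdOrthonormalBasis ℝ (dirOf t) i : E3)).aemeasurable (μ := μH[2].restrict (triOf t))
    exact ((gradM_meas_comp Tr f ht).inner hd).mul ((gradM_meas_comp Tr g ht).inner hd)
  refine h1.congr ?_
  filter_upwards [tri_ae Tr ht] with x hx
  exact (tri_inner Tr ht hx hK f g).symm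

lemma img_meas {t : E3 × E3 × E3} (ht : t ∈ Tr.T) : MeasurableSet (Tr.a '' triOf t) :=
  ((triOf_compact t).image_of_continuousOn (a_cont_tri Tr ht)).isClosed.measurableSet

lemma img_sub {t : E3 × E3 × E3} (ht : t ∈ Tr.T) : Tr.a '' triOf t ⊆ Srf.S := by
  rintro _ ⟨x, hx, rfl⟩; exact Tr.a_mem x (tri_sub_N Tr ht hx)

lemma triE_sub (t : E3 × E3 × E3) (hi : AffineIndependent ℝ ![t.1, t.2.1, t.2.2]) {x : E3}
    (hx : x ∈ triOf t) (hn : x ∉ triI t) : x ∈ triE t := by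
  by_contra hc; apply hn; rw [triOf_diff t hi]; exact ⟨hx, hc⟩

lemma img_null {t : E3 × E3 × E3} {K : ℝ}
    (hK : ∀ x ∈ triOf t, ∀ y ∈ triOf t, ‖Tr.a x - Tr.a y‖ ≤ K * ‖x - y‖ ∧
      ‖x - y‖ ≤ K * ‖Tr.a x - Tr.a y‖) : μH[2] (Tr.a '' (triE t ∩ triOf t)) = 0 := by
  have hL : LipschitzOnWith K.toNNReal Tr.a (triE t ∩ triOf t) := by
    refine LipschitzOnWith.of_dist_le_mul fun x hx y hy => ?_
    rw [dist_eq_norm, dist_eq_norm]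
    refine ((hK x hx.2 y hy.2).1).trans ?_
    exact mul_le_mul_of_nonneg_right (Real.le_coe_toNNReal K) (norm_nonneg _)
  have h1 := hL.hausdorffMeasure_image_le (d := 2) (by norm_num)
  have h2 : μH[2] (triE t ∩ triOf t) = 0 := measure_mono_null Set.inter_subset_left (triE_null t)
  rw [h2, mul_zero] at h1
  exact le_antisymm h1 zero_le

lemma img_ae {t : E3 × E3 × E3} (ht : t ∈ Tr.T) {K : ℝ}
    (hK : ∀ x ∈ triOf t, ∀ y ∈ triOf t, ‖Tr.a x - Tr.a y‖ ≤ K * ‖x - y‖ ∧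
      ‖x - y‖ ≤ K * ‖Tr.a x - Tr.a y‖) :
    ∀ᵐ X ∂(μH[2].restrict (Tr.a '' triOf t)), ∃ x ∈ triI t, Tr.a x = X := by
  have h1 : ∀ᵐ X ∂(μH[2] : Measure E3), X ∉ Tr.a '' (triE t ∩ triOf t) := by
    rw [ae_iff]; simp only [not_not, Set.ofPred_mem_eq]; exact img_null Tr hK
  filter_upwards [ae_restrict_mem (img_meas Tr ht), ae_restrict_of_ae h1] with X hX hE
  obtain ⟨x, hx, rfl⟩ := hX
  refine ⟨x, ?_, rfl⟩
  by_contra hc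
  exact hE ⟨x, ⟨triE_sub t (Tr.indep t ht) hx hc, hx⟩, rfl⟩

lemma grad_meas {t : E3 × E3 × E3} (ht : t ∈ Tr.T) {K : ℝ}
    (hK : ∀ x ∈ triOf t, ∀ y ∈ triOf t, ‖Tr.a x - Tr.a y‖ ≤ K * ‖x - y‖ ∧
      ‖x - y‖ ≤ K * ‖Tr.a x - Tr.a y‖) (f : E3 → ℝ) :
    AEMeasurable (Srf.grad f) (μH[2].restrict (Tr.a '' triOf t)) := by
  refine (gradM_meas Tr f (img_sub Tr ht) (img_meas Tr ht)).congr ?_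
  filter_upwards [img_ae Tr ht hK] with X hX
  obtain ⟨x, hx, rfl⟩ := hX
  exact (grad_eq_gradM Tr ht hx hK f).symm

lemma img_disj {t t' : E3 × E3 × E3} (ht : t ∈ Tr.T) (ht' : t' ∈ Tr.T) (hne : t ≠ t') {K : ℝ}
    (hK : ∀ x ∈ triOf t, ∀ y ∈ triOf t, ‖Tr.a x - Tr.a y‖ ≤ K * ‖x - y‖ ∧
      ‖x - y‖ ≤ K * ‖Tr.a x - Tr.a y‖) :
    AEDisjoint μH[2] (Tr.a '' triOf t) (Tr.a '' triOf t') := by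
  refine measure_mono_null ?_ (img_null Tr hK)
  rintro _ ⟨⟨x, hx, rfl⟩, y, hy, hyx⟩
  have : y = x := Tr.a_bij.injOn (Set.mem_biUnion ht' hy) (Set.mem_biUnion ht hx) hyx
  subst this
  refine ⟨y, ⟨triE_sub t (Tr.indep t ht) hx fun hc => ?_, hx⟩, rfl⟩
  exact triI_not_mem Tr ht ht' hne hc hy

lemma S_restrict {K : ℝ}
    (hK : ∀ t ∈ Tr.T, ∀ x ∈ triOf t, ∀ y ∈ triOf t, ‖Tr.a x - Tr.a y‖ ≤ K * ‖x - y‖ ∧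
      ‖x - y‖ ≤ K * ‖Tr.a x - Tr.a y‖) :
    (μH[2] : Measure E3).restrict Srf.S =
      Measure.sum (fun t : Tr.T => (μH[2] : Measure E3).restrict (Tr.a '' triOf t.1)) := by
  rw [← Measure.restrict_iUnion_ae]
  · congr 1
    rw [← Tr.a_bij.image_eq, Set.image_iUnion₂]
    ext X; simp
  · intro t t' hne
    exact img_disj Tr t.2 t'.2 (fun hc => hne (Subtype.ext hc)) (hK t.1 t.2)
  · intro t; exact (img_meas Tr t.2).nullMeasurableSet

end pt

lemma int_le_of_le {α : Type*} [MeasurableSpace α] {μ ν : Measure α} {k : ℝ} (hk : 0 ≤ k)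
    (h : ν ≤ ENNReal.ofReal k • μ) {P : α → ℝ} (hP : ∀ x, 0 ≤ P x) (hi : Integrable P μ) :
    ∫ x, P x ∂ν ≤ k * ∫ x, P x ∂μ := by
  have h1 : ∫ x, P x ∂ν ≤ ∫ x, P x ∂(ENNReal.ofReal k • μ) :=
    integral_mono_measure h (Filter.Eventually.of_forall hP)
      (hi.smul_measure ENNReal.ofReal_ne_top)
  rwa [integral_smul_measure, ENNReal.toReal_ofReal hk, smul_eq_mul] at h1

lemma int_compare {α : Type*} [MeasurableSpace α] {μ ν : Measure α} {η : ℝ} (h0 : 0 ≤ η)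
    (h1 : η ≤ 1) (hνμ : ν ≤ ENNReal.ofReal ((1 + η) ^ 2) • μ)
    (hμν : μ ≤ ENNReal.ofReal ((1 + η) ^ 2) • ν) {F : α → ℝ} (hF : Integrable F μ) :
    |∫ x, F x ∂ν - ∫ x, F x ∂μ| ≤ 12 * η * ∫ x, |F x| ∂μ := by
  have hFν : Integrable F ν := hF.of_measure_le_smul ENNReal.ofReal_ne_top hνμ
  have hk0 : (0:ℝ) ≤ (1 + η) ^ 2 := sq_nonneg _
  have hk : (1 + η) ^ 2 ≤ 1 + 3 * η := by nlinarith only [h0, h1]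
  have key : ∀ P : α → ℝ, (∀ x, 0 ≤ P x) → Integrable P μ → Integrable P ν →
      |∫ x, P x ∂ν - ∫ x, P x ∂μ| ≤ 12 * η * ∫ x, P x ∂μ := by
    intro P hP hPμ hPν
    have a1 := int_le_of_le hk0 hνμ hP hPμ
    have a2 := int_le_of_le hk0 hμν hP hPν
    have p1 : 0 ≤ ∫ x, P x ∂μ := integral_nonneg hP
    have p2 : 0 ≤ ∫ x, P x ∂ν := integral_nonneg hP
    generalize ∫ x, P x ∂μ = r at *
    generalize ∫ x, P x ∂ν = s at *
    have b1 : s ≤ (1 + 3 * η) * r := a1.trans (mul_le_mul_of_nonneg_right hk p1)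
    have b2 : r ≤ (1 + 3 * η) * s := a2.trans (mul_le_mul_of_nonneg_right hk p2)
    have b3 : s ≤ 4 * r := b1.trans (mul_le_mul_of_nonneg_right (by linarith) p1)
    have b4 := mul_le_mul_of_nonneg_left b3 h0
    have b5 := mul_nonneg h0 p1
    rw [abs_le]; constructor <;> linarith only [b1, b2, b4, b5]
  have q1 := key (fun x => max (F x) 0) (fun x => le_max_right _ _) hF.pos_part hFν.pos_part
  have q2 := key (fun x => max (-F x) 0) (fun x => le_max_right _ _) hF.neg_part hFν.neg_part
  have e1 := integral_eq_integral_pos_part_sub_integral_neg_part hF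
  have e2 := integral_eq_integral_pos_part_sub_integral_neg_part hFν
  have e3 : ∫ x, |F x| ∂μ = ∫ x, max (F x) 0 ∂μ + ∫ x, max (-F x) 0 ∂μ := by
    rw [← integral_add hF.pos_part hF.neg_part]
    refine integral_congr_ae (Filter.Eventually.of_forall fun x => ?_)
    rcases le_total 0 (F x) with hx | hx
    · simp [abs_of_nonneg hx, hx]
    · simp [abs_of_nonpos hx, hx]
  simp only [Real.coe_toNNReal'] at e1 e2
  rw [e1, e2, e3]
  rw [abs_le] at q1 q2 ⊢
  constructor <;> linarith only [q1.1, q1.2, q2.1, q2.2]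

section pt
variable {Srf : SmoothSurface} {γ₀ h : ℝ} (Tr : Triangulation Srf γ₀ h)

lemma map_compare {t : E3 × E3 × E3} (ht : t ∈ Tr.T) {K : ℝ} (hK0 : 0 ≤ K)
    (hK : ∀ x ∈ triOf t, ∀ y ∈ triOf t, ‖Tr.a x - Tr.a y‖ ≤ K * ‖x - y‖ ∧
      ‖x - y‖ ≤ K * ‖Tr.a x - Tr.a y‖) :
    ((μH[2] : Measure E3).restrict (triOf t)).map Tr.a ≤
      ENNReal.ofReal (K ^ 2) • (μH[2] : Measure E3).restrict (Tr.a '' triOf t) ∧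
    (μH[2] : Measure E3).restrict (Tr.a '' triOf t) ≤
      ENNReal.ofReal (K ^ 2) • ((μH[2] : Measure E3).restrict (triOf t)).map Tr.a := by
  have hm : MeasurableSet (triOf t) := (triOf_compact t).isClosed.measurableSet
  have ha : AEMeasurable Tr.a (μH[2].restrict (triOf t)) := (a_cont_tri Tr ht).aemeasurable hm
  have hKK : ((K.toNNReal : ℝ≥0∞)) ^ (2:ℝ) = ENNReal.ofReal (K ^ 2) := by
    rw [ENNReal.rpow_two, ENNReal.ofReal_pow hK0]; rfl
  let b : E3 → E3 := Function.invFunOn Tr.a (triOf t)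
  have hbm : ∀ Y ∈ Tr.a '' triOf t, b Y ∈ triOf t ∧ Tr.a (b Y) = Y := fun Y hY =>
    ⟨Function.invFunOn_mem hY, Function.invFunOn_eq hY⟩
  have hinj : Set.InjOn Tr.a (triOf t) :=
    Tr.a_bij.injOn.mono (Set.subset_biUnion_of_mem (u := triOf) ht)
  have hLa : LipschitzOnWith K.toNNReal Tr.a (triOf t) := by
    refine LipschitzOnWith.of_dist_le_mul fun x hx y hy => ?_
    rw [dist_eq_norm, dist_eq_norm, Real.coe_toNNReal K hK0]
    exact (hK x hx y hy).1
  have hLb : LipschitzOnWith K.toNNReal b (Tr.a '' triOf t) := by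
    refine LipschitzOnWith.of_dist_le_mul fun X hX Y hY => ?_
    rw [dist_eq_norm, dist_eq_norm, Real.coe_toNNReal K hK0]
    have := (hK _ (hbm X hX).1 _ (hbm Y hY).1).2
    rwa [(hbm X hX).2, (hbm Y hY).2] at this
  constructor
  · rw [Measure.le_iff]
    intro B hB
    rw [Measure.map_apply_of_aemeasurable ha hB, Measure.restrict_apply' hm, Measure.smul_apply,
      Measure.restrict_apply' (img_meas Tr ht), smul_eq_mul, ← hKK]
    have hs : Tr.a ⁻¹' B ∩ triOf t ⊆ b '' (B ∩ Tr.a '' triOf t) := by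
      rintro x ⟨hxB, hx⟩
      refine ⟨Tr.a x, ⟨hxB, x, hx, rfl⟩, ?_⟩
      have := hbm (Tr.a x) ⟨x, hx, rfl⟩
      exact hinj this.1 hx this.2
    exact (measure_mono hs).trans
      ((hLb.mono Set.inter_subset_right).hausdorffMeasure_image_le (by norm_num))
  · rw [Measure.le_iff]
    intro B hB
    rw [Measure.smul_apply, Measure.map_apply_of_aemeasurable ha hB, Measure.restrict_apply' hm,
      Measure.restrict_apply' (img_meas Tr ht), smul_eq_mul, ← hKK]
    have hs : B ∩ Tr.a '' triOf t ⊆ Tr.a '' (Tr.a ⁻¹' B ∩ triOf t) := by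
      rintro _ ⟨hxB, x, hx, rfl⟩
      exact ⟨x, ⟨hxB, hx⟩, rfl⟩
    exact (measure_mono hs).trans
      ((hLa.mono Set.inter_subset_right).hausdorffMeasure_image_le (by norm_num))

lemma tri_est {t : E3 × E3 × E3} (ht : t ∈ Tr.T) {η : ℝ} (h0 : 0 ≤ η) (h1 : η ≤ 1)
    (hK : ∀ x ∈ triOf t, ∀ y ∈ triOf t, ‖Tr.a x - Tr.a y‖ ≤ (1 + η) * ‖x - y‖ ∧
      ‖x - y‖ ≤ (1 + η) * ‖Tr.a x - Tr.a y‖) (f g : E3 → ℝ)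
    (hH : Integrable (fun X => ‖Srf.grad f X‖ * ‖Srf.grad g X‖)
      ((μH[2] : Measure E3).restrict (Tr.a '' triOf t))) :
    |(∫ X in Tr.a '' triOf t, ⟪Srf.grad f X, Srf.grad g X⟫ ∂μH[2]) -
      ∫ x in triOf t, ⟪gradTri t (Tr.liftSh f) x, gradTri t (Tr.liftSh g) x⟫ ∂μH[2]| ≤
      60 * η * ∫ X in Tr.a '' triOf t, ‖Srf.grad f X‖ * ‖Srf.grad g X‖ ∂μH[2] := by
  have hm : MeasurableSet (triOf t) := (triOf_compact t).isClosed.measurableSet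
  have ha : AEMeasurable Tr.a (μH[2].restrict (triOf t)) := (a_cont_tri Tr ht).aemeasurable hm
  obtain ⟨hνμ, hμν⟩ := map_compare Tr ht (by linarith) hK
  have hF : Integrable (fun X => (⟪Srf.grad f X, Srf.grad g X⟫ : ℝ))
      ((μH[2] : Measure E3).restrict (Tr.a '' triOf t)) := by
    refine hH.mono' ((grad_meas Tr ht hK f).inner (grad_meas Tr ht hK g)).aestronglyMeasurable ?_
    exact Filter.Eventually.of_forall fun X => by
      rw [Real.norm_eq_abs]; exact abs_real_inner_le_norm _ _
  have hFν := hF.of_measure_le_smul ENNReal.ofReal_ne_top hνμ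
  have hHν := hH.of_measure_le_smul ENNReal.ofReal_ne_top hνμ
  have hFt : Integrable (fun x => (⟪Srf.grad f (Tr.a x), Srf.grad g (Tr.a x)⟫ : ℝ))
      (μH[2].restrict (triOf t)) :=
    (integrable_map_measure hFν.aestronglyMeasurable ha).1 hFν
  have hHt : Integrable (fun x => ‖Srf.grad f (Tr.a x)‖ * ‖Srf.grad g (Tr.a x)‖)
      (μH[2].restrict (triOf t)) :=
    (integrable_map_measure hHν.aestronglyMeasurable ha).1 hHν
  have eF := integral_map ha hFν.aestronglyMeasurable
  have eH := integral_map ha hHν.aestronglyMeasurable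
  have hae : ∀ᵐ x ∂(μH[2].restrict (triOf t)),
      ‖⟪gradTri t (Tr.liftSh f) x, gradTri t (Tr.liftSh g) x⟫ -
      (⟪Srf.grad f (Tr.a x), Srf.grad g (Tr.a x)⟫ : ℝ)‖ ≤
      12 * η * (‖Srf.grad f (Tr.a x)‖ * ‖Srf.grad g (Tr.a x)‖) := by
    filter_upwards [tri_ae Tr ht] with x hx
    rw [Real.norm_eq_abs]
    exact point_est Tr ht hx h0 h1 hK f g
  have hU : Integrable (fun x => (⟪gradTri t (Tr.liftSh f) x, gradTri t (Tr.liftSh g) x⟫ : ℝ) -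
      ⟪Srf.grad f (Tr.a x), Srf.grad g (Tr.a x)⟫) (μH[2].restrict (triOf t)) :=
    (hHt.const_mul (12 * η)).mono'
      ((tri_inner_meas Tr ht hK f g).sub hFt.aestronglyMeasurable.aemeasurable).aestronglyMeasurable
      hae
  have hUt : Integrable (fun x => (⟪gradTri t (Tr.liftSh f) x, gradTri t (Tr.liftSh g) x⟫ : ℝ))
      (μH[2].restrict (triOf t)) := by
    refine (hU.add hFt).congr (Filter.Eventually.of_forall fun x => ?_)
    simp
  have s1 := norm_integral_le_of_norm_le (hHt.const_mul (12 * η)) hae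
  rw [integral_sub hUt hFt, integral_const_mul, ← eF, ← eH, Real.norm_eq_abs] at s1
  have s2 := int_compare h0 h1 hνμ hμν hF
  have s3 := int_le_of_le (sq_nonneg _) hνμ
    (P := fun X => ‖Srf.grad f X‖ * ‖Srf.grad g X‖) (fun X => by positivity) hH
  have s4 : ∫ X in Tr.a '' triOf t, |(⟪Srf.grad f X, Srf.grad g X⟫ : ℝ)| ∂μH[2] ≤
      ∫ X in Tr.a '' triOf t, ‖Srf.grad f X‖ * ‖Srf.grad g X‖ ∂μH[2] :=
    integral_mono hF.abs hH (fun X => abs_real_inner_le_norm _ _)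
  have p : 0 ≤ ∫ X in Tr.a '' triOf t, ‖Srf.grad f X‖ * ‖Srf.grad g X‖ ∂μH[2] :=
    integral_nonneg (fun X => by positivity)
  generalize (∫ X in Tr.a '' triOf t, ‖Srf.grad f X‖ * ‖Srf.grad g X‖ ∂μH[2]) = I at *
  have hk : (1 + η) ^ 2 ≤ 4 := by nlinarith only [h0, h1]
  have s5 := mul_le_mul_of_nonneg_left (s3.trans (mul_le_mul_of_nonneg_right hk p)) h0
  have s6 := mul_le_mul_of_nonneg_left s4 h0
  rw [abs_le] at s1 s2 ⊢
  constructor <;> linarith only [s1.1, s1.2, s2.1, s2.2, s5, s6]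

lemma total_est {η : ℝ} (h0 : 0 < η) (h1 : η ≤ 1)
    (hK : ∀ t ∈ Tr.T, ∀ x ∈ triOf t, ∀ y ∈ triOf t, ‖Tr.a x - Tr.a y‖ ≤ (1 + η) * ‖x - y‖ ∧
      ‖x - y‖ ≤ (1 + η) * ‖Tr.a x - Tr.a y‖) (f g : E3 → ℝ) :
    ENNReal.ofReal |(∫ X in Srf.S, ⟪Srf.grad f X, Srf.grad g X⟫ ∂μH[2]) -
      ∑ t ∈ Tr.T, ∫ x in triOf t,
        ⟪gradTri t (Tr.liftSh f) x, gradTri t (Tr.liftSh g) x⟫ ∂μH[2]| ≤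
      ENNReal.ofReal (60 * η) *
        ∫⁻ X in Srf.S, ENNReal.ofReal (‖Srf.grad f X‖ * ‖Srf.grad g X‖) ∂μH[2] := by
  by_cases htop : ∫⁻ X in Srf.S, ENNReal.ofReal (‖Srf.grad f X‖ * ‖Srf.grad g X‖) ∂μH[2] = ∞
  · rw [htop, ENNReal.mul_top (by simpa using h0)]; exact le_top
  have hmf : ∀ f : E3 → ℝ, AEMeasurable (Srf.grad f) ((μH[2] : Measure E3).restrict Srf.S) := by
    intro f
    rw [S_restrict Tr hK, aemeasurable_sum_measure_iff]
    exact fun t => grad_meas Tr t.2 (hK t.1 t.2) f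
  have hH : Integrable (fun X => ‖Srf.grad f X‖ * ‖Srf.grad g X‖)
      ((μH[2] : Measure E3).restrict Srf.S) := by
    refine ⟨((hmf f).norm.mul (hmf g).norm).aestronglyMeasurable, ?_⟩
    rw [hasFiniteIntegral_iff_ofReal (Filter.Eventually.of_forall fun X => by positivity)]
    exact lt_top_iff_ne_top.2 htop
  have hF : Integrable (fun X => (⟪Srf.grad f X, Srf.grad g X⟫ : ℝ))
      ((μH[2] : Measure E3).restrict Srf.S) := by
    refine hH.mono' ((hmf f).inner (hmf g)).aestronglyMeasurable ?_
    exact Filter.Eventually.of_forall fun X => by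
      rw [Real.norm_eq_abs]; exact abs_real_inner_le_norm _ _
  rw [← ofReal_integral_eq_lintegral_ofReal hH
    (Filter.Eventually.of_forall fun X => by positivity),
    ← ENNReal.ofReal_mul (by positivity)]
  refine ENNReal.ofReal_le_ofReal ?_
  have hsub : ∀ t ∈ Tr.T, Tr.a '' triOf t ⊆ Srf.S := fun t ht => img_sub Tr ht
  have hHi : ∀ G : E3 → ℝ, Integrable G ((μH[2] : Measure E3).restrict Srf.S) →
      ∫ X in Srf.S, G X ∂μH[2] = ∑ t ∈ Tr.T, ∫ X in Tr.a '' triOf t, G X ∂μH[2] := by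
    intro G hG
    rw [S_restrict Tr hK] at hG ⊢
    rw [integral_sum_measure hG, tsum_fintype]
    exact Finset.sum_coe_sort Tr.T (fun t => ∫ X in Tr.a '' triOf t, G X ∂μH[2])
  rw [hHi _ hF, hHi _ hH, ← Finset.sum_sub_distrib, Finset.mul_sum]
  refine (Finset.abs_sum_le_sum_abs _ _).trans (Finset.sum_le_sum fun t ht => ?_)
  exact tri_est Tr ht h0.le h1 (hK t ht) f g
    (hH.mono_measure (Measure.restrict_mono_set _ (hsub t ht)))

lemma grad_meas_S {K : ℝ}
    (hK : ∀ t ∈ Tr.T, ∀ x ∈ triOf t, ∀ y ∈ triOf t, ‖Tr.a x - Tr.a y‖ ≤ K * ‖x - y‖ ∧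
      ‖x - y‖ ≤ K * ‖Tr.a x - Tr.a y‖) (f : E3 → ℝ) :
    AEMeasurable (Srf.grad f) ((μH[2] : Measure E3).restrict Srf.S) := by
  rw [S_restrict Tr hK, aemeasurable_sum_measure_iff]
  exact fun t => grad_meas Tr t.2 (hK t.1 t.2) f

end pt

lemma W1p_top (Srf : SmoothSurface) (f : E3 → ℝ) :
    ∀ᵐ X ∂((μH[2] : Measure E3).restrict Srf.S),
      ENNReal.ofReal ‖Srf.grad f X‖ ≤ W1pNorm Srf f ∞ := by
  unfold W1pNorm
  rw [if_pos rfl]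
  filter_upwards [ENNReal.ae_le_essSup (μ := (μH[2] : Measure E3).restrict Srf.S)
    (fun x => ENNReal.ofReal (max |f x| ‖Srf.grad f x‖))] with X hX
  exact (ENNReal.ofReal_le_ofReal (le_max_right _ _)).trans hX

lemma W1p_fin (Srf : SmoothSurface) (f : E3 → ℝ) (p : ℝ≥0∞) (hp : p ≠ ∞) (h1 : 1 ≤ p) :
    (∫⁻ X in Srf.S, ENNReal.ofReal ‖Srf.grad f X‖ ^ p.toReal ∂μH[2]) ^ (1 / p.toReal) ≤
      W1pNorm Srf f p := by
  unfold W1pNorm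
  rw [if_neg hp]
  refine ENNReal.rpow_le_rpow (lintegral_mono fun X => ?_) (by positivity)
  rw [ENNReal.ofReal_rpow_of_nonneg (norm_nonneg _) ENNReal.toReal_nonneg]
  refine ENNReal.ofReal_le_ofReal ?_
  have : 0 ≤ |f X| ^ p.toReal := by positivity
  linarith

lemma W1p_one (Srf : SmoothSurface) (f : E3 → ℝ) :
    ∫⁻ X in Srf.S, ENNReal.ofReal ‖Srf.grad f X‖ ∂μH[2] ≤ W1pNorm Srf f 1 := by
  have := W1p_fin Srf f 1 ENNReal.one_ne_top le_rfl
  simpa using this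

lemma holder_one (Srf : SmoothSurface) (f g : E3 → ℝ)
    (hf : AEMeasurable (Srf.grad f) ((μH[2] : Measure E3).restrict Srf.S)) :
    ∫⁻ X in Srf.S, ENNReal.ofReal ‖Srf.grad f X‖ * ENNReal.ofReal ‖Srf.grad g X‖ ∂μH[2] ≤
      W1pNorm Srf f 1 * W1pNorm Srf g ∞ := by
  calc _ ≤ ∫⁻ X in Srf.S, ENNReal.ofReal ‖Srf.grad f X‖ * W1pNorm Srf g ∞ ∂μH[2] := by
        refine lintegral_mono_ae ?_
        filter_upwards [W1p_top Srf g] with X hX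
        gcongr
    _ = (∫⁻ X in Srf.S, ENNReal.ofReal ‖Srf.grad f X‖ ∂μH[2]) * W1pNorm Srf g ∞ :=
        lintegral_mul_const'' _ hf.norm.ennreal_ofReal
    _ ≤ _ := by gcongr; exact W1p_one Srf f

lemma holder_W (Srf : SmoothSurface) (f g : E3 → ℝ) (p q : ℝ≥0∞) (hp : 1 ≤ p)
    (hpq : p⁻¹ + q⁻¹ = 1)
    (hf : AEMeasurable (Srf.grad f) ((μH[2] : Measure E3).restrict Srf.S))
    (hg : AEMeasurable (Srf.grad g) ((μH[2] : Measure E3).restrict Srf.S)) :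
    ∫⁻ X in Srf.S, ENNReal.ofReal (‖Srf.grad f X‖ * ‖Srf.grad g X‖) ∂μH[2] ≤
      W1pNorm Srf f p * W1pNorm Srf g q := by
  simp only [ENNReal.ofReal_mul (norm_nonneg _)]
  by_cases hpt : p = ∞
  · have hq : q = 1 := by
      rw [hpt, ENNReal.inv_top, zero_add, ENNReal.inv_eq_one] at hpq; exact hpq
    subst hpt hq
    rw [mul_comm (W1pNorm Srf f ∞)]
    simp only [mul_comm (ENNReal.ofReal ‖Srf.grad f _‖)]
    exact holder_one Srf g f hg
  by_cases hqt : q = ∞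
  · have hp1 : p = 1 := by
      rw [hqt, ENNReal.inv_top, add_zero, ENNReal.inv_eq_one] at hpq; exact hpq
    subst hqt hp1
    exact holder_one Srf f g hf
  have hq1 : 1 ≤ q := by
    rw [← ENNReal.inv_le_one, ← hpq]; exact le_add_self
  have hc : p.toReal.HolderConjugate q.toReal := by
    have : ENNReal.HolderConjugate p q := ENNReal.holderConjugate_iff.2 hpq
    refine ENNReal.HolderConjugate.toReal_of_ne_top ?_ ?_ <;> assumption
  refine (ENNReal.lintegral_mul_le_Lp_mul_Lq _ hc hf.norm.ennreal_ofReal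
    hg.norm.ennreal_ofReal).trans ?_
  exact mul_le_mul' (W1p_fin Srf f p hpt hp) (W1p_fin Srf g q hqt hq1)

/-- **Comparison of Dirichlet integrals over `S` and `S_h`.**
`|∫_S ⟨∇_S f, ∇_S g⟩ − ∫_{S_h} ⟨∇_{S_h} f̃, ∇_{S_h} g̃⟩| ≤ c h² ‖f‖_{W^{1,p}} ‖g‖_{W^{1,p*}}`
for Lipschitz `f, g` and Hölder conjugate exponents `1 ≤ p, p* ≤ ∞`, with `c` independent
of `p`. -/
theorem dirichlet_integral_comparison (Srf : SmoothSurface) (γ₀ : ℝ) (hγ₀ : 0 < γ₀) :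
    ∃ c > 0, ∃ h₀ > 0,
      ∀ p q : ℝ≥0∞, 1 ≤ p → p⁻¹ + q⁻¹ = 1 →
        ∀ h : ℝ, 0 < h → h ≤ h₀ →
          ∀ Tr : Triangulation Srf γ₀ h, ∀ f g : E3 → ℝ,
            (∃ K : ℝ≥0, LipschitzOnWith K f Srf.S) →
            (∃ K : ℝ≥0, LipschitzOnWith K g Srf.S) →
            ENNReal.ofReal
                |(∫ x in Srf.S, ⟪Srf.grad f x, Srf.grad g x⟫ ∂μH[2]) -
                  ∑ t ∈ Tr.T, ∫ x in triOf t,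
                    ⟪gradTri t (Tr.liftSh f) x, gradTri t (Tr.liftSh g) x⟫ ∂μH[2]| ≤
              ENNReal.ofReal (c * h ^ 2) * W1pNorm Srf f p * W1pNorm Srf g q := by
  obtain ⟨M, hM, h₀, hh₀, hb⟩ := bilip Srf γ₀ hγ₀
  refine ⟨60 * M, by positivity, h₀, hh₀, ?_⟩
  intro p q hp hpq h hh hhh Tr f g _ _
  obtain ⟨hη, hK⟩ := hb h hh hhh
  have hη0 : 0 < M * h ^ 2 := by positivity
  have hKT := hK Tr
  refine (total_est Tr hη0 hη hKT f g).trans ?_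
  rw [← mul_assoc 60, mul_assoc (ENNReal.ofReal _)]
  exact mul_le_mul_right (holder_W Srf f g p q hp hpq (grad_meas_S Tr hKT f)
    (grad_meas_S Tr hKT g)) _

end
end
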